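/- arXiv:1509.07098 — 2 statements merged into one kernel-verified Lean document; each statement's English description precedes it below -/
import Mathlib

section
/- Consider quadratic pairs (K,c) (a quadratic field K together with c ∈ K) such that f_c admits both a fixed point in K and a point of preperiodic type 2₃ in K. Then: (i) for every such pair, c ∈ ℚ; (ii) the set S of rational numbers q such that some quadratic pair (K,c) with c the image of q in K has this property contains −21/16 (realized over K = ℚ(√17)); and (iii) S has at most four elements. -/
/-- The quadratic map `z ↦ z ^ 2 + c`. -/
def fc {K : Type*} [Field K] (c : K) : K → K := fun z => z ^ 2 + c

/-- `α` has exact period `m` under `fc c`. -/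
def HasExactPeriod {K : Type*} [Field K] (c : K) (m : ℕ) (α : K) : Prop :=
  (fc c)^[m] α = α ∧ ∀ j : ℕ, 1 ≤ j → j < m → (fc c)^[j] α ≠ α

/-- `α` has preperiodic type `m_n` under `fc c`: preperiod exactly `n`, eventual period `m`. -/
def HasPreperiodicType {K : Type*} [Field K] (c : K) (m n : ℕ) (α : K) : Prop :=
  HasExactPeriod c m ((fc c)^[n] α) ∧ (fc c)^[n + m - 1] α ≠ (fc c)^[n - 1] α

/-- `(K, q)` is a quadratic pair (with `q` rational) admitting a fixed point
and a point of preperiodic type `2₃`. -/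
def RealizesG4 (q : ℚ) (K : Type) [Field K] [NumberField K] : Prop :=
  Module.finrank ℚ K = 2 ∧
    (∃ α : K, HasExactPeriod (q : K) 1 α) ∧
    (∃ β : K, HasPreperiodicType (q : K) 2 3 β)

/-- `K` contains a square root of `17`. -/
def ContainsSqrt17 (K : Type) [Field K] : Prop := ∃ s : K, s ^ 2 = 17

/-- The set of rational `q` realized as the `c`-value of some quadratic pair
admitting a fixed point and a point of type `2₃`. -/
def G4RatSet : Set ℚ :=
  {q : ℚ | ∃ (K : Type) (iF : Field K) (iN : @NumberField K iF), @RealizesG4 q K iF iN}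

/-- A nonnegative factor of a square that is coprime to its cofactor is a square. -/
lemma Int.exists_sq_of_isCoprime_of_nonneg {a b c : ℤ} (h : IsCoprime a b) (hab : a * b = c ^ 2)
    (ha : 0 ≤ a) : ∃ d, a = d ^ 2 := by
  obtain ⟨d, hd | hd⟩ := Int.sq_of_isCoprime h hab
  · exact ⟨d, hd⟩
  · exact ⟨0, by nlinarith [sq_nonneg d]⟩

lemma isCoprime_of_prime_not_dvd {a b : ℤ} (h : ∀ p : ℤ, Prime p → p ∣ a → p ∣ b → False) :
    IsCoprime a b := by
  rw [Int.isCoprime_iff_gcd_eq_one]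
  by_contra hne
  obtain ⟨p, hp, hpd⟩ := Nat.exists_prime_and_dvd hne
  have hd : (p : ℤ) ∣ (Int.gcd a b : ℤ) := Int.natCast_dvd_natCast.mpr hpd
  exact h p (Nat.prime_iff_prime_int.mp hp) (hd.trans (Int.gcd_dvd_left ..))
    (hd.trans (Int.gcd_dvd_right ..))

/-- The quadratic forms `h² + 16f²` and `h² + 17f²` are discordant. -/
theorem not_concordant_sixteen_seventeen (N : ℕ) : ∀ h f g e : ℤ, f.natAbs = N → f ≠ 0 →
    g ^ 2 = h ^ 2 + 16 * f ^ 2 → e ^ 2 = h ^ 2 + 17 * f ^ 2 → False := by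
  induction N using Nat.strong_induction_on with
  | _ N ih =>
  -- the essential case, with signs normalized
  have key : ∀ h f g e : ℤ, f.natAbs = N → f ≠ 0 → IsCoprime h f → 0 < g → 0 < e → 17 ∣ e - h →
      g ^ 2 = h ^ 2 + 16 * f ^ 2 → e ^ 2 = h ^ 2 + 17 * f ^ 2 → False := by
    intro h f g e hfN hf hco hg he h17 h1 h2
    obtain ⟨k, hk⟩ := h17
    have hf2 : 0 < f ^ 2 := by positivity
    have hgh : 0 < g + h := by nlinarith
    have hgh' : 0 < g - h := by nlinarith
    have heh : 0 < e + h := by nlinarith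
    have heg : 0 < e - g := by nlinarith
    have noprime : ∀ p : ℤ, Prime p → p ∣ h → p ∣ f → False := fun p hp hph hpf =>
      hp.not_isUnit (hco.isUnit_of_dvd' hph hpf)
    rcases Int.even_or_odd h with heven | hodd
    · -- `h` even
      have hfodd : Odd f := by
        rw [← Int.not_even_iff_odd]
        intro hfe'
        exact noprime 2 Int.prime_two heven.two_dvd hfe'.two_dvd
      obtain ⟨h', rfl⟩ := heven.two_dvd
      obtain ⟨f', hf'⟩ := hfodd
      have hge : Even g := by
        have : Even (g ^ 2) := ⟨2 * h' ^ 2 + 8 * f ^ 2, by rw [h1]; ring⟩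
        exact (Int.even_pow.mp this).1
      obtain ⟨g', rfl⟩ := hge.two_dvd
      have heo : Odd e := by
        rw [← Int.not_even_iff_odd]
        rintro ⟨e', rfl⟩
        have : (2:ℤ) ∣ 1 := ⟨2 * e' ^ 2 - 2 * h' ^ 2 - 34 * f' ^ 2 - 34 * f' - 8, by
          subst hf'; linarith⟩
        norm_num at this
      have hh'e : Even h' := by
        by_contra hno
        obtain ⟨a, ha⟩ := Int.not_even_iff_odd.mp hno
        have e8 : e ^ 2 % 8 = 1 := by
          obtain ⟨b, hb⟩ := heo
          obtain ⟨c, hc⟩ := Int.even_mul_succ_self b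
          have : e ^ 2 = 8 * c + 1 := by subst hb; linarith
          omega
        obtain ⟨c, hc⟩ := Int.even_mul_succ_self f'
        obtain ⟨c', hc'⟩ := Int.even_mul_succ_self a
        have : e ^ 2 = 8 * (17 * c + 4 * c' + 2) + 5 := by subst hf' ha; linarith
        omega
      obtain ⟨h'', rfl⟩ := hh'e.two_dvd
      have hg'e : Even g' := by
        have : Even (g' ^ 2) := ⟨2 * h'' ^ 2 + 2 * f ^ 2, by linarith⟩
        exact (Int.even_pow.mp this).1
      obtain ⟨g'', rfl⟩ := hg'e.two_dvd
      have odd_of_dvd : ∀ p : ℤ, p ∣ f → p ∣ 2 → Prime p → False := by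
        intro p hpf hp2 hp
        have : p ∣ 1 := by
          have := dvd_sub hpf (hp2.mul_right f')
          rwa [hf', add_sub_cancel_left] at this
        exact hp.not_isUnit (isUnit_of_dvd_one this)
      obtain ⟨β, hβ⟩ : ∃ β, e + 2 * (2 * g'') = β ^ 2 := by
        refine Int.exists_sq_of_isCoprime_of_nonneg (b := e - 2 * (2 * g'')) (c := f)
          (isCoprime_of_prime_not_dvd fun p hp hpa hpb => ?_) (by linarith) (by linarith)
        have hpf : p ∣ f := hp.dvd_of_dvd_pow (n := 2) (by
          have : f ^ 2 = (e + 2 * (2 * g'')) * (e - 2 * (2 * g'')) := by linarith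
          rw [this]; exact hpa.mul_right _)
        have hpg : p ∣ 2 * (2 * (2 * g'')) := by
          have := dvd_sub hpa hpb; ring_nf at this ⊢; exact this
        have hpg'' : p ∣ g'' := by
          rcases hp.dvd_or_dvd hpg with h | h
          · exact (odd_of_dvd p hpf h hp).elim
          rcases hp.dvd_or_dvd h with h | h
          · exact (odd_of_dvd p hpf h hp).elim
          rcases hp.dvd_or_dvd h with h | h
          · exact (odd_of_dvd p hpf h hp).elim
          exact h
        have : p ∣ h'' := hp.dvd_of_dvd_pow (n := 2) (by
          have : h'' ^ 2 = g'' * g'' - f * f := by linarith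
          rw [this]; exact dvd_sub (hpg''.mul_right _) (hpf.mul_right _))
        exact noprime p hp ((this.mul_left 2).mul_left 2) hpf
      obtain ⟨α, hα⟩ : ∃ α, e + 2 * (2 * h'') = α ^ 2 := by
        have hprod : (e + 2 * (2 * h'')) * k = f ^ 2 := by
          have : 17 * ((e + 2 * (2 * h'')) * k) = 17 * f ^ 2 := by
            rw [mul_left_comm, ← hk]; linarith
          linarith
        refine Int.exists_sq_of_isCoprime_of_nonneg (b := k) (c := f)
          (isCoprime_of_prime_not_dvd fun p hp hpa hpb => ?_) hprod heh.le
        have hpf : p ∣ f := hp.dvd_of_dvd_pow (n := 2) (hprod ▸ hpa.mul_right _)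
        have hpg : p ∣ 2 * (2 * (2 * h'')) := by
          have := dvd_sub hpa (hpb.mul_left 17); rw [← hk] at this; ring_nf at this ⊢; exact this
        rcases hp.dvd_or_dvd hpg with h | h
        · exact odd_of_dvd p hpf h hp
        · exact noprime p hp h hpf
      have hfac : (g'' + h'') * (g'' - h'') = f ^ 2 := by linarith
      have hco' : IsCoprime (g'' - h'') (g'' + h'') := by
        refine isCoprime_of_prime_not_dvd fun p hp hpb hpa => ?_
        have hpf : p ∣ f := hp.dvd_of_dvd_pow (n := 2) (hfac ▸ hpa.mul_right _)
        have hpg : p ∣ 2 * h'' := by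
          have := dvd_sub hpa hpb; ring_nf at this ⊢; exact this
        exact noprime p hp (hpg.mul_left 2) hpf
      obtain ⟨γ, hγ⟩ : ∃ γ, g'' - h'' = γ ^ 2 :=
        Int.exists_sq_of_isCoprime_of_nonneg (c := f) hco' (by linarith) (by linarith)
      have hγo : Odd γ := by
        rw [← Int.not_even_iff_odd]
        intro hγe
        refine odd_of_dvd 2 (Int.prime_two.dvd_of_dvd_pow (n := 2) ?_) dvd_rfl Int.prime_two
        rw [← hfac, hγ]
        exact (dvd_pow hγe.two_dvd two_ne_zero).mul_left _
      have hαo : Odd α := by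
        have : Odd (α ^ 2) := by rw [← hα]; exact heo.add_even (even_two_mul _)
        exact (Int.odd_pow' two_ne_zero).mp this
      have hβo : Odd β := by
        have : Odd (β ^ 2) := by rw [← hβ]; exact heo.add_even (even_two_mul _)
        exact (Int.odd_pow' two_ne_zero).mp this
      have e1 : β ^ 2 - α ^ 2 = 4 * γ ^ 2 := by linarith
      have odd_sq : ∀ x : ℤ, Odd x → ∃ y, x ^ 2 = 8 * y + 1 := by
        rintro x ⟨b, rfl⟩
        obtain ⟨c, hc⟩ := Int.even_mul_succ_self b
        exact ⟨c, by linarith⟩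
      obtain ⟨a, ha⟩ := odd_sq α hαo
      obtain ⟨b, hb⟩ := odd_sq β hβo
      obtain ⟨c, hc⟩ := odd_sq γ hγo
      omega
    · -- `h` odd
      obtain ⟨a, ha⟩ := hodd
      have hgo : Odd g := by
        have : Odd (g ^ 2) := by
          rw [h1, ha]; exact ⟨2 * a ^ 2 + 2 * a + 8 * f ^ 2, by ring⟩
        exact (Int.odd_pow' two_ne_zero).mp this
      obtain ⟨b, hb⟩ := hgo
      have hfe : Even f := by
        by_contra hno
        obtain ⟨f', hf'⟩ := Int.not_even_iff_odd.mp hno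
        have hee : Even (e ^ 2) :=
          ⟨2 * a ^ 2 + 2 * a + 34 * f' ^ 2 + 34 * f' + 9, by rw [h2, ha, hf']; ring⟩
        obtain ⟨e', rfl⟩ := (Int.even_pow.mp hee).1
        obtain ⟨c, hc⟩ := Int.even_mul_succ_self f'
        obtain ⟨c', hc'⟩ := Int.even_mul_succ_self a
        have : 4 * e' ^ 2 = 8 * (17 * c + c' + 2) + 2 := by subst hf' ha; linarith
        omega
      obtain ⟨f₁, rfl⟩ := hfe.two_dvd
      have heo : Odd e := by
        have : Odd (e ^ 2) := by
          rw [h2, ha]; exact ⟨2 * a ^ 2 + 2 * a + 34 * f₁ ^ 2, by ring⟩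
        exact (Int.odd_pow' two_ne_zero).mp this
      obtain ⟨c, hc⟩ := heo
      obtain ⟨k', rfl⟩ : ∃ k', k = 2 * k' := by
        have : (2 : ℤ) ∣ k := by omega
        exact this
      have hprod : (a + c + 1) * k' = f₁ ^ 2 := by
        have hk' : (e + h) * (e - h) = 17 * (2 * f₁) ^ 2 := by linarith
        rw [hk] at hk'
        have : e + h = 2 * (a + c + 1) := by linarith
        rw [this] at hk'
        linarith
      have hprod' : (b + c + 1) * (c - b) = f₁ ^ 2 := by
        subst hb hc; linarith
      have hprod'' : (a + b + 1) * (b - a) = (4 * f₁) ^ 2 := by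
        subst ha hb; linarith
      obtain ⟨α, hα⟩ : ∃ α, a + c + 1 = α ^ 2 := by
        refine Int.exists_sq_of_isCoprime_of_nonneg (b := k') (c := f₁)
          (isCoprime_of_prime_not_dvd fun p hp hpa hpb => ?_) hprod (by linarith)
        have hpf : p ∣ f₁ := hp.dvd_of_dvd_pow (n := 2) (hprod ▸ hpa.mul_right _)
        refine noprime p hp ?_ (hpf.mul_left 2)
        have : h = a + c + 1 - 17 * k' := by linarith
        rw [this]; exact dvd_sub hpa (hpb.mul_left _)
      obtain ⟨β, hβ⟩ : ∃ β, b + c + 1 = β ^ 2 := by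
        refine Int.exists_sq_of_isCoprime_of_nonneg (b := c - b) (c := f₁)
          (isCoprime_of_prime_not_dvd fun p hp hpa hpb => ?_) hprod' (by linarith)
        have hpf : p ∣ f₁ := hp.dvd_of_dvd_pow (n := 2) (hprod' ▸ hpa.mul_right _)
        refine noprime p hp (hp.dvd_of_dvd_pow (n := 2) ?_) (hpf.mul_left 2)
        have hpg : p ∣ g := by
          have : g = b + c + 1 - (c - b) := by linarith
          rw [this]; exact dvd_sub hpa hpb
        have : h ^ 2 = g * g - f₁ * (64 * f₁) := by linarith
        rw [this]; exact dvd_sub (hpg.mul_right _) (hpf.mul_right _)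
      obtain ⟨γ, hγ⟩ : ∃ γ, a + b + 1 = γ ^ 2 := by
        refine Int.exists_sq_of_isCoprime_of_nonneg (b := b - a) (c := 4 * f₁)
          (isCoprime_of_prime_not_dvd fun p hp hpa hpb => ?_) hprod'' (by linarith)
        have hph : p ∣ h := by
          have : h = a + b + 1 - (b - a) := by linarith
          rw [this]; exact dvd_sub hpa hpb
        have hpf : p ∣ 4 * f₁ := hp.dvd_of_dvd_pow (n := 2) (hprod'' ▸ hpa.mul_right _)
        have h4 : 4 * f₁ = 2 * (2 * f₁) := by ring
        rw [h4] at hpf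
        rcases hp.dvd_or_dvd hpf with h2' | hpf
        · refine hp.not_isUnit (isUnit_of_dvd_one ?_)
          have := dvd_sub hph (h2'.mul_right a)
          rwa [ha, add_sub_cancel_left] at this
        · exact noprime p hp hph hpf
      have hf₁ : f₁ ≠ 0 := by rintro rfl; simp at hf
      refine ih f₁.natAbs (by omega) (α * γ) f₁ (β * γ) (α * β) rfl hf₁ ?_ ?_
      · rw [mul_pow, mul_pow, ← hα, ← hβ, ← hγ]; linarith
      · rw [mul_pow, mul_pow, ← hα, ← hβ, ← hγ]
        have : 17 * k' = c - a := by linarith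
        linear_combination 17 * hprod - (a + c + 1) * this
  intro h f g e hfN hf h1 h2
  by_cases hco : IsCoprime h f
  · have hf2 : 0 < f ^ 2 := by positivity
    have hg0 : 0 < |g| := abs_pos.mpr (by rintro rfl; nlinarith [sq_nonneg h])
    have he0 : 0 < |e| := abs_pos.mpr (by rintro rfl; nlinarith [sq_nonneg h])
    have hp17 : Prime (17 : ℤ) := Int.prime_iff_natAbs_prime.mpr (by norm_num)
    have hdvd : (17 : ℤ) ∣ (|e| - h) * (|e| + h) := ⟨f ^ 2, by nlinarith [sq_abs e]⟩
    rcases hp17.dvd_or_dvd hdvd with hd | hd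
    · exact key h f |g| |e| hfN hf hco hg0 he0 hd (by rw [sq_abs, h1]) (by rw [sq_abs, h2])
    · exact key (-h) f |g| |e| hfN hf hco.neg_left hg0 he0 (by rwa [sub_neg_eq_add])
        (by rw [sq_abs, h1]; ring) (by rw [sq_abs, h2]; ring)
  · obtain ⟨p, hp, ⟨h', rfl⟩, ⟨f', rfl⟩⟩ : ∃ p : ℤ, Prime p ∧ p ∣ h ∧ p ∣ f := by
      by_contra! hno
      exact hco (isCoprime_of_prime_not_dvd hno)
    obtain ⟨g', rfl⟩ : p ∣ g := (Int.pow_dvd_pow_iff two_ne_zero).mp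
      ⟨h' ^ 2 + 16 * f' ^ 2, by rw [h1]; ring⟩
    obtain ⟨e', rfl⟩ : p ∣ e := (Int.pow_dvd_pow_iff two_ne_zero).mp
      ⟨h' ^ 2 + 17 * f' ^ 2, by rw [h2]; ring⟩
    have hp2 : p ^ 2 ≠ 0 := pow_ne_zero 2 hp.ne_zero
    have hf' : f' ≠ 0 := right_ne_zero_of_mul hf
    refine ih f'.natAbs ?_ h' f' g' e' rfl hf' (mul_left_cancel₀ hp2 (by linear_combination h1))
      (mul_left_cancel₀ hp2 (by linear_combination h2))
    rw [← hfN, Int.natAbs_mul]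
    have := (Int.prime_iff_natAbs_prime.mp hp).two_le
    have := Int.natAbs_pos.mpr hf'
    nlinarith

/-- The rational points on `z² = t⁴ - 2t³ + 3t² + 2t + 1`. -/
theorem eq_zero_of_sq_eq_quartic_fixed (t z : ℚ)
    (h : z ^ 2 = t ^ 4 - 2 * t ^ 3 + 3 * t ^ 2 + 2 * t + 1) : t = 0 := by
  have no17 : ∀ x : ℚ, x ^ 2 ≠ 17 := by
    intro x hx
    have hsq : IsSquare ((17 : ℕ) : ℚ) := ⟨x, by push_cast; linarith [sq x]⟩
    rw [Rat.isSquare_natCast_iff] at hsq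
    obtain ⟨n, hn⟩ := hsq
    have : n < 5 := by nlinarith
    interval_cases n <;> omega
  by_contra ht
  obtain ⟨k, hk⟩ : ∃ k, k = (z + t ^ 2 - t - 1) / 2 := ⟨_, rfl⟩
  have hz : z = 2 * k - (t ^ 2 - t - 1) := by rw [hk]; ring
  have hkt : k ^ 2 - t ^ 2 = k * (t ^ 2 - t - 1) := by
    rw [hz] at h; linarith
  have hk0 : k ≠ 0 := by
    rintro rfl
    exact ht (by simpa using hkt)
  obtain ⟨Y, hY⟩ : ∃ Y, Y = 2 * t * (k + 1) - k := ⟨_, rfl⟩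
  have hY2 : Y ^ 2 = k * (4 * k ^ 2 + 9 * k + 4) := by
    rw [hY]; linear_combination (-4 * (k + 1)) * hkt
  have hkm1 : k ≠ -1 := by
    rintro rfl
    exact ht (by linarith)
  have hk1 : k ≠ 1 := by
    rintro rfl
    exact no17 Y (by rw [hY2]; norm_num)
  have hquad : 4 * k ^ 2 + 9 * k + 4 ≠ 0 := fun h0 =>
    no17 (8 * k + 9) (by linear_combination 16 * h0)
  have hY0 : Y ≠ 0 := by
    rintro rfl
    exact mul_ne_zero hk0 hquad (by rw [← hY2]; norm_num)
  obtain ⟨X, hX⟩ : ∃ X, X = 4 * (k - 1) ^ 2 / k := ⟨_, rfl⟩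
  obtain ⟨W, hW⟩ : ∃ W, W = 4 * Y * (k ^ 2 - 1) / k ^ 2 := ⟨_, rfl⟩
  have hW0 : W ≠ 0 := by
    have : k ^ 2 - 1 ≠ 0 := fun h0 => by
      have : (k - 1) * (k + 1) = 0 := by linarith
      rcases mul_eq_zero.mp this with h | h
      · exact hk1 (by linarith)
      · exact hkm1 (by linarith)
    rw [hW]; positivity
  have hWX : W ^ 2 = X * (X + 16) * (X + 17) := by
    rw [hW, hX, div_pow, mul_pow, mul_pow, hY2]; field_simp; ring
  obtain ⟨ρ, hρ⟩ : ∃ ρ, ρ = (X ^ 2 - 272) / (2 * W) := ⟨_, rfl⟩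
  have h16 : ρ ^ 2 + 16 = ((X ^ 2 + 32 * X + 272) / (2 * W)) ^ 2 := by
    rw [hρ]; field_simp; rw [hWX]; ring
  have h17 : ρ ^ 2 + 17 = ((X ^ 2 + 34 * X + 272) / (2 * W)) ^ 2 := by
    rw [hρ]; field_simp; rw [hWX]; ring
  have clear : ∀ n : ℤ, ∀ r : ℚ, ρ ^ 2 + n = r ^ 2 →
      ∃ g : ℤ, g ^ 2 = ρ.num ^ 2 + n * (ρ.den : ℤ) ^ 2 := by
    intro n r hr
    have hd : (ρ.den : ℚ) ≠ 0 := by exact_mod_cast ρ.den_nz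
    have hsq : IsSquare ((ρ.num ^ 2 + n * (ρ.den : ℤ) ^ 2 : ℤ) : ℚ) := by
      refine ⟨r * ρ.den, ?_⟩
      have hnd : ρ * ρ.den = ρ.num := Rat.mul_den_eq_num ρ
      push_cast
      rw [← hnd]
      linear_combination (ρ.den : ℚ) ^ 2 * hr
    obtain ⟨g, hg⟩ := Rat.isSquare_intCast_iff.mp hsq
    exact ⟨g, by rw [hg, sq]⟩
  obtain ⟨g, hg⟩ := clear 16 _ (by exact_mod_cast h16)
  obtain ⟨e, he⟩ := clear 17 _ (by exact_mod_cast h17)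
  exact not_concordant_sixteen_seventeen _ ρ.num ρ.den g e rfl
    (by exact_mod_cast ρ.den_nz) hg he

section CubicField

open NumberField Module

variable {L : Type*} [Field L] [NumberField L]

lemma cubic_repr (b : Basis (Fin 3) ℚ L) {φ : L} (hb : ⇑b = ![1, φ, φ ^ 2]) (x : L) :
    ∃ x₀ x₁ x₂ : ℚ, x = x₀ + x₁ * φ + x₂ * φ ^ 2 := by
  refine ⟨b.repr x 0, b.repr x 1, b.repr x 2, ?_⟩
  conv_lhs => rw [← b.sum_repr x]
  simp [Fin.sum_univ_three, hb, Algebra.smul_def]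

lemma cubic_repr_unique (b : Basis (Fin 3) ℚ L) {φ : L} (hb : ⇑b = ![1, φ, φ ^ 2])
    {x₀ x₁ x₂ : ℚ} (h : (x₀ : L) + x₁ * φ + x₂ * φ ^ 2 = 0) : x₀ = 0 ∧ x₁ = 0 ∧ x₂ = 0 := by
  have := Fintype.linearIndependent_iff.mp b.linearIndependent ![x₀, x₁, x₂]
    (by simpa [Fin.sum_univ_three, hb, Algebra.smul_def] using h)
  exact ⟨this 0, this 1, this 2⟩

lemma cubic_leftMulMatrix (b : Basis (Fin 3) ℚ L) {φ : L} (hb : ⇑b = ![1, φ, φ ^ 2])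
    (hφ : φ ^ 3 = 2 * φ ^ 2 - 2) (x₀ x₁ x₂ : ℚ) :
    Algebra.leftMulMatrix b ((x₀ : L) + x₁ * φ + x₂ * φ ^ 2) =
      !![x₀, -2 * x₂, -2 * x₁ - 4 * x₂;
         x₁, x₀, -2 * x₂;
         x₂, x₁ + 2 * x₂, x₀ + 2 * x₁ + 4 * x₂] := by
  have h0 : b 0 = 1 := by rw [hb]; rfl
  have h1 : b 1 = φ := by rw [hb]; rfl
  have h2 : b 2 = φ ^ 2 := by rw [hb]; rfl
  have key : ∀ (y : L) (y₀ y₁ y₂ : ℚ), y = y₀ + y₁ * φ + y₂ * φ ^ 2 →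
      ⇑(b.repr y) = ![y₀, y₁, y₂] := by
    intro y y₀ y₁ y₂ hy
    rw [← b.equivFun_apply]
    apply b.equivFun.symm.injective
    rw [LinearEquiv.symm_apply_apply, b.equivFun_symm_apply, hy]
    simp [Fin.sum_univ_three, h0, h1, h2, Algebra.smul_def]
  ext i j
  rw [Algebra.leftMulMatrix_eq_repr_mul]
  fin_cases j
  · change b.repr (_ * b 0) i = _
    rw [h0, key _ x₀ x₁ x₂ (by ring)]
    fin_cases i <;> rfl
  · change b.repr (_ * b 1) i = _
    rw [h1, key _ (-2 * x₂) x₀ (x₁ + 2 * x₂) (by push_cast; linear_combination x₂ * hφ)]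
    fin_cases i <;> rfl
  · change b.repr (_ * b 2) i = _
    rw [h2, key _ (-2 * x₁ - 4 * x₂) (-2 * x₂) (x₀ + 2 * x₁ + 4 * x₂)
      (by push_cast; linear_combination (x₁ + x₂ * φ + 2 * x₂) * hφ)]
    fin_cases i <;> rfl

lemma cubic_norm (b : Basis (Fin 3) ℚ L) {φ : L} (hb : ⇑b = ![1, φ, φ ^ 2])
    (hφ : φ ^ 3 = 2 * φ ^ 2 - 2) (x₀ x₁ x₂ : ℚ) :
    Algebra.norm ℚ ((x₀ : L) + x₁ * φ + x₂ * φ ^ 2) =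
      !![x₀, -2 * x₂, -2 * x₁ - 4 * x₂;
         x₁, x₀, -2 * x₂;
         x₂, x₁ + 2 * x₂, x₀ + 2 * x₁ + 4 * x₂].det := by
  rw [Algebra.norm_eq_matrix_det b, cubic_leftMulMatrix b hb hφ]

lemma cubic_trace (b : Basis (Fin 3) ℚ L) {φ : L} (hb : ⇑b = ![1, φ, φ ^ 2])
    (hφ : φ ^ 3 = 2 * φ ^ 2 - 2) (x₀ x₁ x₂ : ℚ) :
    Algebra.trace ℚ L ((x₀ : L) + x₁ * φ + x₂ * φ ^ 2) = 3 * x₀ + 2 * x₁ + 4 * x₂ := by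
  rw [Algebra.trace_eq_matrix_trace b, cubic_leftMulMatrix b hb hφ]
  simp [Matrix.trace, Fin.sum_univ_three]
  ring

lemma cubic_discr (b : Basis (Fin 3) ℚ L) {φ : L} (hb : ⇑b = ![1, φ, φ ^ 2])
    (hφ : φ ^ 3 = 2 * φ ^ 2 - 2) : Algebra.discr ℚ b = -44 := by
  have tr : ∀ (y : L) (y₀ y₁ y₂ : ℚ), y = y₀ + y₁ * φ + y₂ * φ ^ 2 →
      Algebra.trace ℚ L y = 3 * y₀ + 2 * y₁ + 4 * y₂ := by
    rintro y y₀ y₁ y₂ rfl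
    exact cubic_trace b hb hφ y₀ y₁ y₂
  have h0 : b 0 = 1 := by rw [hb]; rfl
  have h1 : b 1 = φ := by rw [hb]; rfl
  have h2 : b 2 = φ ^ 2 := by rw [hb]; rfl
  have t0 := tr 1 1 0 0 (by push_cast; ring)
  have t1 := tr φ 0 1 0 (by push_cast; ring)
  have t2 := tr (φ ^ 2) 0 0 1 (by push_cast; ring)
  have t3 := tr (φ ^ 3) (-2) 0 2 (by push_cast; linear_combination hφ)
  have t4 := tr (φ ^ 4) (-4) (-2) 4 (by push_cast; linear_combination (φ + 2) * hφ)
  rw [Algebra.discr_def, Matrix.det_fin_three]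
  simp only [Algebra.traceMatrix_apply, Algebra.traceForm_apply, h0, h1, h2, one_mul, mul_one]
  rw [show φ * φ = φ ^ 2 by ring, show φ * φ ^ 2 = φ ^ 3 by ring, show φ ^ 2 * φ = φ ^ 3 by ring,
    show φ ^ 2 * φ ^ 2 = φ ^ 4 by ring, t0, t1, t2, t3, t4]
  norm_num

lemma cubic_numberField_discr (b : Basis (Fin 3) ℚ L) {φ : L} (hb : ⇑b = ![1, φ, φ ^ 2])
    (hφ : φ ^ 3 = 2 * φ ^ 2 - 2) : discr L < 0 ∧ |discr L| ≤ 44 := by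
  have h_integral : IsIntegral ℤ φ := by
    refine ⟨Polynomial.X ^ 3 - 2 * Polynomial.X ^ 2 + 2, ?_, ?_⟩
    · monicity!
    · simp [hφ]
  have hfr : finrank ℚ L = 3 := by simpa using finrank_eq_card_basis b
  have hcard : Fintype.card (Free.ChooseBasisIndex ℤ (𝓞 L)) = 3 := by
    rw [← finrank_eq_card_chooseBasisIndex, RingOfIntegers.rank, hfr]
  let e := Fintype.equivFinOfCardEq hcard
  let ω : Basis (Fin 3) ℚ L := (integralBasis L).reindex e
  have hω : Algebra.discr ℚ ω = discr L := by
    rw [coe_discr, show (⇑ω) = integralBasis L ∘ e.symm from Basis.coe_reindex _ _]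
    exact Algebra.discr_reindex ℚ (integralBasis L) e
  have hbint : ∀ i, IsIntegral ℤ (b i) := by
    intro i
    rw [hb]
    fin_cases i
    · exact isIntegral_one
    · exact h_integral
    · exact h_integral.pow 2
  have hP : ∀ i j, ∃ n : ℤ, ω.toMatrix b i j = n := by
    intro i j
    refine ⟨(RingOfIntegers.basis L).repr ⟨b j, hbint j⟩ (e.symm i), ?_⟩
    rw [Basis.toMatrix_apply, Basis.repr_reindex_apply]
    exact integralBasis_repr_apply (K := L) ⟨b j, hbint j⟩ (e.symm i)
  choose P hP using hP
  have hdet : (ω.toMatrix b).det = ((Matrix.of P).det : ℤ) := by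
    have : ω.toMatrix b = (Matrix.of P).map (Int.castRingHom ℚ) := by
      ext i j; simp [hP]
    rw [this, ← RingHom.mapMatrix_apply, ← RingHom.map_det]; rfl
  have hd := Algebra.discr_of_matrix_vecMul (A := ℚ) (⇑ω) (ω.toMatrix b)
  rw [Basis.toMatrix_map_vecMul, cubic_discr b hb hφ, hdet, hω] at hd
  have hd' : (-44 : ℤ) = (Matrix.of P).det ^ 2 * discr L := by exact_mod_cast hd
  set k := (Matrix.of P).det
  have hk : 1 ≤ k ^ 2 := by
    by_contra hk
    have : k ^ 2 = 0 := by nlinarith [sq_nonneg k]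
    rw [this] at hd'; norm_num at hd'
  have hneg : discr L < 0 := by nlinarith
  refine ⟨hneg, ?_⟩
  rw [abs_of_neg hneg]
  nlinarith

lemma cubic_nrComplexPlaces (b : Basis (Fin 3) ℚ L) {φ : L} (hb : ⇑b = ![1, φ, φ ^ 2])
    (hφ : φ ^ 3 = 2 * φ ^ 2 - 2) :
    InfinitePlace.nrComplexPlaces L = 1 ∧ InfinitePlace.nrRealPlaces L = 1 := by
  have hfr : finrank ℚ L = 3 := by simpa using finrank_eq_card_basis b
  have h := InfinitePlace.card_add_two_mul_card_eq_rank L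
  have hs := sign_discr L
  rw [Int.sign_eq_neg_one_of_neg (cubic_numberField_discr b hb hφ).1] at hs
  have : InfinitePlace.nrComplexPlaces L ≠ 0 := by
    intro h0; rw [h0] at hs; norm_num at hs
  omega

lemma cubic_isPrincipalIdealRing (b : Basis (Fin 3) ℚ L) {φ : L} (hb : ⇑b = ![1, φ, φ ^ 2])
    (hφ : φ ^ 3 = 2 * φ ^ 2 - 2) : IsPrincipalIdealRing (𝓞 L) := by
  have hfr : finrank ℚ L = 3 := by simpa using finrank_eq_card_basis b
  apply RingOfIntegers.isPrincipalIdealRing_of_abs_discr_lt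
  rw [(cubic_nrComplexPlaces b hb hφ).1, hfr]
  have h := (cubic_numberField_discr b hb hφ).2
  have h' : ((|discr L| : ℤ) : ℝ) ≤ 44 := by exact_mod_cast h
  refine h'.trans_lt ?_
  have hpi := Real.pi_gt_d2
  norm_num [Nat.factorial]
  nlinarith

/-- Infinite descent by divisibility of all coordinates by a fixed integer. -/
lemma Int.eq_zero_of_descent {p : ℤ} (hp : 2 ≤ p) (S : ℤ → ℤ → ℤ → ℤ → Prop)
    (hS : ∀ x y z D, S x y z D → ∃ x' y' z' D', D = p * D' ∧ S x' y' z' D')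
    {x y z D : ℤ} (h : S x y z D) : D = 0 := by
  by_contra hD
  induction hN : D.natAbs using Nat.strong_induction_on generalizing x y z D with
  | _ N ih =>
  obtain ⟨x', y', z', D', rfl, h'⟩ := hS x y z D h
  have hD' : D' ≠ 0 := right_ne_zero_of_mul hD
  refine ih D'.natAbs ?_ h' hD' rfl
  rw [← hN, Int.natAbs_mul]
  have := Int.natAbs_pos.mpr hD'
  have : 2 ≤ p.natAbs := by omega
  nlinarith

lemma cubic_int_repr (b : Basis (Fin 3) ℚ L) {φ : L} (hb : ⇑b = ![1, φ, φ ^ 2]) (γ : L) :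
    ∃ x y z D : ℤ, D ≠ 0 ∧ D * γ = x + y * φ + z * φ ^ 2 := by
  obtain ⟨r, s, t, rfl⟩ := cubic_repr b hb γ
  refine ⟨r.num * s.den * t.den, s.num * r.den * t.den, t.num * r.den * s.den,
    r.den * s.den * t.den, ?_, ?_⟩
  · have := r.den_nz
    have := s.den_nz
    have := t.den_nz
    positivity
  · have h (q : ℚ) : (q : L) * q.den = q.num := by exact_mod_cast Rat.mul_den_eq_num q
    push_cast
    rw [← h r, ← h s, ← h t]
    ring

lemma cubic_int_repr_unique (b : Basis (Fin 3) ℚ L) {φ : L} (hb : ⇑b = ![1, φ, φ ^ 2])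
    {x y z : ℤ} (h : (x : L) + y * φ + z * φ ^ 2 = 0) : x = 0 ∧ y = 0 ∧ z = 0 := by
  have := cubic_repr_unique b hb (x₀ := x) (x₁ := y) (x₂ := z) (by exact_mod_cast h)
  exact_mod_cast this

lemma cubic_norm_eq (b : Basis (Fin 3) ℚ L) {φ : L} (hb : ⇑b = ![1, φ, φ ^ 2])
    (hφ : φ ^ 3 = 2 * φ ^ 2 - 2) (y : L) (x₀ x₁ x₂ : ℚ) (hy : y = x₀ + x₁ * φ + x₂ * φ ^ 2) :
    Algebra.norm ℚ y = x₀ ^ 3 - 2 * x₁ ^ 3 + 4 * x₂ ^ 3 + 2 * x₀ ^ 2 * x₁ + 4 * x₀ ^ 2 * x₂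
      - 4 * x₁ ^ 2 * x₂ + 6 * x₀ * x₁ * x₂ + 8 * x₀ * x₂ ^ 2 := by
  rw [hy, cubic_norm b hb hφ, Matrix.det_fin_three]
  simp only [Matrix.of_apply, Matrix.cons_val]
  ring

lemma cubic_one_sub_ne_sq (b : Basis (Fin 3) ℚ L) {φ : L} (hb : ⇑b = ![1, φ, φ ^ 2])
    (hφ : φ ^ 3 = 2 * φ ^ 2 - 2) (γ : L) : 1 - φ ≠ γ ^ 2 := by
  intro h
  obtain ⟨x, y, z, D, hD, hγ⟩ := cubic_int_repr b hb γ
  have h2 : (D : L) ^ 2 * (1 - φ) = (x + y * φ + z * φ ^ 2) ^ 2 := by rw [h, ← hγ]; ring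
  obtain ⟨h0, h1, h2⟩ := cubic_int_repr_unique b hb (x := x ^ 2 - 4 * y * z - 4 * z ^ 2 - D ^ 2)
    (y := 2 * x * y - 2 * z ^ 2 + D ^ 2) (z := y ^ 2 + 2 * x * z + 4 * y * z + 4 * z ^ 2) (by
      push_cast
      linear_combination -h2 - (2 * y * z + z ^ 2 * φ + 2 * z ^ 2) * hφ)
  refine hD (Int.eq_zero_of_descent le_rfl (fun x y z D : ℤ =>
    x ^ 2 - 4 * y * z - 4 * z ^ 2 - D ^ 2 = 0 ∧ 2 * x * y - 2 * z ^ 2 + D ^ 2 = 0 ∧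
    y ^ 2 + 2 * x * z + 4 * y * z + 4 * z ^ 2 = 0) ?_ ⟨h0, h1, h2⟩)
  rintro x y z D ⟨h0, h1, h2⟩
  have even {a c : ℤ} (h : a ^ 2 = 2 * c) : ∃ a', a = 2 * a' :=
    Int.prime_two.dvd_of_dvd_pow (n := 2) ⟨c, h⟩
  obtain ⟨D, rfl⟩ := even (a := D) (c := z ^ 2 - x * y) (by linarith)
  obtain ⟨y, rfl⟩ := even (a := y) (c := - (x * z + 2 * y * z + 2 * z ^ 2)) (by linarith)
  obtain ⟨x, rfl⟩ := even (a := x) (c := 4 * y * z + 2 * z ^ 2 + 2 * D ^ 2) (by linarith)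
  obtain ⟨z, rfl⟩ := even (a := z) (c := 2 * x * y + D ^ 2) (by linarith)
  exact ⟨x, y, z, D, rfl, by linarith, by linarith, by linarith⟩

lemma cubic_units (b : Basis (Fin 3) ℚ L) {Φ : 𝓞 L}
    (hb : ⇑b = ![1, algebraMap (𝓞 L) L Φ, algebraMap (𝓞 L) L Φ ^ 2])
    (hφ : algebraMap (𝓞 L) L Φ ^ 3 = 2 * algebraMap (𝓞 L) L Φ ^ 2 - 2) (u : (𝓞 L)ˣ) :
    ∃ w : L, w ≠ 0 ∧ ((Algebra.norm ℚ (algebraMap (𝓞 L) L u) : L) * algebraMap (𝓞 L) L u = w ^ 2 ∨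
      (Algebra.norm ℚ (algebraMap (𝓞 L) L u) : L) * algebraMap (𝓞 L) L u =
        (1 - algebraMap (𝓞 L) L Φ) * w ^ 2) := by
  have hΦ : Φ ^ 3 = 2 * Φ ^ 2 - 2 := by
    apply RingOfIntegers.coe_injective
    simpa only [map_sub, map_mul, map_pow, map_ofNat] using hφ
  let υ : (𝓞 L)ˣ := ⟨Φ - 1, Φ - Φ ^ 2 + 1, by linear_combination -hΦ, by linear_combination -hΦ⟩
  have hυ : algebraMap (𝓞 L) L υ = algebraMap (𝓞 L) L Φ - 1 := by simp [υ]
  have hNυ : Algebra.norm ℚ (algebraMap (𝓞 L) L υ) = -1 := by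
    rw [cubic_norm_eq b hb hφ _ (-1) 1 0 (by rw [hυ]; push_cast; ring)]; norm_num
  have hfr : finrank ℚ L = 3 := by simpa using finrank_eq_card_basis b
  have hrank : Units.rank L = 1 := by
    rw [Units.rank, InfinitePlace.card_eq_nrRealPlaces_add_nrComplexPlaces,
      (cubic_nrComplexPlaces b hb hφ).1, (cubic_nrComplexPlaces b hb hφ).2]
  have hstr : ∃ η : (𝓞 L)ˣ, ∀ x : (𝓞 L)ˣ, ∃ e : ℤ, x = η ^ e ∨ x = - η ^ e := by
    have : Unique (Fin (Units.rank L)) := by rw [hrank]; infer_instance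
    refine ⟨Units.fundSystem L default, fun x => ?_⟩
    obtain ⟨⟨ζ, e⟩, h, -⟩ := Units.exist_unique_eq_mul_prod L x
    refine ⟨e default, ?_⟩
    rw [Fintype.prod_unique] at h
    rcases Units.torsion_eq_one_or_neg_one_of_odd_finrank (by rw [hfr]; decide) ζ with hζ | hζ
    · left; rw [h, hζ, one_mul]
    · right; rw [h, hζ, neg_one_mul]
  obtain ⟨η, hη⟩ := hstr
  have hmod : ∀ x : (𝓞 L)ˣ, ∃ w : (𝓞 L)ˣ, x = w ^ 2 ∨ x = - w ^ 2 ∨ x = υ * w ^ 2 ∨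
      x = -(υ * w ^ 2) := by
    obtain ⟨e, he⟩ := hη υ
    rcases Int.even_or_odd' e with ⟨k, rfl | rfl⟩
    · exfalso
      rw [mul_comm, zpow_mul, zpow_ofNat] at he
      rcases he with he | he
      · have h1 : Algebra.norm ℚ (algebraMap (𝓞 L) L υ) =
            (Algebra.norm ℚ (algebraMap (𝓞 L) L (η ^ k : (𝓞 L)ˣ))) ^ 2 := by
          conv_lhs => rw [he]
          simp only [Units.val_pow_eq_pow_val, map_pow]
        rw [hNυ] at h1
        nlinarith [sq_nonneg (Algebra.norm ℚ (algebraMap (𝓞 L) L (η ^ k : (𝓞 L)ˣ)))]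
      · apply cubic_one_sub_ne_sq b hb hφ (algebraMap (𝓞 L) L (η ^ k : (𝓞 L)ˣ))
        have : algebraMap (𝓞 L) L υ = -algebraMap (𝓞 L) L (η ^ k : (𝓞 L)ˣ) ^ 2 := by
          conv_lhs => rw [he]
          simp only [Units.val_pow_eq_pow_val, Units.val_neg, map_pow, map_neg]
        rw [hυ] at this
        linear_combination -this
    · have hη' : ∀ m : ℤ, ∃ w : (𝓞 L)ˣ, η ^ (2 * m + 1) = υ * w ^ 2 ∨
          η ^ (2 * m + 1) = -(υ * w ^ 2) := by
        intro m
        refine ⟨η ^ (m - k), ?_⟩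
        have h2 : η ^ (2 * m + 1) = η ^ (2 * k + 1) * (η ^ (m - k)) ^ 2 := by
          rw [← zpow_natCast, ← zpow_mul, ← zpow_add]; congr 1; push_cast; ring
        rcases he with he | he
        · left; rw [he, h2]
        · right; rw [he, h2]; simp
      intro x
      obtain ⟨f, hf⟩ := hη x
      rcases Int.even_or_odd' f with ⟨m, rfl | rfl⟩
      · refine ⟨η ^ m, ?_⟩
        rw [mul_comm, zpow_mul, zpow_ofNat] at hf
        rcases hf with hf | hf
        · left; exact hf
        · right; left; exact hf
      · obtain ⟨w, hw | hw⟩ := hη' m <;> refine ⟨w, ?_⟩ <;> rcases hf with hf | hf <;> rw [hw] at hf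
        · right; right; left; exact hf
        · right; right; right; exact hf
        · right; right; right; exact hf
        · right; right; left; rw [hf, neg_neg]
  obtain ⟨w, hw⟩ := hmod u
  have hw0 : algebraMap (𝓞 L) L w ≠ 0 := by simp
  have hN0 : (Algebra.norm ℚ (algebraMap (𝓞 L) L w)) ≠ 0 := Algebra.norm_ne_zero_iff.mpr hw0
  have hneg : Algebra.norm ℚ (-1 : L) = -1 := by
    rw [cubic_norm_eq b hb hφ _ (-1) 0 0 (by push_cast; ring)]; norm_num
  refine ⟨(Algebra.norm ℚ (algebraMap (𝓞 L) L w) : L) * algebraMap (𝓞 L) L w,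
    mul_ne_zero (by exact_mod_cast hN0) hw0, ?_⟩
  rcases hw with rfl | rfl | rfl | rfl
  · left
    simp only [Units.val_pow_eq_pow_val, map_pow]
    push_cast; ring
  · left
    simp only [Units.val_neg, Units.val_pow_eq_pow_val, map_pow, map_neg]
    rw [neg_eq_neg_one_mul, map_mul, map_pow, hneg]
    push_cast; ring
  · right
    simp only [Units.val_mul, Units.val_pow_eq_pow_val, map_pow, map_mul]
    rw [hNυ, hυ]
    push_cast; ring
  · right
    simp only [Units.val_neg, Units.val_mul, Units.val_pow_eq_pow_val, map_pow, map_mul, map_neg]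
    rw [neg_eq_neg_one_mul, map_mul, map_mul, map_pow, hneg, hNυ, hυ]
    push_cast; ring

/-- In a unique factorization domain, an element is a product of powers of three given primes,
a squarefree element coprime to them, and a square. -/
lemma exists_eq_mul_squarefree_mul_sq {R : Type*} [CommRing R] [IsDomain R]
    [UniqueFactorizationMonoid R] {x y z : R} (hx : Prime x) (hy : Prime y) (hz : Prime z)
    {a : R} (ha : a ≠ 0) :
    ∃ (u : Rˣ) (i j k : ℕ) (m β : R), a = u * x ^ i * y ^ j * z ^ k * m * β ^ 2 ∧
      Squarefree m ∧ ∀ p, Prime p → p ∣ m → ¬ p ∣ x ∧ ¬ p ∣ y ∧ ¬ p ∣ z := by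
  induction a using UniqueFactorizationMonoid.induction_on_prime with
  | h₁ => exact absurd rfl ha
  | h₂ a hu =>
    obtain ⟨u, rfl⟩ := hu
    exact ⟨u, 0, 0, 0, 1, 1, by simp, squarefree_one,
      fun p hp h => (hp.not_isUnit (isUnit_of_dvd_one h)).elim⟩
  | h₃ a p ha0 hp ih =>
    obtain ⟨u, i, j, k, m, β, rfl, hm, hpm⟩ := ih ha0
    by_cases hpx : p ∣ x
    · obtain ⟨v, rfl⟩ := (hp.associated_of_dvd hx hpx).symm
      exact ⟨u * v, i + 1, j, k, m, β, by push_cast; ring, hm, hpm⟩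
    by_cases hpy : p ∣ y
    · obtain ⟨v, rfl⟩ := (hp.associated_of_dvd hy hpy).symm
      exact ⟨u * v, i, j + 1, k, m, β, by push_cast; ring, hm, hpm⟩
    by_cases hpz : p ∣ z
    · obtain ⟨v, rfl⟩ := (hp.associated_of_dvd hz hpz).symm
      exact ⟨u * v, i, j, k + 1, m, β, by push_cast; ring, hm, hpm⟩
    by_cases hpm' : p ∣ m
    · obtain ⟨m', rfl⟩ := hpm'
      exact ⟨u, i, j, k, m', p * β, by ring, hm.of_mul_right,
        fun r hr h => hpm r hr (h.mul_left p)⟩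
    · refine ⟨u, i, j, k, p * m, β, by ring, ?_, ?_⟩
      · rw [squarefree_mul_iff]
        exact ⟨fun r hr hr' => ((hp.irreducible.dvd_iff.mp hr).resolve_right fun h =>
          hpm' (h.dvd.trans hr')), hp.irreducible.squarefree, hm⟩
      · intro r hr h
        rcases hr.dvd_or_dvd h with h | h
        · obtain ⟨v, rfl⟩ := (hr.associated_of_dvd hp h)
          rw [Units.mul_right_dvd] at hpx hpy hpz
          exact ⟨hpx, hpy, hpz⟩
        · exact hpm r hr h

/-- Parity of the multiplicity of a prime. -/
lemma Prime.not_mul_sq_eq_mul_sq {R : Type*} [CommRing R] [IsDomain R]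
    [UniqueFactorizationMonoid R] {p a b x y : R} (hp : Prime p) (ha : ¬ p ∣ a) (hb : ¬ p ∣ b)
    (hy : y ≠ 0) (h : p * a * x ^ 2 = b * y ^ 2) : False := by
  have hb0 : b ≠ 0 := fun h0 => hb (h0 ▸ dvd_zero p)
  have hx : x ≠ 0 := by
    rintro rfl
    exact mul_ne_zero hb0 (pow_ne_zero 2 hy) (by rw [← h]; ring)
  have ha0 : a ≠ 0 := fun h0 => ha (h0 ▸ dvd_zero p)
  have e := congrArg (emultiplicity p) h
  have fx := (FiniteMultiplicity.of_prime_left hp hx).emultiplicity_eq_multiplicity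
  have fy := (FiniteMultiplicity.of_prime_left hp hy).emultiplicity_eq_multiplicity
  have fp := (FiniteMultiplicity.of_prime_left hp hp.ne_zero).emultiplicity_self
  rw [emultiplicity_mul hp, emultiplicity_mul hp, emultiplicity_mul hp, emultiplicity_pow hp,
    emultiplicity_pow hp, emultiplicity_eq_zero.mpr ha, emultiplicity_eq_zero.mpr hb, fx, fy, fp]
    at e
  norm_cast at e
  omega

lemma cubic_norm_algebraMap (b : Basis (Fin 3) ℚ L) {Φ : 𝓞 L}
    (hb : ⇑b = ![1, algebraMap (𝓞 L) L Φ, algebraMap (𝓞 L) L Φ ^ 2])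
    (hφ : algebraMap (𝓞 L) L Φ ^ 3 = 2 * algebraMap (𝓞 L) L Φ ^ 2 - 2) (y : 𝓞 L) (x₀ x₁ x₂ : ℤ)
    (hy : y = x₀ + x₁ * Φ + x₂ * Φ ^ 2) :
    Algebra.norm ℤ y = x₀ ^ 3 - 2 * x₁ ^ 3 + 4 * x₂ ^ 3 + 2 * x₀ ^ 2 * x₁ + 4 * x₀ ^ 2 * x₂
      - 4 * x₁ ^ 2 * x₂ + 6 * x₀ * x₁ * x₂ + 8 * x₀ * x₂ ^ 2 := by
  have h := cubic_norm_eq b hb hφ (algebraMap (𝓞 L) L y) x₀ x₁ x₂ (by rw [hy]; simp)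
  have h' : ((Algebra.norm ℤ y : ℤ) : ℚ) = Algebra.norm ℚ (algebraMap (𝓞 L) L y) :=
    Algebra.coe_norm_int y
  rw [h] at h'
  exact_mod_cast h'

lemma prime_of_norm_natAbs_prime {x : 𝓞 L} (h : (Algebra.norm ℤ x).natAbs.Prime) : Prime x := by
  have hx : x ≠ 0 := by rintro rfl; simp [Algebra.norm_zero, Nat.not_prime_zero] at h
  rw [← Ideal.span_singleton_prime hx]
  apply Ideal.isPrime_of_irreducible_absNorm
  rwa [Ideal.absNorm_span_singleton]

lemma cubic_factor (b : Basis (Fin 3) ℚ L) {Φ : 𝓞 L}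
    (hb : ⇑b = ![1, algebraMap (𝓞 L) L Φ, algebraMap (𝓞 L) L Φ ^ 2])
    (hφ : algebraMap (𝓞 L) L Φ ^ 3 = 2 * algebraMap (𝓞 L) L Φ ^ 2 - 2)
    {A B C δ : ℤ} (hco : IsCoprime A B) (hC : C ≠ 0)
    (h : B * (4 * A ^ 3 - 4 * A ^ 2 * B + B ^ 3) = δ * C ^ 2)
    (hδ : ∀ p : 𝓞 L, Prime p → p ∣ (δ : 𝓞 L) → p ∣ 2 * A - Φ * B → ¬ p ∣ (B : 𝓞 L) →
      p ∣ 1 + 2 * Φ + 2 * Φ ^ 2) (hα : (2 * A - Φ * B : 𝓞 L) ≠ 0) :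
    ∃ (u : (𝓞 L)ˣ) (i j k : ℕ) (β : 𝓞 L), (2 * A - Φ * B : 𝓞 L) =
      u * Φ ^ i * (3 - 4 * Φ + 2 * Φ ^ 2) ^ j * (1 + 2 * Φ + 2 * Φ ^ 2) ^ k * β ^ 2 ∧
      (Odd j → ¬ 11 ∣ B) ∧ (Odd k → ¬ 53 ∣ B) ∧
      B * (Algebra.norm ℤ (u : 𝓞 L) * (-2) ^ i * 11 ^ j * 53 ^ k * Algebra.norm ℤ β ^ 2) =
        2 * δ * C ^ 2 := by
  have := cubic_isPrincipalIdealRing b hb hφ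
  have hΦ : Φ ^ 3 = 2 * Φ ^ 2 - 2 := by
    apply RingOfIntegers.coe_injective
    simpa only [map_sub, map_mul, map_pow, map_ofNat] using hφ
  have nΦ : Algebra.norm ℤ Φ = -2 := by
    rw [cubic_norm_algebraMap b hb hφ _ 0 1 0 (by push_cast; ring)]; norm_num
  have nq : Algebra.norm ℤ (3 - 4 * Φ + 2 * Φ ^ 2) = 11 := by
    rw [cubic_norm_algebraMap b hb hφ _ 3 (-4) 2 (by push_cast; ring)]; norm_num
  have nπ : Algebra.norm ℤ (1 + 2 * Φ + 2 * Φ ^ 2) = 53 := by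
    rw [cubic_norm_algebraMap b hb hφ _ 1 2 2 (by push_cast; ring)]; norm_num
  have nα : Algebra.norm ℤ (2 * A - Φ * B : 𝓞 L) = 2 * (4 * A ^ 3 - 4 * A ^ 2 * B + B ^ 3) := by
    rw [cubic_norm_algebraMap b hb hφ _ (2 * A) (-B) 0 (by push_cast; ring)]; ring
  have pΦ : Prime Φ := prime_of_norm_natAbs_prime (by rw [nΦ]; norm_num)
  have pq : Prime (3 - 4 * Φ + 2 * Φ ^ 2) := prime_of_norm_natAbs_prime (by rw [nq]; norm_num)
  have pπ : Prime (1 + 2 * Φ + 2 * Φ ^ 2) := prime_of_norm_natAbs_prime (by rw [nπ]; norm_num)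
  obtain ⟨u, i, j, k, m, β, hdec, hm, hpm⟩ := exists_eq_mul_squarefree_mul_sq pΦ pq pπ hα
  obtain ⟨r, s, hrs⟩ := hco
  have hrs' : (r : 𝓞 L) * A + s * B = 1 := by exact_mod_cast congrArg (Int.cast : ℤ → 𝓞 L) hrs
  have hC' : (C : 𝓞 L) ≠ 0 := by exact_mod_cast hC
  have hprod : (2 * A - Φ * B : 𝓞 L) *
      (4 * A ^ 2 + 2 * (Φ - 2) * A * B + Φ * (Φ - 2) * B ^ 2) * B = 2 * δ * C ^ 2 := by
    have h' : (B : 𝓞 L) * (4 * A ^ 3 - 4 * A ^ 2 * B + B ^ 3) = δ * C ^ 2 := by exact_mod_cast h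
    linear_combination 2 * h' - (B : 𝓞 L) ^ 4 * hΦ
  have hmu : IsUnit m := by
    by_contra hmu
    obtain ⟨p, hp, hpm'⟩ := WfDvdMonoid.exists_irreducible_factor hmu hm.ne_zero
    replace hp := hp.prime
    obtain ⟨hp1, hp2, hp3⟩ := hpm p hp hpm'
    obtain ⟨m', rfl⟩ := hpm'
    have hpα : p ∣ (2 * A - Φ * B : 𝓞 L) := by
      rw [hdec]
      exact ((dvd_mul_right p m').mul_left _).mul_right _
    have hp2' : ¬ p ∣ (2 : 𝓞 L) := by
      intro h2
      refine hp1 (hp.dvd_of_dvd_pow (n := 3) ?_)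
      rw [show Φ ^ 3 = 2 * (Φ ^ 2 - 1) by rw [hΦ]; ring]
      exact h2.mul_right _
    have hpB : ¬ p ∣ (B : 𝓞 L) := by
      intro hB
      have : p ∣ (2 * A : 𝓞 L) := by
        have := dvd_add hpα (hB.mul_left Φ)
        rwa [sub_add_cancel] at this
      have := (hp.dvd_or_dvd this).resolve_left hp2'
      apply hp.not_isUnit
      apply isUnit_of_dvd_one
      rw [← hrs']
      exact dvd_add (this.mul_left _) (hB.mul_left _)
    have hpα' : ¬ p ∣ (4 * A ^ 2 + 2 * (Φ - 2) * A * B + Φ * (Φ - 2) * B ^ 2 : 𝓞 L) := by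
      intro hd
      have h3 : p ∣ (B : 𝓞 L) ^ 2 * (Φ ^ 2 * (3 - 4 * Φ + 2 * Φ ^ 2)) := by
        have := dvd_sub hd (hpα.mul_right (2 * A + (2 * Φ - 2) * B))
        convert! this using 1
        linear_combination (B : 𝓞 L) ^ 2 * (2 * Φ) * hΦ
      rcases hp.dvd_or_dvd h3 with h3 | h3
      · exact hpB (hp.dvd_of_dvd_pow h3)
      rcases hp.dvd_or_dvd h3 with h3 | h3
      · exact hp1 (hp.dvd_of_dvd_pow h3)
      · exact hp2 h3
    have hpδ : ¬ p ∣ (δ : 𝓞 L) := fun hd => hp3 (hδ p hp hd hpα hpB)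
    have hpm'' : ¬ p ∣ m' := by
      intro hd
      exact hp.not_isUnit (hm p (mul_dvd_mul_left p hd))
    have hpu : ¬ p ∣ (u : 𝓞 L) := fun hd => hp.not_isUnit (isUnit_of_dvd_unit hd u.isUnit)
    refine hp.not_mul_sq_eq_mul_sq (R := 𝓞 L) (x := β) (y := C) (b := 2 * δ)
      (a := m' * u * Φ ^ i * (3 - 4 * Φ + 2 * Φ ^ 2) ^ j * (1 + 2 * Φ + 2 * Φ ^ 2) ^ k *
        (4 * A ^ 2 + 2 * (Φ - 2) * A * B + Φ * (Φ - 2) * B ^ 2) * B) ?_ ?_ hC' ?_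
    · simp only [hp.dvd_mul, not_or]
      exact ⟨⟨⟨⟨⟨⟨hpm'', hpu⟩, fun hd => hp1 (hp.dvd_of_dvd_pow hd)⟩,
        fun hd => hp2 (hp.dvd_of_dvd_pow hd)⟩, fun hd => hp3 (hp.dvd_of_dvd_pow hd)⟩, hpα'⟩, hpB⟩
    · simp only [hp.dvd_mul, not_or]
      exact ⟨hp2', hpδ⟩
    · rw [← hprod, hdec]; ring
  obtain ⟨v, rfl⟩ := hmu
  have hnorm : ∀ (x : 𝓞 L) (ℓ : ℤ), Prime ℓ → ¬ ℓ ∣ 2 → Algebra.norm ℤ x = ℓ →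
      x ∣ 2 * A - Φ * B → ¬ ℓ ∣ B := by
    intro x ℓ hℓ hℓ2 hx hxα hℓB
    have hxB : x ∣ (B : 𝓞 L) := by
      have h1 : x ∣ (ℓ : 𝓞 L) := by
        have := Ideal.absNorm_mem (Ideal.span {x})
        rw [Ideal.absNorm_span_singleton, Ideal.mem_span_singleton, hx] at this
        refine this.trans ?_
        have h2 : ((ℓ.natAbs : ℤ) : 𝓞 L) ∣ (ℓ : 𝓞 L) :=
          map_dvd (Int.castRingHom (𝓞 L)) (Int.natAbs_dvd.mpr dvd_rfl)
        rwa [Int.cast_natCast] at h2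
      exact h1.trans (map_dvd (Int.castRingHom (𝓞 L)) hℓB)
    have hx2A : x ∣ ((2 * A : ℤ) : 𝓞 L) := by
      have := dvd_add hxα (hxB.mul_left Φ)
      rw [sub_add_cancel] at this
      exact_mod_cast this
    have h8 : ℓ ∣ (2 * A) ^ 3 := by
      have := map_dvd (Algebra.norm ℤ) hx2A
      rw [hx] at this
      rw [cubic_norm_algebraMap b hb hφ _ (2 * A) 0 0 (by push_cast; ring)] at this
      ring_nf at this ⊢; exact this
    have hA : ℓ ∣ A := (hℓ.dvd_or_dvd (hℓ.dvd_of_dvd_pow h8)).resolve_left hℓ2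
    apply hℓ.not_isUnit
    apply isUnit_of_dvd_one
    rw [← hrs]
    exact dvd_add (hA.mul_left _) (hℓB.mul_left _)
  refine ⟨u * v, i, j, k, β, by rw [hdec]; push_cast; ring, fun hj => ?_, fun hk => ?_, ?_⟩
  · refine hnorm _ 11 (Int.prime_iff_natAbs_prime.mpr (by norm_num)) (by norm_num) nq ?_
    rw [hdec]
    refine Dvd.dvd.mul_right (Dvd.dvd.mul_right (Dvd.dvd.mul_right (Dvd.dvd.mul_left
      (dvd_pow_self _ hj.pos.ne') _) _) _) _
  · refine hnorm _ 53 (Int.prime_iff_natAbs_prime.mpr (by norm_num)) (by norm_num) nπ ?_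
    rw [hdec]
    refine Dvd.dvd.mul_right (Dvd.dvd.mul_right (Dvd.dvd.mul_left
      (dvd_pow_self _ hk.pos.ne') _) _) _
  · have := congrArg (Algebra.norm ℤ) hdec
    rw [nα] at this
    simp only [map_mul, map_pow, nΦ, nq, nπ, Units.val_mul] at this ⊢
    linear_combination 2 * h - B * this

lemma cubic_class (b : Basis (Fin 3) ℚ L) {Φ : 𝓞 L}
    (hb : ⇑b = ![1, algebraMap (𝓞 L) L Φ, algebraMap (𝓞 L) L Φ ^ 2])
    (hφ : algebraMap (𝓞 L) L Φ ^ 3 = 2 * algebraMap (𝓞 L) L Φ ^ 2 - 2)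
    {A B C δ : ℤ} (hco : IsCoprime A B) (hC : C ≠ 0) (h11 : ¬ 11 ∣ δ)
    (h : B * (4 * A ^ 3 - 4 * A ^ 2 * B + B ^ 3) = δ * C ^ 2)
    (hδ : ∀ p : 𝓞 L, Prime p → p ∣ (δ : 𝓞 L) → p ∣ 2 * A - Φ * B → ¬ p ∣ (B : 𝓞 L) →
      p ∣ 1 + 2 * Φ + 2 * Φ ^ 2) (hα : (2 * A - Φ * B : 𝓞 L) ≠ 0) :
    ∃ (w γ : L), (w = 1 ∨ w = 1 - algebraMap (𝓞 L) L Φ) ∧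
      ((¬ (53 ∣ δ ∧ ¬ 53 ^ 2 ∣ δ ∧ ¬ 53 ∣ B) ∧
        2 * δ * B * (2 * A - algebraMap (𝓞 L) L Φ * B) = w * γ ^ 2) ∨
      (53 ∣ δ ∧ 2 * δ * B * (2 * A - algebraMap (𝓞 L) L Φ * B) =
        53 * w * (1 + 2 * algebraMap (𝓞 L) L Φ + 2 * algebraMap (𝓞 L) L Φ ^ 2) * γ ^ 2)) := by
  obtain ⟨u, i, j, k, β, hdec, hj, hk, hN⟩ := cubic_factor b hb hφ hco hC h hδ hα
  obtain ⟨v, hv0, hv⟩ := cubic_units b hb hφ u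
  have hNu : IsUnit (Algebra.norm ℤ (u : 𝓞 L)) := u.isUnit.map _
  have hu : ∀ p : ℤ, Prime p → ¬ p ∣ Algebra.norm ℤ (u : 𝓞 L) := fun p hp hd =>
    hp.not_isUnit (isUnit_of_dvd_unit hd hNu)
  have p11 : Prime (11 : ℤ) := Int.prime_iff_natAbs_prime.mpr (by norm_num)
  have p53 : Prime (53 : ℤ) := Int.prime_iff_natAbs_prime.mpr (by norm_num)
  have hjeven : Even j := by
    by_contra hjo
    rw [Nat.not_even_iff_odd] at hjo
    obtain ⟨j', rfl⟩ := id hjo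
    refine p11.not_mul_sq_eq_mul_sq (x := 11 ^ j' * Algebra.norm ℤ β) (y := C) (b := 2 * δ)
      (a := B * Algebra.norm ℤ (u : 𝓞 L) * (-2) ^ i * 53 ^ k) ?_ ?_ hC ?_
    · simp only [p11.dvd_mul, not_or]
      exact ⟨⟨⟨hj hjo, hu _ p11⟩, fun hd => absurd (p11.dvd_of_dvd_pow hd) (by norm_num)⟩,
        fun hd => absurd (p11.dvd_of_dvd_pow hd) (by norm_num)⟩
    · simp only [p11.dvd_mul, not_or]
      exact ⟨by norm_num, h11⟩
    · rw [← hN]; ring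
  obtain ⟨j', rfl⟩ := hjeven
  have hC' : (C : L) ≠ 0 := by exact_mod_cast hC
  have hN' : (B : L) * (Algebra.norm ℚ (algebraMap (𝓞 L) L u) * (-2) ^ i * 11 ^ (j' + j') * 53 ^ k *
      (Algebra.norm ℤ β : L) ^ 2) = 2 * δ * C ^ 2 := by
    have h1 : ((Algebra.norm ℤ (u : 𝓞 L) : ℤ) : ℚ) = Algebra.norm ℚ (algebraMap (𝓞 L) L u) :=
      Algebra.coe_norm_int (u : 𝓞 L)
    rw [← h1]
    exact_mod_cast congrArg (Int.cast : ℤ → L) hN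
  have hdec' := congrArg (algebraMap (𝓞 L) L) hdec
  simp only [map_sub, map_add, map_mul, map_pow, map_ofNat, map_one, map_intCast] at hdec'
  generalize algebraMap (𝓞 L) L Φ = φ at *
  have hsq : (-2 * φ) ^ i = ((φ ^ 2 - 2) ^ i) ^ 2 := by
    rw [← pow_mul, mul_comm i 2, pow_mul]; congr 1; linear_combination (-φ - 2) * hφ
  have main : 2 * δ * B * (2 * A - φ * B) * (C : L) ^ 2 =
      (Algebra.norm ℚ (algebraMap (𝓞 L) L u) * algebraMap (𝓞 L) L u) *
      (53 * (1 + 2 * φ + 2 * φ ^ 2)) ^ k * ((φ ^ 2 - 2) ^ i * (11 * (3 - 4 * φ + 2 * φ ^ 2)) ^ j' *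
        (B * (Algebra.norm ℤ β : L) * algebraMap (𝓞 L) L β)) ^ 2 := by
    calc _ = B * (2 * A - φ * B) * (2 * δ * (C : L) ^ 2) := by ring
      _ = _ := by
        rw [← hN', hdec', mul_pow (_ * _ : L) _ 2, mul_pow (_ ^ i : L) _ 2, ← hsq]
        simp only [mul_pow]
        ring
  obtain ⟨w, hw, hw'⟩ : ∃ w : L, (w = 1 ∨ w = 1 - φ) ∧
      Algebra.norm ℚ (algebraMap (𝓞 L) L u) * algebraMap (𝓞 L) L u = w * v ^ 2 := by
    rcases hv with hv | hv
    · exact ⟨1, .inl rfl, by rw [hv, one_mul]⟩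
    · exact ⟨1 - φ, .inr rfl, hv⟩
  rw [hw'] at main
  rcases Nat.even_or_odd' k with ⟨k', rfl | rfl⟩
  · refine ⟨w, (53 * (1 + 2 * φ + 2 * φ ^ 2)) ^ k' * v * ((φ ^ 2 - 2) ^ i *
      (11 * (3 - 4 * φ + 2 * φ ^ 2)) ^ j' *
        (B * (Algebra.norm ℤ β : L) * algebraMap (𝓞 L) L β)) / C, hw, .inl ⟨?_, ?_⟩⟩
    · rintro ⟨⟨d, rfl⟩, hd, hB⟩
      refine p53.not_mul_sq_eq_mul_sq (x := C) (y := 53 ^ k' * Algebra.norm ℤ β) (a := 2 * d)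
        (b := B * Algebra.norm ℤ (u : 𝓞 L) * (-2) ^ i * 11 ^ (j' + j')) ?_ ?_ ?_ ?_
      · simp only [p53.dvd_mul, not_or]
        refine ⟨by norm_num, fun h => hd ?_⟩
        rw [sq]; exact mul_dvd_mul_left _ h
      · simp only [p53.dvd_mul, not_or]
        exact ⟨⟨⟨hB, hu _ p53⟩, fun hd => absurd (p53.dvd_of_dvd_pow hd) (by norm_num)⟩,
          fun hd => absurd (p53.dvd_of_dvd_pow hd) (by norm_num)⟩
      · intro h0
        have : Algebra.norm ℤ β = 0 := by simpa using h0
        rw [this] at hN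
        have hd0 : d ≠ 0 := by rintro rfl; simp at hd
        have : 2 * (53 * d) * C ^ 2 ≠ 0 := by positivity
        exact this (by rw [← hN]; ring)
      · linear_combination -hN
    · rw [div_pow, mul_div_assoc', eq_div_iff (pow_ne_zero 2 hC'), main, pow_mul']
      ring
  · refine ⟨w, (53 * (1 + 2 * φ + 2 * φ ^ 2)) ^ k' * v * ((φ ^ 2 - 2) ^ i *
      (11 * (3 - 4 * φ + 2 * φ ^ 2)) ^ j' *
        (B * (Algebra.norm ℤ β : L) * algebraMap (𝓞 L) L β)) / C, hw, .inr ⟨?_, ?_⟩⟩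
    · by_contra hd
      refine p53.not_mul_sq_eq_mul_sq (x := 53 ^ k' * Algebra.norm ℤ β) (y := C) (b := 2 * δ)
        (a := B * Algebra.norm ℤ (u : 𝓞 L) * (-2) ^ i * 11 ^ (j' + j')) ?_ ?_ hC ?_
      · simp only [p53.dvd_mul, not_or]
        exact ⟨⟨⟨hk ⟨k', rfl⟩, hu _ p53⟩, fun hd => absurd (p53.dvd_of_dvd_pow hd) (by norm_num)⟩,
          fun hd => absurd (p53.dvd_of_dvd_pow hd) (by norm_num)⟩
      · simp only [p53.dvd_mul, not_or]
        exact ⟨by norm_num, hd⟩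
      · rw [← hN]; ring
    · rw [div_pow, mul_div_assoc', eq_div_iff (pow_ne_zero 2 hC'), main]
      ring

lemma cubic_not_one_sub_class (b : Basis (Fin 3) ℚ L) {φ : L} (hb : ⇑b = ![1, φ, φ ^ 2])
    (hφ : φ ^ 3 = 2 * φ ^ 2 - 2) {A B δ : ℤ} (hB : B ≠ 0) (hδ : Odd δ) (γ : L) :
    2 * δ * B * (2 * A - φ * B) ≠ (1 - φ) * γ ^ 2 := by
  intro h
  obtain ⟨x, y, z, D, hD, hγ⟩ := cubic_int_repr b hb γ
  have h2 : (D : L) ^ 2 * (2 * δ * B * (2 * A - φ * B)) =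
      (1 - φ) * (x + y * φ + z * φ ^ 2) ^ 2 := by rw [h, ← hγ]; ring
  have hsq : (x + y * φ + z * φ ^ 2) ^ 2 = (x ^ 2 - 4 * y * z - 4 * z ^ 2 : L) +
      (2 * x * y - 2 * z ^ 2) * φ + (y ^ 2 + 2 * x * z + 4 * y * z + 4 * z ^ 2) * φ ^ 2 := by
    linear_combination (2 * y * z + z ^ 2 * (φ + 2)) * hφ
  rw [hsq] at h2
  obtain ⟨-, h1, h2⟩ := cubic_int_repr_unique b hb
    (x := x ^ 2 - 4 * y * z - 4 * z ^ 2 + 2 * (y ^ 2 + 2 * x * z + 4 * y * z + 4 * z ^ 2)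
      - 4 * δ * A * B * D ^ 2)
    (y := -x ^ 2 + 2 * x * y + 4 * y * z + 2 * z ^ 2 + 2 * δ * (B * D) ^ 2)
    (z := -(y ^ 2 + 2 * x * y + 2 * x * z + 4 * y * z + 2 * z ^ 2)) (by
      push_cast
      linear_combination -h2 + (y ^ 2 + 2 * x * z + 4 * y * z + 4 * z ^ 2) * hφ)
  refine mul_ne_zero hB hD (Int.eq_zero_of_descent (p := 2) le_rfl (fun x y z E =>
    -x ^ 2 + 2 * x * y + 4 * y * z + 2 * z ^ 2 + 2 * δ * E ^ 2 = 0 ∧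
      -(y ^ 2 + 2 * x * y + 2 * x * z + 4 * y * z + 2 * z ^ 2) = 0) ?_ ⟨h1, h2⟩)
  clear * - hδ
  rintro x y z E ⟨h1, h2⟩
  have hy : Even y := by
    rw [← Int.even_pow' (n := 2) two_ne_zero]
    exact ⟨-(x * y + x * z + 2 * y * z + z ^ 2), by linear_combination -h2⟩
  have hx : Even x := by
    rw [← Int.even_pow' (n := 2) two_ne_zero]
    exact ⟨x * y + 2 * y * z + z ^ 2 + δ * E ^ 2, by linear_combination -h1⟩
  obtain ⟨y', rfl⟩ := hy.two_dvd
  obtain ⟨x', rfl⟩ := hx.two_dvd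
  have hz : Even z := by
    rw [← Int.even_pow' (n := 2) two_ne_zero]
    exact ⟨-(y' ^ 2 + 2 * x' * y' + x' * z + 2 * y' * z), by linarith⟩
  obtain ⟨z', rfl⟩ := hz.two_dvd
  have hE : Even E := by
    rw [← Int.even_pow' (n := 2) two_ne_zero]
    have : Even (δ * E ^ 2) := ⟨x' ^ 2 - 2 * x' * y' - 4 * y' * z' - 2 * z' ^ 2, by linarith⟩
    exact (Int.even_mul.mp this).resolve_left (Int.not_even_iff_odd.mpr hδ)
  obtain ⟨E', rfl⟩ := hE.two_dvd
  exact ⟨x', y', z', E', rfl, by linarith, by linarith⟩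

lemma cubic_not_one_sub_mul_class (b : Basis (Fin 3) ℚ L) {φ : L} (hb : ⇑b = ![1, φ, φ ^ 2])
    (hφ : φ ^ 3 = 2 * φ ^ 2 - 2) {A B : ℤ} (hB : B ≠ 0) (γ : L) :
    2 * B * (2 * A - φ * B) ≠ (1 - φ) * (1 + 2 * φ + 2 * φ ^ 2) * γ ^ 2 := by
  intro h
  have h' : 2 * B * (2 * A - φ * B) = (5 + φ - 4 * φ ^ 2) * γ ^ 2 := by
    rw [h]; linear_combination -2 * γ ^ 2 * hφ
  obtain ⟨x, y, z, D, hD, hγ⟩ := cubic_int_repr b hb γ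
  have h2 : (D : L) ^ 2 * (2 * B * (2 * A - φ * B)) =
      (5 + φ - 4 * φ ^ 2) * (x + y * φ + z * φ ^ 2) ^ 2 := by rw [h', ← hγ]; ring
  have hsq : (x + y * φ + z * φ ^ 2) ^ 2 = (x ^ 2 - 4 * y * z - 4 * z ^ 2 : L) +
      (2 * x * y - 2 * z ^ 2) * φ + (y ^ 2 + 2 * x * z + 4 * y * z + 4 * z ^ 2) * φ ^ 2 := by
    linear_combination (2 * y * z + z ^ 2 * (φ + 2)) * hφ
  rw [hsq] at h2
  obtain ⟨-, h1, h2⟩ := cubic_int_repr_unique b hb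
    (x := 5 * (x ^ 2 - 4 * y * z - 4 * z ^ 2)
      - 2 * ((y ^ 2 + 2 * x * z + 4 * y * z + 4 * z ^ 2) - 4 * (2 * x * y - 2 * z ^ 2))
      + 16 * (y ^ 2 + 2 * x * z + 4 * y * z + 4 * z ^ 2) - 4 * A * B * D ^ 2)
    (y := 5 * (2 * x * y - 2 * z ^ 2) + (x ^ 2 - 4 * y * z - 4 * z ^ 2)
      + 8 * (y ^ 2 + 2 * x * z + 4 * y * z + 4 * z ^ 2) + 2 * (B * D) ^ 2)
    (z := -9 * (y ^ 2 + 2 * x * z + 4 * y * z + 4 * z ^ 2) - 7 * (2 * x * y - 2 * z ^ 2)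
      - 4 * (x ^ 2 - 4 * y * z - 4 * z ^ 2)) (by
      push_cast
      linear_combination -h2 - ((y ^ 2 + 2 * x * z + 4 * y * z + 4 * z ^ 2)
        - 4 * (2 * x * y - 2 * z ^ 2)
        - 4 * (y ^ 2 + 2 * x * z + 4 * y * z + 4 * z ^ 2) * (φ + 2)) * hφ)
  refine mul_ne_zero hB hD (Int.eq_zero_of_descent (p := 2) le_rfl (fun x y z E =>
    5 * (2 * x * y - 2 * z ^ 2) + (x ^ 2 - 4 * y * z - 4 * z ^ 2)
      + 8 * (y ^ 2 + 2 * x * z + 4 * y * z + 4 * z ^ 2) + 2 * E ^ 2 = 0 ∧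
      -9 * (y ^ 2 + 2 * x * z + 4 * y * z + 4 * z ^ 2) - 7 * (2 * x * y - 2 * z ^ 2)
      - 4 * (x ^ 2 - 4 * y * z - 4 * z ^ 2) = 0) ?_ ⟨h1, h2⟩)
  clear * -
  rintro x y z E ⟨h1, h2⟩
  have hy : Even y := by
    rw [← Int.even_pow' (n := 2) two_ne_zero]
    exact ⟨-(4 * y ^ 2 + 9 * (x * z + 2 * y * z + 2 * z ^ 2) + 7 * (x * y - z ^ 2)
      + 2 * (x ^ 2 - 4 * y * z - 4 * z ^ 2)), by linear_combination -h2⟩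
  have hx : Even x := by
    rw [← Int.even_pow' (n := 2) two_ne_zero]
    exact ⟨-(5 * (x * y - z ^ 2) - 2 * y * z - 2 * z ^ 2
      + 4 * (y ^ 2 + 2 * x * z + 4 * y * z + 4 * z ^ 2) + E ^ 2), by linear_combination h1⟩
  obtain ⟨y', rfl⟩ := hy.two_dvd
  obtain ⟨x', rfl⟩ := hx.two_dvd
  have hz : Even z := by
    rw [← Int.even_pow' (n := 2) two_ne_zero]
    have : Even (7 * z ^ 2) := ⟨9 * (y' ^ 2 + x' * z + 2 * y' * z + z ^ 2) + 14 * x' * y'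
      + 4 * x' ^ 2 - 8 * y' * z - 4 * z ^ 2, by linarith⟩
    exact (Int.even_mul.mp this).resolve_left (by decide)
  obtain ⟨z', rfl⟩ := hz.two_dvd
  have hE : Even E := by
    rw [← Int.even_pow' (n := 2) two_ne_zero]
    exact ⟨-(5 * (2 * x' * y' - 2 * z' ^ 2) + (x' ^ 2 - 4 * y' * z' - 4 * z' ^ 2)
      + 8 * (y' ^ 2 + 2 * x' * z' + 4 * y' * z' + 4 * z' ^ 2)), by linarith⟩
  obtain ⟨E', rfl⟩ := hE.two_dvd
  exact ⟨x', y', z', E', rfl, by linarith, by linarith⟩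

lemma cubic_not_class_fiftyThree (b : Basis (Fin 3) ℚ L) {φ : L} (hb : ⇑b = ![1, φ, φ ^ 2])
    (hφ : φ ^ 3 = 2 * φ ^ 2 - 2) {A B : ℤ} (hB : ¬ 53 ∣ B) (hAB : 53 ∣ 2 * A - 41 * B) (γ : L) :
    2 * B * (2 * A - φ * B) ≠ (1 + 2 * φ + 2 * φ ^ 2) * γ ^ 2 := by
  intro h
  obtain ⟨x, y, z, D, hD, hγ⟩ := cubic_int_repr b hb γ
  have h2 : (D : L) ^ 2 * (2 * B * (2 * A - φ * B)) =
      (1 + 2 * φ + 2 * φ ^ 2) * (x + y * φ + z * φ ^ 2) ^ 2 := by rw [h, ← hγ]; ring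
  have hsq : (x + y * φ + z * φ ^ 2) ^ 2 = (x ^ 2 - 4 * y * z - 4 * z ^ 2 : L) +
      (2 * x * y - 2 * z ^ 2) * φ + (y ^ 2 + 2 * x * z + 4 * y * z + 4 * z ^ 2) * φ ^ 2 := by
    linear_combination (2 * y * z + z ^ 2 * (φ + 2)) * hφ
  rw [hsq] at h2
  obtain ⟨h0, h1, h2⟩ := cubic_int_repr_unique b hb
    (x := (x ^ 2 - 4 * y * z - 4 * z ^ 2) - 4 * (2 * x * y - 2 * z ^ 2)
      - 12 * (y ^ 2 + 2 * x * z + 4 * y * z + 4 * z ^ 2) - 4 * A * B * D ^ 2)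
    (y := 2 * (x ^ 2 - 4 * y * z - 4 * z ^ 2) + (2 * x * y - 2 * z ^ 2)
      - 4 * (y ^ 2 + 2 * x * z + 4 * y * z + 4 * z ^ 2) + 2 * B ^ 2 * D ^ 2)
    (z := 2 * (x ^ 2 - 4 * y * z - 4 * z ^ 2) + 6 * (2 * x * y - 2 * z ^ 2)
      + 13 * (y ^ 2 + 2 * x * z + 4 * y * z + 4 * z ^ 2)) (by
      push_cast
      linear_combination -h2 - (2 * (y ^ 2 + 2 * x * z + 4 * y * z + 4 * z ^ 2) * (φ + 3)
        + 2 * (2 * x * y - 2 * z ^ 2)) * hφ)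
  refine hD (Int.eq_zero_of_descent (p := 53) (by norm_num) (fun x y z D =>
    (x ^ 2 - 4 * y * z - 4 * z ^ 2) - 4 * (2 * x * y - 2 * z ^ 2)
      - 12 * (y ^ 2 + 2 * x * z + 4 * y * z + 4 * z ^ 2) - 4 * A * B * D ^ 2 = 0 ∧
    2 * (x ^ 2 - 4 * y * z - 4 * z ^ 2) + (2 * x * y - 2 * z ^ 2)
      - 4 * (y ^ 2 + 2 * x * z + 4 * y * z + 4 * z ^ 2) + 2 * B ^ 2 * D ^ 2 = 0 ∧
    2 * (x ^ 2 - 4 * y * z - 4 * z ^ 2) + 6 * (2 * x * y - 2 * z ^ 2)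
      + 13 * (y ^ 2 + 2 * x * z + 4 * y * z + 4 * z ^ 2) = 0) ?_ ⟨h0, h1, h2⟩)
  clear * - hB hAB
  rintro x y z D ⟨h0, h1, h2⟩
  have p53 : Prime (53 : ℤ) := Int.prime_iff_natAbs_prime.mpr (by norm_num)
  have key : ∀ r : ℤ, ∃ k : ℤ, 2 * B * D ^ 2 * (2 * A - r * B) =
      (1 + 2 * r + 2 * r ^ 2) * (x + y * r + z * r ^ 2) ^ 2 + k * (r ^ 3 - 2 * r ^ 2 + 2) :=
    fun r => ⟨-((1 + 2 * r + 2 * r ^ 2) * (2 * y * z + z ^ 2 * (r + 2))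
      + 2 * (y ^ 2 + 2 * x * z + 4 * y * z + 4 * z ^ 2) * (r + 3)
        + 2 * (2 * x * y - 2 * z ^ 2)), by
      linear_combination -h0 - r * h1 - r ^ 2 * h2⟩
  obtain ⟨a, ha⟩ := hAB
  have hz53 : ∀ u v : ZMod 53, u ^ 2 = 19 * v ^ 2 → u = 0 ∧ v = 0 := by decide
  obtain ⟨hBD, hg33⟩ : 53 ∣ 4 * B * D ∧ 53 ∣ x + y * 33 + z * 33 ^ 2 := by
    obtain ⟨k, hk⟩ := key 33
    have := hz53 ((4 * B * D : ℤ)) ((x + y * 33 + z * 33 ^ 2 : ℤ)) (by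
      have := (ZMod.intCast_eq_intCast_iff_dvd_sub (19 * (x + y * 33 + z * 33 ^ 2) ^ 2)
        ((4 * B * D) ^ 2) 53).mpr ⟨42 * (x + y * 33 + z * 33 ^ 2) ^ 2 + 637 * k
          - 2 * B * D ^ 2 * a, by push_cast; linear_combination hk - 2 * B * D ^ 2 * ha⟩
      push_cast at this ⊢
      exact this.symm)
    exact ⟨(ZMod.intCast_zmod_eq_zero_iff_dvd _ 53).mp this.1,
      (ZMod.intCast_zmod_eq_zero_iff_dvd _ 53).mp this.2⟩
  have hD : 53 ∣ D := by
    rcases p53.dvd_or_dvd hBD with h | h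
    · rcases p53.dvd_or_dvd h with h | h
      · norm_num at h
      · exact absurd h hB
    · exact h
  obtain ⟨D', rfl⟩ := hD
  have hg34 : 53 ∣ x + y * 34 + z * 34 ^ 2 := by
    obtain ⟨k, hk⟩ := key 34
    refine p53.dvd_of_dvd_pow (n := 2) ((p53.dvd_or_dvd (a := 49) ?_).resolve_left (by norm_num))
    exact ⟨2 * B * 53 * D' ^ 2 * (2 * A - 34 * B) - 44 * (x + y * 34 + z * 34 ^ 2) ^ 2
      - 698 * k, by linear_combination -hk⟩
  have hg41 : 53 ∣ x + y * (-277) + z * (-277) ^ 2 := by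
    obtain ⟨k, hk⟩ := key (-277)
    refine p53.dvd_of_dvd_pow (n := 2) ((p53.dvd_or_dvd (a := 2885) ?_).resolve_left (by norm_num))
    refine ⟨2 * B * D' ^ 2 * (2 * A + 277 * B) + 7621 * k, ?_⟩
    linarith
  obtain ⟨g1, hg1⟩ := hg33
  obtain ⟨g2, hg2⟩ := hg34
  obtain ⟨g3, hg3⟩ := hg41
  have hz : 53 ∣ z := (p53.dvd_or_dvd (a := 96410) ⟨g3 - g1 + 310 * (g2 - g1), by
    linear_combination hg3 - 311 * hg1 + 310 * hg2⟩).resolve_left (by norm_num)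
  obtain ⟨z', rfl⟩ := hz
  have hy : 53 ∣ y := ⟨g2 - g1 - 67 * z', by linear_combination hg2 - hg1⟩
  obtain ⟨y', rfl⟩ := hy
  have hx : 53 ∣ x := ⟨g1 - 33 * y' - 33 ^ 2 * z', by linear_combination hg1⟩
  obtain ⟨x', rfl⟩ := hx
  exact ⟨x', y', z', D', rfl, by linarith, by linarith, by linarith⟩

lemma cubic_halving (b : Basis (Fin 3) ℚ L) {φ : L} (hb : ⇑b = ![1, φ, φ ^ 2])
    (hφ : φ ^ 3 = 2 * φ ^ 2 - 2) {x δ : ℚ} (hδ : δ ≠ 0) {β : L} (h : 2 * δ * (2 * x - φ) = β ^ 2) :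
    ∃ x' w' : ℚ, δ * w' ^ 2 = 4 * x' ^ 3 - 4 * x' ^ 2 + 1 ∧
      x * (4 * x' ^ 3 - 4 * x' ^ 2 + 1) = x' ^ 4 - 2 * x' + 1 := by
  obtain ⟨r, s, t, rfl⟩ := cubic_repr b hb β
  obtain ⟨h0, h1, h2⟩ := cubic_repr_unique b hb (x₀ := r ^ 2 - 4 * s * t - 4 * t ^ 2 - 4 * δ * x)
    (x₁ := 2 * r * s - 2 * t ^ 2 + 2 * δ) (x₂ := s ^ 2 + 2 * r * t + 4 * s * t + 4 * t ^ 2) (by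
      push_cast
      linear_combination -h - (2 * s * t + t ^ 2 * (φ + 2)) * hφ)
  have ht : t ≠ 0 := by
    rintro rfl
    have : s = 0 := by simpa using h2
    subst this
    exact hδ (by linarith)
  have hr : r = -(s + 2 * t) ^ 2 / (2 * t) := by
    field_simp; linear_combination h2
  have hδ' : δ = t ^ 2 - r * s := by linear_combination h1 / 2
  have hx : δ * x = (r ^ 2 - 4 * s * t - 4 * t ^ 2) / 4 := by linear_combination -h0 / 4
  have hF : 4 * ((s + 2 * t) / (2 * t)) ^ 3 - 4 * ((s + 2 * t) / (2 * t)) ^ 2 + 1 = δ / t ^ 2 := by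
    rw [hδ', hr]; field_simp; ring
  refine ⟨(s + 2 * t) / (2 * t), 1 / t, ?_, ?_⟩
  · rw [hF]; field_simp
  · rw [hF, mul_div_assoc', mul_comm x, hx, hr]; field_simp; ring

end CubicField

section CubicDescent

open NumberField Module

lemma exists_cubic_field : ∃ (L : Type) (_ : Field L) (_ : NumberField L) (b : Basis (Fin 3) ℚ L)
    (Φ : 𝓞 L), ⇑b = ![1, algebraMap (𝓞 L) L Φ, algebraMap (𝓞 L) L Φ ^ 2] ∧
      algebraMap (𝓞 L) L Φ ^ 3 = 2 * algebraMap (𝓞 L) L Φ ^ 2 - 2 := by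
  classical
  let f : Polynomial ℚ := Polynomial.X ^ 3 - 2 * Polynomial.X ^ 2 + 2
  have hdeg : f.natDegree = 3 := by simp only [f]; compute_degree!
  have hmonic : f.Monic := by simp only [f]; monicity!
  have hf : Irreducible f := by
    have hm : (Polynomial.X ^ 3 - 2 * Polynomial.X ^ 2 + 2 : Polynomial ℤ).Monic := by monicity!
    have hd : (Polynomial.X ^ 3 - 2 * Polynomial.X ^ 2 + 2 : Polynomial ℤ).natDegree = 3 := by
      compute_degree!
    have hE : (Polynomial.X ^ 3 - 2 * Polynomial.X ^ 2 + 2 : Polynomial ℤ).IsEisensteinAt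
        (Ideal.span {2}) := by
      refine ⟨?_, fun {n} hn => ?_, ?_⟩
      · rw [hm.leadingCoeff, Ideal.mem_span_singleton]; norm_num
      · rw [hd] at hn
        rw [Ideal.mem_span_singleton]
        interval_cases n <;> simp [Polynomial.coeff_ofNat_mul,
          Polynomial.coeff_X_pow, Polynomial.coeff_ofNat_zero]
      · rw [Ideal.span_singleton_pow, Ideal.mem_span_singleton]
        simp [Polynomial.coeff_ofNat_mul, Polynomial.coeff_X_pow]
    have := hE.irreducible ((Ideal.span_singleton_prime (by norm_num)).mpr Int.prime_two)
      hm.isPrimitive (by rw [hd]; norm_num)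
    have h2 := (hm.isPrimitive.irreducible_iff_irreducible_map_fraction_map (K := ℚ)).mp this
    simpa [f, Polynomial.map_ofNat] using h2
  have : Fact (Irreducible f) := ⟨hf⟩
  have hroot : AdjoinRoot.root f ^ 3 = 2 * AdjoinRoot.root f ^ 2 - 2 := by
    have := AdjoinRoot.eval₂_root f
    simp only [f, Polynomial.eval₂_add, Polynomial.eval₂_sub, Polynomial.eval₂_mul,
      Polynomial.eval₂_pow, Polynomial.eval₂_X, Polynomial.eval₂_ofNat] at this
    linear_combination this
  have h_integral : IsIntegral ℤ (AdjoinRoot.root f) := by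
    refine ⟨Polynomial.X ^ 3 - 2 * Polynomial.X ^ 2 + 2, by monicity!, ?_⟩
    simp [hroot]
  let pb := AdjoinRoot.powerBasis hf.ne_zero
  have : FiniteDimensional ℚ (AdjoinRoot f) := pb.finite
  have : NumberField (AdjoinRoot f) := ⟨⟩
  have hdim : pb.dim = 3 := hdeg
  refine ⟨AdjoinRoot f, inferInstance, inferInstance, pb.basis.reindex (finCongr hdim),
    ⟨AdjoinRoot.root f, h_integral⟩, ?_, hroot⟩
  ext i
  have : algebraMap (𝓞 (AdjoinRoot f)) (AdjoinRoot f) ⟨AdjoinRoot.root f, h_integral⟩ =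
    AdjoinRoot.root f := rfl
  rw [this, Basis.reindex_apply, PowerBasis.basis_eq_pow]
  fin_cases i <;> simp [pb]

lemma four_cubic_ne_zero {A B : ℤ} (hco : IsCoprime A B) :
    4 * A ^ 3 - 4 * A ^ 2 * B + B ^ 3 ≠ 0 := by
  intro h
  have hB : Even B := by
    rw [← Int.even_pow' (n := 3) three_ne_zero]
    exact ⟨-(2 * A ^ 3 - 2 * A ^ 2 * B), by linear_combination h⟩
  obtain ⟨B', rfl⟩ := hB.two_dvd
  have hA : Even A := by
    rw [← Int.even_pow' (n := 3) three_ne_zero]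
    exact ⟨A ^ 2 * B' - B' ^ 3, by linarith⟩
  exact Int.prime_two.not_isUnit (hco.isUnit_of_dvd' hA.two_dvd ⟨B', rfl⟩)

lemma cubic_sub_ne_zero {L : Type*} [Field L] [NumberField L] (b : Basis (Fin 3) ℚ L) {Φ : 𝓞 L}
    (hb : ⇑b = ![1, algebraMap (𝓞 L) L Φ, algebraMap (𝓞 L) L Φ ^ 2]) {A B : ℤ} (hB : B ≠ 0) :
    (2 * A - Φ * B : 𝓞 L) ≠ 0 := by
  intro h
  have h' := congrArg (algebraMap (𝓞 L) L) h
  simp only [map_sub, map_mul, map_ofNat, map_intCast, map_zero] at h'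
  have := cubic_int_repr_unique b hb (x := 2 * A) (y := -B) (z := 0) (by
    push_cast; linear_combination h')
  exact hB (by simpa using this.2.1)

lemma exists_halving {A B C δ : ℤ} (hδ : δ = 1 ∨ δ = 5) (hco : IsCoprime A B) (hB : B ≠ 0)
    (h : B * (4 * A ^ 3 - 4 * A ^ 2 * B + B ^ 3) = δ * C ^ 2) :
    ∃ x' w' : ℚ, δ * w' ^ 2 = 4 * x' ^ 3 - 4 * x' ^ 2 + 1 ∧
      (A / B : ℚ) * (4 * x' ^ 3 - 4 * x' ^ 2 + 1) = x' ^ 4 - 2 * x' + 1 := by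
  obtain ⟨L, _, _, b, Φ, hb, hφ⟩ := exists_cubic_field
  have hF := four_cubic_ne_zero hco
  have hC : C ≠ 0 := by
    rintro rfl
    exact mul_ne_zero hB hF (by rw [h]; ring)
  have hΦ : Φ ^ 3 = 2 * Φ ^ 2 - 2 := by
    apply RingOfIntegers.coe_injective
    simpa only [map_sub, map_mul, map_pow, map_ofNat] using hφ
  obtain ⟨w, γ, hw, hγ⟩ := cubic_class b hb hφ hco hC (by rcases hδ with rfl | rfl <;> norm_num) h
    (by
      intro p hp hpδ hpα hpB
      exfalso
      rcases hδ with rfl | rfl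
      · exact hp.not_isUnit (isUnit_of_dvd_one (by simpa using hpδ))
      have h1 : p ∣ ((2 * (4 * A ^ 3 - 4 * A ^ 2 * B + B ^ 3) : ℤ) : 𝓞 L) := by
        have := hpα.mul_right (4 * A ^ 2 + 2 * (Φ - 2) * A * B + Φ * (Φ - 2) * B ^ 2 : 𝓞 L)
        convert! this using 1
        push_cast
        linear_combination (B : 𝓞 L) ^ 3 * hΦ
      have h5 : ¬ IsCoprime (5 : ℤ) (2 * (4 * A ^ 3 - 4 * A ^ 2 * B + B ^ 3)) := by
        rintro ⟨r, s, hrs⟩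
        refine hp.not_isUnit (isUnit_of_dvd_one ?_)
        have h2 := congrArg (Int.cast : ℤ → 𝓞 L) hrs
        rw [Int.cast_add, Int.cast_mul, Int.cast_mul s, Int.cast_one] at h2
        rw [← h2]
        exact dvd_add (hpδ.mul_left _) (h1.mul_left _)
      have p5 : Prime (5 : ℤ) := Int.prime_iff_natAbs_prime.mpr (by norm_num)
      rw [p5.coprime_iff_not_dvd, not_not] at h5
      have hz : ∀ a b : ZMod 5, 2 * (4 * a ^ 3 - 4 * a ^ 2 * b + b ^ 3) = 0 → a = 0 ∧ b = 0 := by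
        decide
      obtain ⟨ha, hb'⟩ := hz A B (by
        exact_mod_cast (ZMod.intCast_zmod_eq_zero_iff_dvd _ 5).mpr h5)
      exact p5.not_isUnit (hco.isUnit_of_dvd' ((ZMod.intCast_zmod_eq_zero_iff_dvd _ 5).mp ha)
        ((ZMod.intCast_zmod_eq_zero_iff_dvd _ 5).mp hb')))
    (cubic_sub_ne_zero b hb hB)
  rcases hγ with ⟨-, hγ⟩ | ⟨hd, -⟩
  · rcases hw with rfl | rfl
    · have hB' : (B : L) ≠ 0 := by exact_mod_cast hB
      refine cubic_halving b hb hφ (x := A / B) (δ := δ) (β := γ / B)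
        (by rcases hδ with rfl | rfl <;> norm_num) ?_
      push_cast
      field_simp
      linear_combination hγ
    · exact absurd hγ (cubic_not_one_sub_class b hb hφ hB
        (by rcases hδ with rfl | rfl <;> decide) γ)
  · exact absurd hd (by rcases hδ with rfl | rfl <;> norm_num)

lemma not_four_cubic_eq_fiftyThree_mul_sq {A B C : ℤ} (hco : IsCoprime A B) (hB : ¬ 53 ∣ B)
    (hAB : 53 ∣ 2 * A - 41 * B) : B * (4 * A ^ 3 - 4 * A ^ 2 * B + B ^ 3) ≠ 53 * C ^ 2 := by
  intro h
  obtain ⟨L, _, _, b, Φ, hb, hφ⟩ := exists_cubic_field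
  have hB0 : B ≠ 0 := by rintro rfl; simp at hB
  have hC : C ≠ 0 := by
    rintro rfl
    exact mul_ne_zero hB0 (four_cubic_ne_zero hco) (by rw [h]; ring)
  obtain ⟨w, γ, hw, hγ⟩ := cubic_class b hb hφ hco hC (by norm_num) h
    (by
      intro p hp hpδ hpα hpB
      obtain ⟨a, ha⟩ := hAB
      have ha' : (2 * A - 41 * B : 𝓞 L) = 53 * a := by exact_mod_cast ha
      have h53 : p ∣ (53 : 𝓞 L) := by exact_mod_cast hpδ
      have h1 : p ∣ (Φ - 41) * B := by
        have := dvd_sub (h53.mul_right (a : 𝓞 L)) hpα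
        convert! this using 1
        rw [← ha']; ring
      have h2 := (hp.dvd_or_dvd h1).resolve_right hpB
      have := dvd_add (h2.mul_right (2 * Φ + 84)) (h53.mul_right 65)
      convert! this using 1
      ring)
    (cubic_sub_ne_zero b hb hB0)
  rcases hγ with ⟨hn, -⟩ | ⟨-, hγ⟩
  · exact hn ⟨by norm_num, by norm_num, hB⟩
  · have h53 : (53 : L) ≠ 0 := by norm_num
    rcases hw with rfl | rfl
    · refine cubic_not_class_fiftyThree b hb hφ hB hAB γ (mul_left_cancel₀ h53 ?_)
      push_cast at hγ
      linear_combination hγ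
    · refine cubic_not_one_sub_mul_class b hb hφ hB0 (A := A) γ (mul_left_cancel₀ h53 ?_)
      push_cast at hγ
      linear_combination hγ

end CubicDescent

lemma abs_cubic_form_le {p q M : ℤ} (hp : |p| ≤ M) (hq : |q| ≤ M) (a b c d : ℤ) :
    |a * q ^ 3 + b * (p * q ^ 2) + c * (p ^ 2 * q) + d * p ^ 3| ≤
      (|a| + |b| + |c| + |d|) * M ^ 3 := by
  have hM0 : 0 ≤ M := (abs_nonneg p).trans hp
  have h0 : |q ^ 3| ≤ M ^ 3 := by rw [abs_pow]; gcongr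
  have h1 : |p * q ^ 2| ≤ M ^ 3 := by
    rw [abs_mul, abs_pow, pow_succ' M 2]; gcongr
  have h2 : |p ^ 2 * q| ≤ M ^ 3 := by
    rw [abs_mul, abs_pow, pow_succ M 2]; gcongr
  have h3 : |p ^ 3| ≤ M ^ 3 := by rw [abs_pow]; gcongr
  calc _ ≤ |a * q ^ 3| + |b * (p * q ^ 2)| + |c * (p ^ 2 * q)| + |d * p ^ 3| :=
        (abs_add_le _ _).trans (add_le_add ((abs_add_le _ _).trans
          (add_le_add (abs_add_le _ _) le_rfl)) le_rfl)
    _ ≤ |a| * M ^ 3 + |b| * M ^ 3 + |c| * M ^ 3 + |d| * M ^ 3 := by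
        rw [abs_mul a, abs_mul b, abs_mul c, abs_mul d]; gcongr
    _ = _ := by ring

lemma duplication_height_le {p q A B M H : ℤ} (hpq : IsCoprime p q) (hAB : IsCoprime A B)
    (h : A * (q * (4 * p ^ 3 - 4 * p ^ 2 * q + q ^ 3)) = B * (p ^ 4 - 2 * p * q ^ 3 + q ^ 4))
    (hp : |p| ≤ M) (hq : |q| ≤ M) (hM : |p| = M ∨ |q| = M) (hM0 : 0 < M) (hA : |A| ≤ H)
    (hB : |B| ≤ H) : M ^ 4 ≤ 139 * H := by
  have hH0 : 0 ≤ H := (abs_nonneg A).trans hA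
  obtain ⟨k, hN, hD⟩ : ∃ k, p ^ 4 - 2 * p * q ^ 3 + q ^ 4 = k * A ∧
      q * (4 * p ^ 3 - 4 * p ^ 2 * q + q ^ 3) = k * B := by
    obtain ⟨r, s, hrs⟩ := hAB
    refine ⟨r * (p ^ 4 - 2 * p * q ^ 3 + q ^ 4) +
      s * (q * (4 * p ^ 3 - 4 * p ^ 2 * q + q ^ 3)), ?_, ?_⟩
    · linear_combination -(p ^ 4 - 2 * p * q ^ 3 + q ^ 4) * hrs - s * h
    · linear_combination -(q * (4 * p ^ 3 - 4 * p ^ 2 * q + q ^ 3)) * hrs + r * h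
  have e1 : 11 * q ^ 7 = k * (A * (-16 * q ^ 3 + -32 * (p * q ^ 2) + 48 * (p ^ 2 * q) + 0 * p ^ 3) +
      B * (27 * q ^ 3 + 0 * (p * q ^ 2) + -4 * (p ^ 2 * q) + -12 * p ^ 3)) := by
    linear_combination (-16 * q ^ 3 + -32 * (p * q ^ 2) + 48 * (p ^ 2 * q)) * hN +
      (27 * q ^ 3 + -4 * (p ^ 2 * q) + -12 * p ^ 3) * hD
  have e2 : 11 * p ^ 7 = k * (A * (6 * q ^ 3 + 4 * (p * q ^ 2) + -20 * (p ^ 2 * q) + 11 * p ^ 3) +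
      B * (-6 * q ^ 3 + 8 * (p * q ^ 2) + 4 * (p ^ 2 * q) + 5 * p ^ 3)) := by
    linear_combination (6 * q ^ 3 + 4 * (p * q ^ 2) + -20 * (p ^ 2 * q) + 11 * p ^ 3) * hN +
      (-6 * q ^ 3 + 8 * (p * q ^ 2) + 4 * (p ^ 2 * q) + 5 * p ^ 3) * hD
  have hk : |k| ≤ 11 := by
    obtain ⟨r, s, hrs⟩ := hpq.pow (m := 7) (n := 7)
    refine Int.le_of_dvd (by norm_num) ((abs_dvd _ _).mpr ?_)
    have : (11 : ℤ) = r * (11 * p ^ 7) + s * (11 * q ^ 7) := by linear_combination -11 * hrs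
    rw [this, e1, e2]
    exact dvd_add ((dvd_mul_right _ _).mul_left _) ((dvd_mul_right _ _).mul_left _)
  have key : ∀ U V n : ℤ, |U| ≤ 96 * M ^ 3 → |V| ≤ 43 * M ^ 3 → |n| = M →
      11 * n ^ 7 = k * (A * U + B * V) → M ^ 4 ≤ 139 * H := by
    intro U V n hU hV hn hnk
    have h1 : 11 * M ^ 7 ≤ 11 * (H * (96 * M ^ 3) + H * (43 * M ^ 3)) := by
      calc 11 * M ^ 7 = |11 * n ^ 7| := by rw [abs_mul, abs_pow, hn]; rfl
        _ ≤ |k| * (|A| * |U| + |B| * |V|) := by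
            rw [hnk, abs_mul, ← abs_mul A, ← abs_mul B]; gcongr; exact abs_add_le _ _
        _ ≤ _ := by gcongr
    have h2 : M ^ 3 * M ^ 4 ≤ M ^ 3 * (139 * H) := by linarith
    exact le_of_mul_le_mul_left h2 (by positivity)
  rcases hM with hM | hM
  · refine key _ _ p ?_ ?_ hM e2
    · refine (abs_cubic_form_le hp hq _ _ _ _).trans ?_
      gcongr; decide
    · refine (abs_cubic_form_le hp hq _ _ _ _).trans ?_
      gcongr; decide
  · refine key _ _ q ?_ ?_ hM e1
    · refine (abs_cubic_form_le hp hq _ _ _ _).trans ?_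
      gcongr; decide
    · refine (abs_cubic_form_le hp hq _ _ _ _).trans ?_
      gcongr; decide

lemma four_cubic_eq_mul_sq_of_le_five {p q C δ : ℤ} (hδ : δ = 1 ∨ δ = 5) (hp : |p| ≤ 5)
    (hq : 0 < q) (hq' : q ≤ 5) (h : q * (4 * p ^ 3 - 4 * p ^ 2 * q + q ^ 3) = δ * C ^ 2) :
    δ = 1 ∧ (p = 0 ∨ p = q) := by
  have hsq : IsSquare (δ * (q * (4 * p ^ 3 - 4 * p ^ 2 * q + q ^ 3))) :=
    ⟨δ * C, by rw [h]; ring⟩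
  have enum1 : ∀ p ∈ Finset.Icc (-5 : ℤ) 5, ∀ q ∈ Finset.Icc (1 : ℤ) 5,
      IsSquare (1 * (q * (4 * p ^ 3 - 4 * p ^ 2 * q + q ^ 3))) → p = 0 ∨ p = q := by
    decide +kernel
  have enum5 : ∀ p ∈ Finset.Icc (-5 : ℤ) 5, ∀ q ∈ Finset.Icc (1 : ℤ) 5,
      ¬ IsSquare (5 * (q * (4 * p ^ 3 - 4 * p ^ 2 * q + q ^ 3))) := by
    decide +kernel
  have hp' := Finset.mem_Icc.mpr (abs_le.mp hp)
  have hq'' := Finset.mem_Icc.mpr ⟨hq, hq'⟩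
  rcases hδ with rfl | rfl
  · exact ⟨rfl, enum1 p hp' q hq'' hsq⟩
  · exact absurd hsq (enum5 p hp' q hq'')

lemma exists_int_mul_sq_of_rat {δ V : ℤ} {w : ℚ} (hδ : δ = 1 ∨ δ = 5) (h : δ * w ^ 2 = V) :
    ∃ C : ℤ, V = δ * C ^ 2 := by
  have : IsSquare ((δ * V : ℤ) : ℚ) := ⟨δ * w, by push_cast; rw [← h]; ring⟩
  rw [Rat.isSquare_intCast_iff] at this
  obtain ⟨E, hE⟩ := this
  rcases hδ with rfl | rfl
  · exact ⟨E, by linear_combination hE⟩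
  · have p5 : Prime (5 : ℤ) := Int.prime_iff_natAbs_prime.mpr (by norm_num)
    obtain ⟨C, rfl⟩ : 5 ∣ E := by
      rcases p5.dvd_or_dvd (a := E) (b := E) ⟨V, by rw [← hE]⟩ with h | h <;> exact h
    exact ⟨C, by linarith⟩

lemma four_cubic_eq_mul_sq {A B C δ : ℤ} (hδ : δ = 1 ∨ δ = 5) (hco : IsCoprime A B)
    (hB : 0 < B) (h : B * (4 * A ^ 3 - 4 * A ^ 2 * B + B ^ 3) = δ * C ^ 2) :
    δ = 1 ∧ (A = 0 ∨ A = B) := by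
  induction hH : (max |A| B).toNat using Nat.strong_induction_on generalizing A B C with
  | _ n ih =>
  subst hH
  obtain ⟨x, w, hw, hx⟩ := exists_halving hδ hco hB.ne' h
  have hq : (0 : ℤ) < x.den := by exact_mod_cast x.den_pos
  have hpq : IsCoprime x.num x.den := Rat.isCoprime_num_den x
  generalize hp : x.num = p at *
  generalize hq' : (x.den : ℤ) = q at *
  have hxe : x = p / q := by rw [← hp, ← hq']; exact_mod_cast (Rat.num_div_den x).symm
  have hq0 : (q : ℚ) ≠ 0 := by exact_mod_cast hq.ne'
  have hB0 : (B : ℚ) ≠ 0 := by exact_mod_cast hB.ne'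
  obtain ⟨C', hC'⟩ := exists_int_mul_sq_of_rat (w := w * q ^ 2)
    (V := q * (4 * p ^ 3 - 4 * p ^ 2 * q + q ^ 3)) hδ (by
      rw [hxe] at hw
      push_cast
      rw [mul_pow, ← mul_assoc, hw]
      field_simp)
  have hdup : A * (q * (4 * p ^ 3 - 4 * p ^ 2 * q + q ^ 3)) =
      B * (p ^ 4 - 2 * p * q ^ 3 + q ^ 4) := by
    rw [hxe] at hx
    field_simp at hx
    have h1 : (A : ℚ) * (q * (4 * p ^ 3 - 4 * p ^ 2 * q + q ^ 3)) =
      B * (p ^ 4 - 2 * p * q ^ 3 + q ^ 4) := by linear_combination hx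
    exact_mod_cast h1
  have hpM : |p| ≤ max |p| q := le_max_left _ _
  have hqM : q ≤ max |p| q := le_max_right _ _
  obtain ⟨hδ1, hpq'⟩ : δ = 1 ∧ (p = 0 ∨ p = q) := by
    by_cases hlt : max |p| q < max |A| B
    · exact ih _ (by omega) hpq hq hC' rfl
    · have hle := duplication_height_le (M := max |p| q) (H := max |A| B) hpq hco hdup hpM
        (by rwa [abs_of_pos hq]) (by rw [abs_of_pos hq]; exact (max_choice _ _).imp Eq.symm Eq.symm)
        (hq.trans_le hqM) (le_max_left _ _) (by rw [abs_of_pos hB]; exact le_max_right _ _)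
      have hM5 : max |p| q ≤ 5 := by
        by_contra h5
        have : 6 ≤ max |p| q := by omega
        nlinarith [pow_le_pow_left₀ (by norm_num) this 3]
      exact four_cubic_eq_mul_sq_of_le_five hδ (hpM.trans hM5) hq (hqM.trans hM5) hC'
  refine ⟨hδ1, ?_⟩
  rcases hpq' with rfl | rfl
  · right
    exact mul_right_cancel₀ (pow_ne_zero 4 hq.ne') (by linear_combination hdup)
  · left
    exact mul_right_cancel₀ (pow_ne_zero 4 hq.ne') (by linear_combination hdup)

lemma quartic_eq_mul_sq {m n C δ : ℤ} (hδ : δ = 1 ∨ δ = 5) (hco : IsCoprime m n)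
    (hmn : m + n ≠ 0) (h : m ^ 4 + 2 * m ^ 2 * n ^ 2 + 4 * m * n ^ 3 + n ^ 4 = δ * C ^ 2) :
    δ = 1 ∧ (m = 0 ∨ n = 0) := by
  wlog hpos : 0 < m + n generalizing m n
  · have := this (m := -m) (n := -n) (hco.neg_neg) (by omega) (by linear_combination h) (by omega)
    simpa using this
  have hco' : IsCoprime m (m + n) := by
    have := hco.add_mul_left_right 1
    rwa [mul_one, add_comm] at this
  obtain ⟨h1, h2⟩ := four_cubic_eq_mul_sq (A := m) (B := m + n) (C := C) hδ hco' hpos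
    (by linear_combination h)
  exact ⟨h1, by omega⟩

lemma eq_zero_or_neg_one_of_sq_eq_quartic {t y : ℚ} (h : y ^ 2 = t ^ 4 + 2 * t ^ 2 + 4 * t + 1) :
    t = 0 ∨ t = -1 := by
  have hn : (t.den : ℚ) ≠ 0 := by exact_mod_cast t.den_nz
  have ht : t = t.num / t.den := (Rat.num_div_den t).symm
  have hco := Rat.isCoprime_num_den t
  have h' : y ^ 2 = (t.num / t.den : ℚ) ^ 4 + 2 * (t.num / t.den : ℚ) ^ 2 +
      4 * (t.num / t.den : ℚ) + 1 := by rw [Rat.num_div_den, h]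
  by_cases h0 : t.num + t.den = 0
  · right
    have : (t.num : ℚ) + t.den = 0 := by exact_mod_cast h0
    rw [ht, div_eq_iff hn]; linear_combination this
  obtain ⟨C, hC⟩ := exists_int_mul_sq_of_rat (δ := 1) (w := y * t.den ^ 2)
    (V := t.num ^ 4 + 2 * t.num ^ 2 * t.den ^ 2 + 4 * t.num * t.den ^ 3 + t.den ^ 4) (.inl rfl) (by
      push_cast
      rw [mul_pow, h']
      field_simp)
  obtain ⟨-, h1 | h1⟩ := quartic_eq_mul_sq (.inl rfl) hco h0 hC
  · left; rwa [Rat.num_eq_zero] at h1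
  · exact absurd h1 (by exact_mod_cast t.den_nz)

lemma not_prime_dvd_of_isCoprime {m n p a : ℤ} (hp : Prime p) (hco : IsCoprime m n)
    (h : p ∣ m - a * n) : ¬ p ∣ n := by
  intro hn
  refine hp.not_isUnit (hco.isUnit_of_dvd' ?_ hn)
  have := dvd_add h (hn.mul_left a)
  rwa [sub_add_cancel] at this

lemma dvd_sub_of_fiftyThree_dvd {m n : ℤ}
    (h1 : 53 ∣ m ^ 4 + 2 * m ^ 2 * n ^ 2 + 4 * m * n ^ 3 + n ^ 4)
    (h2 : 53 ∣ m ^ 4 - 2 * m ^ 3 * n + 3 * m ^ 2 * n ^ 2 + 2 * m * n ^ 3 + n ^ 4) :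
    53 ∣ m - 37 * n := by
  have key : ∀ a b : ZMod 53, a ^ 4 + 2 * a ^ 2 * b ^ 2 + 4 * a * b ^ 3 + b ^ 4 = 0 →
      a ^ 4 - 2 * a ^ 3 * b + 3 * a ^ 2 * b ^ 2 + 2 * a * b ^ 3 + b ^ 4 = 0 → a - 37 * b = 0 := by
    decide +kernel
  have := key m n (by exact_mod_cast (ZMod.intCast_zmod_eq_zero_iff_dvd _ 53).mpr h1)
    (by exact_mod_cast (ZMod.intCast_zmod_eq_zero_iff_dvd _ 53).mpr h2)
  exact (ZMod.intCast_zmod_eq_zero_iff_dvd _ 53).mp (by exact_mod_cast this)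

lemma not_quartics_eq_fiftyThree_mul_sq {m n C : ℤ} (hco : IsCoprime m n)
    (h1 : m ^ 4 + 2 * m ^ 2 * n ^ 2 + 4 * m * n ^ 3 + n ^ 4 = 53 * C ^ 2)
    (h2 : 53 ∣ m ^ 4 - 2 * m ^ 3 * n + 3 * m ^ 2 * n ^ 2 + 2 * m * n ^ 3 + n ^ 4) : False := by
  have hd := dvd_sub_of_fiftyThree_dvd ⟨_, h1⟩ h2
  have p53 : Prime (53 : ℤ) := Int.prime_iff_natAbs_prime.mpr (by norm_num)
  have hn := not_prime_dvd_of_isCoprime p53 hco hd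
  have hco' : IsCoprime m (m + n) := by
    have := hco.add_mul_left_right 1
    rwa [mul_one, add_comm] at this
  exact not_four_cubic_eq_fiftyThree_mul_sq (A := m) (B := m + n) (C := C) hco' (by omega)
    (by omega) (by linear_combination h1)

lemma not_quartics_eq_mul_sq {m n Y : ℤ} (hco : IsCoprime m n)
    (h1 : 265 ∣ m ^ 4 + 2 * m ^ 2 * n ^ 2 + 4 * m * n ^ 3 + n ^ 4)
    (h2 : m ^ 4 - 2 * m ^ 3 * n + 3 * m ^ 2 * n ^ 2 + 2 * m * n ^ 3 + n ^ 4 = 265 * Y ^ 2) :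
    False := by
  have p5 : Prime (5 : ℤ) := Int.prime_iff_natAbs_prime.mpr (by norm_num)
  obtain ⟨a, ha⟩ := dvd_sub_of_fiftyThree_dvd (m := m) (n := n) (dvd_trans (by norm_num) h1)
    (by rw [h2]; exact (by norm_num : (53 : ℤ) ∣ 265).mul_right _)
  have h5 : 5 ∣ m - (-1) * n := by
    have key : ∀ a b : ZMod 5, a ^ 4 + 2 * a ^ 2 * b ^ 2 + 4 * a * b ^ 3 + b ^ 4 = 0 →
      a ^ 4 - 2 * a ^ 3 * b + 3 * a ^ 2 * b ^ 2 + 2 * a * b ^ 3 + b ^ 4 = 0 → a + b = 0 := by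
      decide
    have h1' : 5 ∣ m ^ 4 + 2 * m ^ 2 * n ^ 2 + 4 * m * n ^ 3 + n ^ 4 := dvd_trans (by norm_num) h1
    have h2' : 5 ∣ m ^ 4 - 2 * m ^ 3 * n + 3 * m ^ 2 * n ^ 2 + 2 * m * n ^ 3 + n ^ 4 := by
      rw [h2]; exact (by norm_num : (5 : ℤ) ∣ 265).mul_right _
    have := key m n (by exact_mod_cast (ZMod.intCast_zmod_eq_zero_iff_dvd _ 5).mpr h1')
      (by exact_mod_cast (ZMod.intCast_zmod_eq_zero_iff_dvd _ 5).mpr h2')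
    have h3 : (5 : ℤ) ∣ m + n := (ZMod.intCast_zmod_eq_zero_iff_dvd _ 5).mp (by exact_mod_cast this)
    omega
  have hn5 := not_prime_dvd_of_isCoprime p5 hco h5
  obtain ⟨e, he⟩ := h5
  obtain ⟨f, hf⟩ : ∃ f, m = 249 * n + 265 * f := ⟨(m - 249 * n) / 265, by omega⟩
  obtain ⟨P', hP'⟩ : ∃ P', 3 * (m ^ 2 - m * n - n ^ 2) - 16 * (2 * m * n) = 265 * P' :=
    ⟨669 * n ^ 2 + 1459 * n * f + 795 * f ^ 2, by rw [hf]; ring⟩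
  obtain ⟨Q', hQ'⟩ : ∃ Q', 16 * (m ^ 2 - m * n - n ^ 2) + 3 * (2 * m * n) = 265 * Q' :=
    ⟨3734 * n ^ 2 + 7958 * n * f + 4240 * f ^ 2, by rw [hf]; ring⟩
  have hP : m ^ 2 - m * n - n ^ 2 = 3 * P' + 16 * Q' := by linarith
  have hQ : 2 * m * n = -16 * P' + 3 * Q' := by linarith
  have hPodd : Odd (m ^ 2 - m * n - n ^ 2) := by
    rw [← Int.not_even_iff_odd]
    intro hev
    have : ¬ (Even m ∧ Even n) := fun ⟨hm, hn⟩ =>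
      Int.prime_two.not_isUnit (hco.isUnit_of_dvd' hm.two_dvd hn.two_dvd)
    simp only [Int.even_sub, Int.even_mul, Int.even_pow' two_ne_zero] at hev
    tauto
  have hQ'ev : Even Q' := by
    have : Even (3 * Q') := ⟨m * n + 8 * P', by linarith⟩
    exact (Int.even_mul.mp this).resolve_left (by decide)
  have hcoPQ : IsCoprime P' Q' := by
    refine isCoprime_of_prime_not_dvd fun p hp hpP hpQ => ?_
    have h3 : p ∣ m ^ 2 - m * n - n ^ 2 := by
      rw [hP]; exact dvd_add (hpP.mul_left _) (hpQ.mul_left _)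
    have h4 : p ∣ 2 * m * n := by
      rw [hQ]; exact dvd_add (hpP.mul_left _) (hpQ.mul_left _)
    rcases hp.dvd_or_dvd h4 with h4 | h4
    · rcases hp.dvd_or_dvd h4 with h4 | h4
      · have hp2 : 2 ∣ p := (hp.associated_of_dvd Int.prime_two h4).symm.dvd
        exact Int.not_even_iff_odd.mpr hPodd (even_iff_two_dvd.mpr (hp2.trans h3))
      · have h5 : p ∣ n ^ 2 := by
          have := dvd_sub (h4.mul_right (m - n)) h3
          convert! this using 1; ring
        exact hp.not_isUnit (hco.isUnit_of_dvd' h4 (hp.dvd_of_dvd_pow h5))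
    · have h5 : p ∣ m ^ 2 := by
        have := dvd_add (h4.mul_right (m + n)) h3
        convert! this using 1; ring
      exact hp.not_isUnit (hco.isUnit_of_dvd' (hp.dvd_of_dvd_pow h5) h4)
  have hpyth : PythagoreanTriple P' Q' Y := by
    have : (265 : ℤ) * (P' * P' + Q' * Q') = 265 * (Y * Y) := by
      calc (265 : ℤ) * (P' * P' + Q' * Q') = (3 * P' + 16 * Q') ^ 2 + (-16 * P' + 3 * Q') ^ 2 := by
            ring
        _ = 265 * (Y * Y) := by rw [← hP, ← hQ]; linear_combination h2
    exact mul_left_cancel₀ (by norm_num) this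
  obtain ⟨x, y, ⟨hx, hy⟩ | ⟨hx, hy⟩, -⟩ := PythagoreanTriple.coprime_classification.mp
    ⟨hpyth, Int.isCoprime_iff_gcd_eq_one.mp hcoPQ⟩
  · have key : ∀ n s : ZMod 5, s ^ 2 = 2 * n ^ 2 → n = 0 := by decide
    refine hn5 ((ZMod.intCast_zmod_eq_zero_iff_dvd _ 5).mp (key n (x + 2 * y : ℤ) ?_))
    have hm : m = -n + 5 * e := by linarith
    have : (x + 2 * y) ^ 2 - 2 * n ^ 2 = 5 * (-n ^ 2 + n * e + 5 * e ^ 2 + y ^ 2 + 6 * P' - 4 * Q') := by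
      have h6 : m ^ 2 - m * n - n ^ 2 + 2 * (2 * m * n) = -29 * P' + 22 * Q' := by linarith
      rw [hm] at h6
      linear_combination (-1) * hx - 2 * hy - h6
    have h7 := congrArg (Int.cast : ℤ → ZMod 5) this
    push_cast at h7 ⊢
    have h50 : (5 : ZMod 5) = 0 := by decide
    rw [h50, zero_mul, sub_eq_zero] at h7
    exact h7
  · have : Even P' := ⟨x * y, by rw [hx]; ring⟩
    refine Int.not_even_iff_odd.mpr hPodd ?_
    rw [hP]
    exact (this.mul_left 3).add (hQ'ev.mul_left 16)

lemma not_quartics_mul_eq_sq {m n S : ℤ} (hco : IsCoprime m n) (hm : m ≠ 0) (hn : n ≠ 0)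
    (hmn : m + n ≠ 0)
    (h : (m ^ 4 + 2 * m ^ 2 * n ^ 2 + 4 * m * n ^ 3 + n ^ 4) *
      (m ^ 4 - 2 * m ^ 3 * n + 3 * m ^ 2 * n ^ 2 + 2 * m * n ^ 3 + n ^ 4) = S ^ 2) : False := by
  have hG2 : 0 < m ^ 4 - 2 * m ^ 3 * n + 3 * m ^ 2 * n ^ 2 + 2 * m * n ^ 3 + n ^ 4 := by
    have : 0 < (m ^ 2 - m * n - n ^ 2) ^ 2 + (2 * m * n) ^ 2 := by positivity
    linarith
  have hG1 : 0 ≤ m ^ 4 + 2 * m ^ 2 * n ^ 2 + 4 * m * n ^ 3 + n ^ 4 := by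
    by_contra hneg
    nlinarith [sq_nonneg S]
  have e1 : 265 * n ^ 7 = (-173 * n ^ 3 - 418 * m * n ^ 2 + 269 * m ^ 2 * n - 118 * m ^ 3) *
      (m ^ 4 + 2 * m ^ 2 * n ^ 2 + 4 * m * n ^ 3 + n ^ 4) +
      (438 * n ^ 3 + 234 * m * n ^ 2 - 33 * m ^ 2 * n + 118 * m ^ 3) *
      (m ^ 4 - 2 * m ^ 3 * n + 3 * m ^ 2 * n ^ 2 + 2 * m * n ^ 3 + n ^ 4) := by ring
  have e2 : 265 * m ^ 7 = (-162 * n ^ 3 - 347 * m * n ^ 2 - 514 * m ^ 2 * n + 323 * m ^ 3) *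
      (m ^ 4 + 2 * m ^ 2 * n ^ 2 + 4 * m * n ^ 3 + n ^ 4) +
      (162 * n ^ 3 + 671 * m * n ^ 2 + 398 * m ^ 2 * n - 58 * m ^ 3) *
      (m ^ 4 - 2 * m ^ 3 * n + 3 * m ^ 2 * n ^ 2 + 2 * m * n ^ 3 + n ^ 4) := by ring
  generalize hg1 : m ^ 4 + 2 * m ^ 2 * n ^ 2 + 4 * m * n ^ 3 + n ^ 4 = G1 at *
  generalize hg2 : m ^ 4 - 2 * m ^ 3 * n + 3 * m ^ 2 * n ^ 2 + 2 * m * n ^ 3 + n ^ 4 = G2 at *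
  have hgpos : 0 < Int.gcd G1 G2 := Int.gcd_pos_of_ne_zero_right _ hG2.ne'
  obtain ⟨X, Y, hXY, hX, hY⟩ := Int.exists_gcd_one hgpos
  generalize Int.gcd G1 G2 = g at *
  have hgpos' : (0 : ℤ) < g := by exact_mod_cast hgpos
  have hg : g ∣ 265 := by
    obtain ⟨r, s, hrs⟩ := hco.pow (m := 7) (n := 7)
    have h265 : (265 : ℤ) = r * (265 * m ^ 7) + s * (265 * n ^ 7) := by
      linear_combination -265 * hrs
    have h1 : (g : ℤ) ∣ G1 := ⟨X, by rw [hX]; ring⟩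
    have h2 : (g : ℤ) ∣ G2 := ⟨Y, by rw [hY]; ring⟩
    have : (g : ℤ) ∣ 265 := by
      rw [h265, e1, e2]
      exact dvd_add ((dvd_add (h1.mul_left _) (h2.mul_left _)).mul_left _)
        ((dvd_add (h1.mul_left _) (h2.mul_left _)).mul_left _)
    exact_mod_cast this
  have hcoXY : IsCoprime X Y := Int.isCoprime_iff_gcd_eq_one.mpr hXY
  have hX0 : 0 ≤ X := nonneg_of_mul_nonneg_left (hX ▸ hG1) hgpos'
  have hY0 : 0 ≤ Y := nonneg_of_mul_nonneg_left (hY ▸ hG2.le) hgpos'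
  obtain ⟨S', rfl⟩ : (g : ℤ) ∣ S := by
    rw [← Int.pow_dvd_pow_iff (n := 2) two_ne_zero]
    exact ⟨X * Y, by rw [← h, hX, hY]; ring⟩
  have hXYsq : X * Y = S' ^ 2 := by
    refine mul_left_cancel₀ (pow_ne_zero 2 hgpos'.ne') ?_
    rw [← mul_pow, ← h, hX, hY]; ring
  obtain ⟨C, rfl⟩ := Int.exists_sq_of_isCoprime_of_nonneg hcoXY hXYsq hX0
  obtain ⟨Z, rfl⟩ := Int.exists_sq_of_isCoprime_of_nonneg hcoXY.symm
    (by rw [mul_comm]; exact hXYsq) hY0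
  have hg4 : g = 1 ∨ g = 5 ∨ g = 53 ∨ g = 265 := by
    have h1 : g ∈ Nat.divisors 265 := Nat.mem_divisors.mpr ⟨hg, by norm_num⟩
    have h2 : Nat.divisors 265 = {1, 5, 53, 265} := by decide +kernel
    rw [h2] at h1
    simpa using h1
  rw [mul_comm] at hX hY
  rcases hg4 with rfl | rfl | rfl | rfl
  · have := quartic_eq_mul_sq (δ := 1) (.inl rfl) hco hmn (hg1.trans hX)
    tauto
  · have := quartic_eq_mul_sq (δ := 5) (.inr rfl) hco hmn (hg1.trans hX)
    norm_num at this
  · exact not_quartics_eq_fiftyThree_mul_sq hco (hg1.trans hX) ⟨_, hg2.trans hY⟩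
  · exact not_quartics_eq_mul_sq hco ⟨_, hg1.trans hX⟩ (hg2.trans hY)

lemma not_isSquare_quartics_mul {t s : ℚ} (ht : t ≠ 0) (ht' : t ≠ -1)
    (h : (t ^ 4 + 2 * t ^ 2 + 4 * t + 1) * (t ^ 4 - 2 * t ^ 3 + 3 * t ^ 2 + 2 * t + 1) = s ^ 2) :
    False := by
  have hn : (t.den : ℚ) ≠ 0 := by exact_mod_cast t.den_nz
  have hmn : t.num + t.den ≠ 0 := by
    intro h0
    have h1 : (t.num : ℚ) + t.den = 0 := by exact_mod_cast h0
    rw [← Rat.num_div_den t] at ht'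
    refine ht' ?_
    rw [div_eq_iff hn]; linear_combination h1
  rw [← Rat.num_div_den t] at h
  obtain ⟨S, hS⟩ := exists_int_mul_sq_of_rat (δ := 1) (w := s * t.den ^ 4)
    (V := (t.num ^ 4 + 2 * t.num ^ 2 * t.den ^ 2 + 4 * t.num * t.den ^ 3 + t.den ^ 4) *
      (t.num ^ 4 - 2 * t.num ^ 3 * t.den + 3 * t.num ^ 2 * t.den ^ 2 + 2 * t.num * t.den ^ 3
        + t.den ^ 4)) (.inl rfl) (by
      push_cast
      rw [mul_pow, ← h]
      field_simp)
  refine not_quartics_mul_eq_sq (Rat.isCoprime_num_den t) (Rat.num_ne_zero.mpr ht)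
    (by exact_mod_cast t.den_nz) hmn (hS.trans (one_mul _))

section Quadratic

variable {K : Type*} [Field K] [NumberField K]

lemma quadratic_repr_unique {t : K} (ht : ∀ q : ℚ, (q : K) ≠ t) {a b : ℚ}
    (h : (a : K) + b * t = 0) : a = 0 ∧ b = 0 := by
  have hb : b = 0 := by
    by_contra hb
    have hb' : (b : K) ≠ 0 := by exact_mod_cast hb
    refine ht (-a / b) ?_
    push_cast
    rw [div_eq_iff hb']; linear_combination -h
  subst hb
  exact ⟨by simpa using h, rfl⟩

lemma quadratic_repr (hK : Module.finrank ℚ K = 2) {t : K} (ht : ∀ q : ℚ, (q : K) ≠ t) (y : K) :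
    ∃ a b : ℚ, y = a + b * t := by
  have hli : LinearIndependent ℚ ![1, t] := by
    rw [LinearIndependent.pair_iff]
    intro a b h
    refine quadratic_repr_unique ht ?_
    simpa [Algebra.smul_def] using h
  have hspan := hli.span_eq_top_of_card_eq_finrank (by simp [hK])
  have hy : y ∈ Submodule.span ℚ (Set.range ![1, t]) := by rw [hspan]; trivial
  rw [Matrix.range_cons_cons_empty, Submodule.mem_span_pair] at hy
  obtain ⟨a, b, h⟩ := hy
  exact ⟨a, b, by rw [← h]; simp [Algebra.smul_def]⟩

lemma isSquare_of_quadratic_sq (hK : Module.finrank ℚ K = 2) {y z : K} {r s : ℚ}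
    (hy : y ^ 2 = r) (hz : z ^ 2 = s) : (∃ q, r = q ^ 2) ∨ (∃ q, s = q ^ 2) ∨ ∃ q, r * s = q ^ 2 := by
  by_cases hrat : ∀ q : ℚ, (q : K) ≠ y
  · obtain ⟨a, b, rfl⟩ := quadratic_repr hK hrat z
    obtain ⟨h1, h2⟩ := quadratic_repr_unique hrat (a := a ^ 2 + b ^ 2 * r - s) (b := 2 * a * b) (by
      push_cast; rw [← hy, ← hz]; ring)
    rcases mul_eq_zero.mp h2 with h2 | rfl
    · have ha : a = 0 := by linarith
      subst ha
      exact .inr (.inr ⟨b * r, by linear_combination -r * h1⟩)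
    · exact .inr (.inl ⟨a, by linear_combination -h1⟩)
  · push Not at hrat
    obtain ⟨q, rfl⟩ := hrat
    exact .inl ⟨q, by exact_mod_cast hy.symm⟩

lemma quartic_relation (hK : Module.finrank ℚ K = 2) {t y : K} (ht : ∀ q : ℚ, (q : K) ≠ t)
    {T N : ℚ} (hTN : t ^ 2 = T * t - N) (hy : y ^ 2 = t ^ 4 + 2 * t ^ 2 + 4 * t + 1) :
    T * (N - 1) = 1 ∨ T * (N + 1) + N ^ 2 + 2 * N = 0 := by
  obtain ⟨y0, y1, rfl⟩ := quadratic_repr hK ht y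
  obtain ⟨a, ha⟩ : ∃ a, a = y1 - T := ⟨_, rfl⟩
  obtain ⟨b, hb⟩ : ∃ b, b = y0 + N := ⟨_, rfl⟩
  obtain ⟨k, hk⟩ : ∃ k, k = 2 - a ^ 2 - 2 * b - 2 * a * T := ⟨_, rfl⟩
  have hy' : (t ^ 2 + a * t + b) ^ 2 = t ^ 4 + 2 * t ^ 2 + 4 * t + 1 := by
    rw [← hy, ha, hb, hTN]; push_cast; ring
  obtain ⟨h0, h1⟩ := quadratic_repr_unique ht (a := 1 - b ^ 2 - k * N)
    (b := 4 - 2 * a * b + 2 * a * N + k * T) (by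
      rw [hk]
      push_cast
      linear_combination -hy' + (2 * a * t - (2 - a ^ 2 - 2 * b - 2 * a * T)) * hTN)
  clear hy hy' ha hb hTN
  by_cases ha0 : a = 0
  · subst ha0
    have hb1 : b - 1 ≠ 0 := by
      intro hb1
      have : b = 1 := by linarith
      subst this
      norm_num at hk
      rw [hk] at h1
      norm_num at h1
    left
    have hk' : k = 2 - 2 * b := by linear_combination hk
    subst hk'
    have hN : b = 2 * N - 1 := mul_left_cancel₀ hb1 (by linear_combination -h0)
    subst hN
    linear_combination -h1 / 4
  · have hτ := eq_zero_or_neg_one_of_sq_eq_quartic (t := k / (2 * a))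
      (y := (k / (2 * a)) ^ 2 + a * (k / (2 * a)) + b) (by
        have hkk : k = k / (2 * a) * (2 * a) := by field_simp
        generalize k / (2 * a) = τ at *
        linear_combination τ ^ 2 * hk - τ * h1 - h0 - (τ ^ 2 - T * τ + N) * hkk)
    rcases hτ with hτ | hτ
    · have hk0 : k = 0 := by
        rw [div_eq_zero_iff] at hτ
        exact hτ.resolve_right (mul_ne_zero two_ne_zero ha0)
      subst hk0
      have hb1 : (b - 1) * (b + 1) = 0 := by linear_combination -h0
      rcases mul_eq_zero.mp hb1 with hb1 | hb1
      · left
        have : b = 1 := by linarith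
        subst this
        refine mul_left_cancel₀ (mul_ne_zero ha0 ha0) ?_
        linear_combination (a / 2) * (N - 1) * hk - a ^ 2 / 4 * h1
      · right
        have : b = -1 := by linarith
        subst this
        refine mul_left_cancel₀ (mul_ne_zero ha0 ha0) ?_
        have hN : a * (N + 1) = -2 := by linear_combination h1 / 2
        linear_combination (a * T + a * (N + 1) - 2) * hN - hk
    · rw [div_eq_iff (mul_ne_zero two_ne_zero ha0)] at hτ
      right
      subst hτ
      have hb1 : (1 - a + b) ^ 2 = 0 := by linear_combination hk + h1 - h0
      have hb2 : b = a - 1 := by linear_combination pow_eq_zero_iff two_ne_zero |>.mp hb1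
      subst hb2
      have hN : a = 2 * N + 2 := mul_left_cancel₀ ha0 (by linear_combination -h0)
      subst hN
      linear_combination hk / 4

lemma quartic_fixed_relation (hK : Module.finrank ℚ K = 2) {t z : K} (ht : ∀ q : ℚ, (q : K) ≠ t)
    {T N : ℚ} (hTN : t ^ 2 = T * t - N)
    (hz : z ^ 2 = t ^ 4 - 2 * t ^ 3 + 3 * t ^ 2 + 2 * t + 1) :
    T * (N - 1) = N ∨ N = -1 := by
  obtain ⟨z0, z1, rfl⟩ := quadratic_repr hK ht z
  obtain ⟨a, ha⟩ : ∃ a, a = z1 - T := ⟨_, rfl⟩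
  obtain ⟨b, hb⟩ : ∃ b, b = z0 + N := ⟨_, rfl⟩
  obtain ⟨k, hk⟩ : ∃ k, k = 3 - a ^ 2 - 2 * b - (2 + 2 * a) * T := ⟨_, rfl⟩
  have hz' : (t ^ 2 + a * t + b) ^ 2 = t ^ 4 - 2 * t ^ 3 + 3 * t ^ 2 + 2 * t + 1 := by
    rw [← hz, ha, hb, hTN]; push_cast; ring
  obtain ⟨h0, h1⟩ := quadratic_repr_unique ht (a := 1 - b ^ 2 - k * N)
    (b := 2 - 2 * a * b + (2 + 2 * a) * N + k * T) (by
      rw [hk]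
      push_cast
      linear_combination -hz' + ((2 + 2 * a) * t - (3 - a ^ 2 - 2 * b - (2 + 2 * a) * T)) * hTN)
  clear hz hz' ha hb hTN
  by_cases ha0 : 1 + a = 0
  · have ha1 : a = -1 := by linarith
    subst ha1
    have hb1 : b - 1 ≠ 0 := by
      intro hb1
      have : b = 1 := by linarith
      subst this
      norm_num at hk
      rw [hk] at h1
      norm_num at h1
    left
    have hk' : k = 2 - 2 * b := by linear_combination hk
    subst hk'
    have hN : b = 2 * N - 1 := mul_left_cancel₀ hb1 (by linear_combination -h0)
    subst hN
    linear_combination -h1 / 4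
  · have ha2 : 2 + 2 * a ≠ 0 := fun h => ha0 (by linarith)
    have hτ := eq_zero_of_sq_eq_quartic_fixed (k / (2 + 2 * a))
      ((k / (2 + 2 * a)) ^ 2 + a * (k / (2 + 2 * a)) + b) (by
        have hkk : k = k / (2 + 2 * a) * (2 + 2 * a) := by field_simp
        generalize k / (2 + 2 * a) = τ at *
        linear_combination τ ^ 2 * hk - τ * h1 - h0 - (τ ^ 2 - T * τ + N) * hkk)
    have hk0 : k = 0 := by
      rw [div_eq_zero_iff] at hτ
      exact hτ.resolve_right ha2
    subst hk0
    have hb1 : (b - 1) * (b + 1) = 0 := by linear_combination -h0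
    rcases mul_eq_zero.mp hb1 with hb1 | hb1
    · left
      have : b = 1 := by linarith
      subst this
      have hT : T = (1 - a) / 2 := mul_left_cancel₀ ha2 (by linear_combination hk)
      subst hT
      linear_combination -h1 / 4
    · right
      have : b = -1 := by linarith
      subst this
      exact mul_left_cancel₀ ha2 (by linear_combination h1)

lemma sq_eq_of_quartics (hK : Module.finrank ℚ K = 2) {t y z : K} (ht0 : t ≠ 0) (ht1 : t ≠ -1)
    (hy : y ^ 2 = t ^ 4 + 2 * t ^ 2 + 4 * t + 1)
    (hz : z ^ 2 = t ^ 4 - 2 * t ^ 3 + 3 * t ^ 2 + 2 * t + 1) : 2 * t ^ 2 = 2 - t := by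
  by_cases ht : ∀ q : ℚ, (q : K) ≠ t
  · obtain ⟨n, T, hTN⟩ := quadratic_repr hK ht (t ^ 2)
    obtain ⟨N, rfl⟩ : ∃ N, n = -N := ⟨-n, by ring⟩
    have hTN' : t ^ 2 = T * t - N := by rw [hTN]; push_cast; ring
    have hR := quartic_relation hK ht hTN' hy
    have hS := quartic_fixed_relation hK ht hTN' hz
    rcases hR with hR | hR <;> rcases hS with hS | rfl
    · have hN : N = 1 := by rw [← hS, hR]
      subst hN
      norm_num at hR
    · have hT : T = -1 / 2 := by linarith
      subst hT
      rw [hTN']; push_cast; ring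
    · exfalso
      have h1 : N * (N ^ 2 + 2 * N - 1) = 0 := by linear_combination (N - 1) * hR - (N + 1) * hS
      rcases mul_eq_zero.mp h1 with rfl | h1
      · refine ht T (mul_right_cancel₀ ht0 ?_)
        rw [← sq, hTN']; push_cast; ring
      · have h2 : IsSquare ((2 : ℤ) : ℚ) := ⟨N + 1, by push_cast; linear_combination -h1⟩
        rw [Rat.isSquare_intCast_iff] at h2
        exact absurd h2 (by decide +kernel)
    · norm_num at hR
  · exfalso
    push Not at ht
    obtain ⟨q, rfl⟩ := ht
    have hq0 : q ≠ 0 := by exact_mod_cast ht0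
    have hq1 : q ≠ -1 := by exact_mod_cast ht1
    rcases isSquare_of_quadratic_sq hK (r := q ^ 4 + 2 * q ^ 2 + 4 * q + 1)
      (s := q ^ 4 - 2 * q ^ 3 + 3 * q ^ 2 + 2 * q + 1) (by rw [hy]; push_cast; ring)
      (by rw [hz]; push_cast; ring) with ⟨w, hw⟩ | ⟨w, hw⟩ | ⟨w, hw⟩
    · exact (eq_zero_or_neg_one_of_sq_eq_quartic hw.symm).elim hq0 hq1
    · exact hq0 (eq_zero_of_sq_eq_quartic_fixed q w hw.symm)
    · exact not_isSquare_quartics_mul hq0 hq1 hw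

lemma eq_of_fixed_point_of_type_two_three (hK : Module.finrank ℚ K = 2) {c α β : K}
    (hα : HasExactPeriod c 1 α) (hβ : HasPreperiodicType c 2 3 β) : c = (-21 / 16 : ℚ) := by
  have hα' : α ^ 2 + c = α := hα.1
  obtain ⟨⟨h1, h2⟩, h3⟩ := hβ
  replace h2 := h2 1 le_rfl one_lt_two
  simp only [fc, Function.iterate_succ, Function.iterate_zero, Function.comp_apply, id_eq,
    Nat.add_one_sub_one, Nat.reduceAdd] at h1 h2 h3
  obtain ⟨u, hu⟩ : ∃ u, u = β ^ 2 + c := ⟨_, rfl⟩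
  obtain ⟨w, hw⟩ : ∃ w, w = u ^ 2 + c := ⟨_, rfl⟩
  obtain ⟨v, hv⟩ : ∃ v, v = w ^ 2 + c := ⟨_, rfl⟩
  obtain ⟨p, hp⟩ : ∃ p, p = v ^ 2 + c := ⟨_, rfl⟩
  simp only [← hu, ← hw, ← hv, ← hp] at h1 h2 h3
  have hwp : w = -p := by
    have : (w - p) * (w + p) = 0 := by linear_combination h1.symm - hv
    rcases mul_eq_zero.mp this with h | h
    · exact absurd (by linear_combination -h) h3
    · linear_combination h
  have hvp : v = -1 - p := by
    refine mul_left_cancel₀ (sub_ne_zero.mpr h2) ?_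
    linear_combination h1 + hp
  subst hwp hvp
  have hc : c = -(1 + p + p ^ 2) := by linear_combination -hp
  have hp0 : p ≠ 0 := fun h => h3 (by rw [h, neg_zero])
  have hup : (u - p) * (u + p) = 1 := by linear_combination -hw - hc
  have ht0 : u - p ≠ 0 := left_ne_zero_of_mul_eq_one hup
  obtain ⟨t, ht⟩ : ∃ t, t = u - p := ⟨_, rfl⟩
  rw [← ht] at ht0 hup
  have hu' : u = t + p := by rw [ht]; ring
  subst hu'
  have hpt : 2 * t * p = 1 - t ^ 2 := by linear_combination hup
  have ht1 : t ≠ -1 := by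
    rintro rfl
    exact hp0 (by linear_combination -hpt / 2)
  have hmain := sq_eq_of_quartics hK ht0 ht1 (y := 2 * t * β) (z := t * (2 * α - 1))
    (by
      have hβ2 : β ^ 2 = t + p + 1 + p + p ^ 2 := by linear_combination -hu - hc
      rw [mul_pow, hβ2]
      linear_combination (2 * t * p + 1 - t ^ 2 + 4 * t) * hpt)
    (by
      have hα2 : (2 * α - 1) ^ 2 = 1 + 4 * (1 + p + p ^ 2) := by linear_combination 4 * hα' - 4 * hc
      rw [mul_pow, hα2]
      linear_combination (2 * t * p + 1 - t ^ 2 + 2 * t) * hpt)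
  have hp4 : p = 1 / 4 := by
    refine mul_left_cancel₀ (mul_ne_zero two_ne_zero ht0) ?_
    linear_combination hpt - hmain / 2
  rw [hc, hp4]
  norm_num

end Quadratic

lemma exists_realizesG4 : ∃ (K : Type) (iF : Field K) (iN : @NumberField K iF),
    @ContainsSqrt17 K iF ∧ @RealizesG4 (-21 / 16) K iF iN := by
  have hirr : ¬ IsSquare ((17 : ℤ) : ℚ) := by rw [Rat.isSquare_intCast_iff]; decide +kernel
  let f : Polynomial ℚ := Polynomial.X ^ 2 - Polynomial.C 17
  have hf : Irreducible f := by
    refine X_pow_sub_C_irreducible_of_prime Nat.prime_two fun b hb => hirr ⟨b, ?_⟩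
    push_cast
    rw [← hb, sq]
  have hd : f.natDegree = 2 := Polynomial.natDegree_X_pow_sub_C
  have : Fact (Irreducible f) := ⟨hf⟩
  let pb := AdjoinRoot.powerBasis hf.ne_zero
  have : FiniteDimensional ℚ (AdjoinRoot f) := pb.finite
  have hN : NumberField (AdjoinRoot f) := ⟨⟩
  have hs : AdjoinRoot.root f ^ 2 = 17 := by
    have := AdjoinRoot.eval₂_root f
    simp only [f, Polynomial.eval₂_sub, Polynomial.eval₂_pow, Polynomial.eval₂_X,
      Polynomial.eval₂_ofNat, map_ofNat] at this
    linear_combination this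
  refine ⟨AdjoinRoot f, inferInstance, hN, ⟨AdjoinRoot.root f, hs⟩, pb.finrank.trans hd,
    ⟨7 / 4, ?_, fun j hj hj2 => absurd hj2 (by omega)⟩,
    ⟨(2 + AdjoinRoot.root f) / 4, ⟨?_, fun j hj hj2 => ?_⟩, ?_⟩⟩
  · simp only [fc, Function.iterate_one]
    push_cast
    norm_num
  all_goals
    have h1 : fc ((-21 / 16 : ℚ) : AdjoinRoot f) ((2 + AdjoinRoot.root f) / 4) =
        AdjoinRoot.root f / 4 := by
      simp only [fc]; push_cast; linear_combination hs / 16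
    have h2 : fc ((-21 / 16 : ℚ) : AdjoinRoot f) (AdjoinRoot.root f / 4) = -1 / 4 := by
      simp only [fc]; push_cast; linear_combination hs / 16
    have h3 : fc ((-21 / 16 : ℚ) : AdjoinRoot f) (-1 / 4) = -5 / 4 := by
      simp only [fc]; push_cast; norm_num
    have h4 : fc ((-21 / 16 : ℚ) : AdjoinRoot f) (-5 / 4) = 1 / 4 := by
      simp only [fc]; push_cast; norm_num
    have h5 : fc ((-21 / 16 : ℚ) : AdjoinRoot f) (1 / 4) = -5 / 4 := by
      simp only [fc]; push_cast; norm_num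
  · simp only [Function.iterate_succ, Function.iterate_zero, Function.comp_apply, id_eq,
      h1, h2, h3, h4, h5]
  · obtain rfl : j = 1 := by omega
    simp only [Function.iterate_succ, Function.iterate_zero, Function.comp_apply, id_eq,
      h1, h2, h3, h4]
    norm_num
  · simp only [Function.iterate_succ, Function.iterate_zero, Function.comp_apply, id_eq,
      Nat.add_one_sub_one, Nat.reduceAdd, h1, h2, h3, h4]
    norm_num

theorem fixed_point_and_type_2_3 :
    (∀ (K : Type) [Field K] [NumberField K], Module.finrank ℚ K = 2 →
      ∀ c : K, (∃ α : K, HasExactPeriod c 1 α) →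
        (∃ β : K, HasPreperiodicType c 2 3 β) → ∃ q : ℚ, (q : K) = c) ∧
    ((-21 / 16 : ℚ) ∈ G4RatSet ∧
      ∃ (K : Type) (iF : Field K) (iN : @NumberField K iF),
        @ContainsSqrt17 K iF ∧ @RealizesG4 (-21 / 16) K iF iN) ∧
    G4RatSet.encard ≤ 4 := by
  refine ⟨fun K _ _ hK c ⟨α, hα⟩ ⟨β, hβ⟩ =>
    ⟨-21 / 16, (eq_of_fixed_point_of_type_two_three hK hα hβ).symm⟩, ⟨?_, exists_realizesG4⟩, ?_⟩
  · obtain ⟨K, iF, iN, -, h⟩ := exists_realizesG4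
    exact ⟨K, iF, iN, h⟩
  · have hsub : G4RatSet ⊆ {-21 / 16} := by
      rintro q ⟨K, iF, iN, hK, ⟨α, hα⟩, ⟨β, hβ⟩⟩
      have := eq_of_fixed_point_of_type_two_three hK hα hβ
      exact_mod_cast this
    calc G4RatSet.encard ≤ ({-21 / 16} : Set ℚ).encard := Set.encard_le_encard hsub
      _ = 1 := Set.encard_singleton _
      _ ≤ 4 := by norm_num
end

section
/- Let K be a quadratic field and let c ∈ K. Then there do not exist α₁, α₂, β ∈ K such that α₁ and α₂ both have preperiodic type 1₂ under f_c with f_c(α₁) ≠ f_c(α₂), and β has exact period 2 under f_c. -/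
theorem sq_emod_eight_of_odd {x : ℤ} (hx : x % 2 = 1) : x ^ 2 % 8 = 1 := by
  have h : x % 8 = 1 ∨ x % 8 = 3 ∨ x % 8 = 5 ∨ x % 8 = 7 := by omega
  rcases h with h | h | h | h <;> simp [pow_two, Int.mul_emod, h]

/-- The descent step for the concordant forms `x² + w²`, `x² + n² w²`. -/
theorem concordant_descent {n u v s t : ℤ} (hn : n = 2 ∨ n = 4) (huv : IsCoprime u v)
    (hsub : u ^ 2 - v ^ 2 = s ^ 2 - t ^ 2) (hmul : n * (u * v) = s * t) (hs : s % 2 = 1)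
    (hv : v ≠ 0) :
    ∃ x w y z : ℤ, IsCoprime x w ∧ x % 2 = 1 ∧ w ∣ v ∧ x ^ 2 + w ^ 2 = y ^ 2 ∧
      x ^ 2 + n ^ 2 * w ^ 2 = z ^ 2 := by
  have hs0 : s ≠ 0 := by rintro rfl; norm_num at hs
  have hns : IsCoprime n s := by
    have h2 : IsCoprime (2 : ℤ) s := ⟨-(s / 2), 1, by omega⟩
    rcases hn with rfl | rfl
    · exact h2
    · have := h2.pow_left (m := 2); norm_num at this; exact this
  have hn0 : n ≠ 0 := by rcases hn with rfl | rfl <;> norm_num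
  obtain ⟨t', rfl⟩ : n ∣ t := hns.dvd_of_dvd_mul_left (hmul ▸ dvd_mul_right n _)
  have huv' : u * v = s * t' := mul_left_cancel₀ hn0 (by linear_combination hmul)
  obtain ⟨x, z, ⟨y, rfl⟩, ⟨w, rfl⟩, rfl⟩ :=
    exists_dvd_and_dvd_of_dvd_mul (huv' ▸ dvd_mul_right s t' : s ∣ u * v)
  obtain rfl : t' = y * w := mul_left_cancel₀ hs0 (by linear_combination -huv')
  have hw0 : w ≠ 0 := right_ne_zero_of_mul hv
  have hxw : IsCoprime x w := huv.of_mul_left_left.of_mul_right_right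
  have hyz : IsCoprime y z := huv.of_mul_left_right.of_mul_right_left
  have hxo : x % 2 = 1 := by
    rcases Int.emod_two_eq_zero_or_one x with h | h
    · simp [Int.mul_emod, h] at hs
    · exact h
  have hzo : z % 2 = 1 := by
    rcases Int.emod_two_eq_zero_or_one z with h | h
    · simp [Int.mul_emod, h] at hs
    · exact h
  have key : x ^ 2 * (z ^ 2 - y ^ 2) = w ^ 2 * (n ^ 2 * y ^ 2 - z ^ 2) := by
    linear_combination -hsub
  obtain ⟨k, hk⟩ : w ^ 2 ∣ z ^ 2 - y ^ 2 :=
    (hxw.symm.pow (m := 2) (n := 2)).dvd_of_dvd_mul_left (key.symm ▸ dvd_mul_right _ _)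
  have hk' : n ^ 2 * y ^ 2 - z ^ 2 = x ^ 2 * k :=
    mul_left_cancel₀ (pow_ne_zero 2 hw0) (by rw [← key, hk]; ring)
  have e1 : (n ^ 2 - 1) * y ^ 2 = k * (w ^ 2 + x ^ 2) := by linear_combination hk + hk'
  have e2 : (n ^ 2 - 1) * z ^ 2 = k * (n ^ 2 * w ^ 2 + x ^ 2) := by
    linear_combination n ^ 2 * hk + hk'
  have hkd : k ∣ n ^ 2 - 1 := by
    obtain ⟨p, q, hpq⟩ := hyz.pow (m := 2) (n := 2)
    exact ⟨p * (w ^ 2 + x ^ 2) + q * (n ^ 2 * w ^ 2 + x ^ 2), by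
      linear_combination p * e1 + q * e2 - (n ^ 2 - 1) * hpq⟩
  have hx8 : x ^ 2 % 8 = 1 := sq_emod_eight_of_odd hxo
  have hz8 : z ^ 2 % 8 = 1 := sq_emod_eight_of_odd hzo
  have hwpos : 0 < w ^ 2 := by positivity
  have hkpos : 0 < k := by
    by_contra! h
    have h1 : 0 < (n ^ 2 - 1) := by rcases hn with rfl | rfl <;> norm_num
    have hz0 : z ≠ 0 := by rintro rfl; norm_num at hzo
    have : 0 < (n ^ 2 - 1) * z ^ 2 := by positivity
    have : k * (n ^ 2 * w ^ 2 + x ^ 2) ≤ 0 := mul_nonpos_of_nonpos_of_nonneg h (by positivity)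
    omega
  have hkn : k = n ^ 2 - 1 := by
    have hmod : (x ^ 2 * k) % 8 = k % 8 := by rw [Int.mul_emod, hx8]; simp
    have hle := Int.le_of_dvd (by rcases hn with rfl | rfl <;> norm_num) hkd
    rcases hn with rfl | rfl
    · norm_num at hkd hle ⊢
      interval_cases k <;> omega
    · norm_num at hkd hle ⊢
      interval_cases k <;> omega
  have hn1 : n ^ 2 - 1 ≠ 0 := by rcases hn with rfl | rfl <;> norm_num
  subst hkn
  exact ⟨x, w, y, z, hxw, hxo, dvd_mul_left _ _, mul_left_cancel₀ hn1 (by linear_combination -e1),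
    mul_left_cancel₀ hn1 (by linear_combination -e2)⟩

theorem exists_of_odd_pythagorean {a b c : ℤ} (ha : a % 2 = 1) (hab : IsCoprime a b)
    (h : a ^ 2 + b ^ 2 = c ^ 2) :
    ∃ u v : ℤ, a = u ^ 2 - v ^ 2 ∧ b = 2 * (u * v) ∧ IsCoprime u v ∧
      (u % 2 = 1 ∨ v % 2 = 1) := by
  have hp : PythagoreanTriple a b c := by
    unfold PythagoreanTriple; linear_combination h
  obtain ⟨u, v, huv, hcop, hpar⟩ :=
    hp.isPrimitiveClassified_of_coprime (Int.isCoprime_iff_gcd_eq_one.1 hab)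
  rcases huv with ⟨h1, h2⟩ | ⟨h1, h2⟩
  · exact ⟨u, v, h1, by rw [h2]; ring, Int.isCoprime_iff_gcd_eq_one.2 hcop, by tauto⟩
  · rw [h1, mul_assoc] at ha
    omega

theorem concordant_of_odd {n : ℤ} (hn : n = 2 ∨ n = 4) (a b c d : ℤ) (ha : a % 2 = 1)
    (hab : IsCoprime a b) (hc : a ^ 2 + b ^ 2 = c ^ 2) (hd : a ^ 2 + n ^ 2 * b ^ 2 = d ^ 2) :
    b = 0 := by
  induction hN : b.natAbs using Nat.strong_induction_on generalizing a b c d with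
  | _ N ih =>
    subst hN
    by_contra hb
    have han : IsCoprime a (n * b) := by
      have h2 : IsCoprime a (2 : ℤ) := ⟨1, -(a / 2), by omega⟩
      refine IsCoprime.mul_right ?_ hab
      rcases hn with rfl | rfl
      · exact h2
      · have := h2.pow_right (n := 2); norm_num at this; exact this
    obtain ⟨u, v, hau, hbu, huv, -⟩ := exists_of_odd_pythagorean ha hab hc
    obtain ⟨s, t, has, hbs, -, hpar⟩ :=
      exists_of_odd_pythagorean (c := d) ha han (by linear_combination hd)
    have hmul : n * (u * v) = s * t := by
      rw [hbu] at hbs; linarith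
    have huv0 : u * v ≠ 0 := by rintro h; simp [h] at hbu; exact hb hbu
    have descend : ∃ x w y z : ℤ, IsCoprime x w ∧ x % 2 = 1 ∧ w ∣ u * v ∧
        x ^ 2 + w ^ 2 = y ^ 2 ∧ x ^ 2 + n ^ 2 * w ^ 2 = z ^ 2 := by
      rcases hpar with hs | ht
      · obtain ⟨x, w, y, z, h1, h2, h3, h4⟩ := concordant_descent hn huv (hau.symm.trans has) hmul
          hs (right_ne_zero_of_mul huv0)
        exact ⟨x, w, y, z, h1, h2, h3.mul_left u, h4⟩
      · obtain ⟨x, w, y, z, h1, h2, h3, h4⟩ := concordant_descent (s := t) (t := s) hn huv.symm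
          (by linear_combination hau - has) (by linear_combination hmul) ht
          (left_ne_zero_of_mul huv0)
        exact ⟨x, w, y, z, h1, h2, h3.mul_right v, h4⟩
    obtain ⟨x, w, y, z, hxw, hx, hw, hy, hz⟩ := descend
    have hle : w.natAbs ≤ (u * v).natAbs :=
      Nat.le_of_dvd (Int.natAbs_pos.2 huv0) (Int.natAbs_dvd_natAbs.2 hw)
    have hlt : w.natAbs < b.natAbs := by
      rw [hbu, Int.natAbs_mul 2]
      have := Int.natAbs_pos.2 huv0
      simp only [Int.reduceAbs]; omega
    have hw0 := ih _ hlt x w y z hx hxw hy hz rfl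
    subst hw0
    exact huv0 (zero_dvd_iff.1 hw)

theorem concordant_int {n : ℤ} (hn : n = 2 ∨ n = 4) {a b c d : ℤ} (hab : IsCoprime a b)
    (hc : a ^ 2 + b ^ 2 = c ^ 2) (hd : a ^ 2 + n ^ 2 * b ^ 2 = d ^ 2) : a = 0 ∨ b = 0 := by
  rcases Int.emod_two_eq_zero_or_one a with ha | ha
  · left
    obtain ⟨a', rfl⟩ : (2 : ℤ) ∣ a := Int.dvd_of_emod_eq_zero ha
    have hb : b % 2 = 1 := by
      by_contra hb
      have := hab.isUnit_of_dvd' (dvd_mul_right 2 a') (Int.dvd_of_emod_eq_zero (by omega))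
      norm_num [Int.isUnit_iff] at this
    have hd2 : (2 : ℤ) ∣ d := by
      refine Int.prime_two.dvd_of_dvd_pow (n := 2) (hd ▸ ?_)
      rcases hn with rfl | rfl
      · exact ⟨2 * a' ^ 2 + 2 * b ^ 2, by ring⟩
      · exact ⟨2 * a' ^ 2 + 8 * b ^ 2, by ring⟩
    obtain ⟨d', rfl⟩ := hd2
    have hb8 : b ^ 2 % 8 = 1 := sq_emod_eight_of_odd hb
    have hcop : IsCoprime b a' := hab.of_mul_left_right.symm
    rcases hn with rfl | rfl
    · rw [concordant_of_odd (.inl rfl) b a' d' c hb hcop (by linarith) (by linarith), mul_zero]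
    · have ha' : (2 : ℤ) ∣ a' := by
        by_contra h
        have h8 : a' ^ 2 % 8 = 1 :=
          sq_emod_eight_of_odd (by omega)
        have hco : c ^ 2 % 8 = 1 :=
          sq_emod_eight_of_odd (by
            rcases Int.emod_two_eq_zero_or_one c with h' | h'
            · obtain ⟨c', rfl⟩ := Int.dvd_of_emod_eq_zero h'
              ring_nf at hc; omega
            · exact h')
        ring_nf at hc; omega
      obtain ⟨e, rfl⟩ := ha'
      have hd2 : (2 : ℤ) ∣ d' := by
        refine Int.prime_two.dvd_of_dvd_pow (n := 2) ⟨2 * e ^ 2 + 2 * b ^ 2, ?_⟩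
        linarith
      obtain ⟨f, rfl⟩ := hd2
      rw [concordant_of_odd (.inr rfl) b e f c hb hcop.of_mul_right_right
        (by linarith) (by linarith), mul_zero, mul_zero]
  · exact .inr (concordant_of_odd hn a b c d ha hab hc hd)

theorem exists_int_sq_of_rat {N : ℤ} {q : ℚ} (h : (N : ℚ) = q ^ 2) : ∃ s : ℤ, N = s ^ 2 := by
  obtain ⟨s, hs⟩ := Rat.isSquare_intCast_iff.1 ⟨q, h.trans (sq q)⟩
  exact ⟨s, hs.trans (sq s).symm⟩

theorem isCoprime_num_den (q : ℚ) : IsCoprime q.num q.den :=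
  Int.isCoprime_iff_gcd_eq_one.2 q.reduced

/-- If `m² + 1` and `m² + n²` are both rational squares, where `n = 2` or `n = 4`, then `m = 0`. -/
theorem concordant_rat {n : ℤ} (hn : n = 2 ∨ n = 4) {m p q : ℚ} (hp : m ^ 2 + 1 = p ^ 2)
    (hq : m ^ 2 + n ^ 2 = q ^ 2) : m = 0 := by
  have hb : (m.den : ℚ) ≠ 0 := by exact_mod_cast m.den_ne_zero
  have hm : m * m.den = m.num := Rat.mul_den_eq_num m
  obtain ⟨c, hc⟩ := exists_int_sq_of_rat (N := m.num ^ 2 + (m.den : ℤ) ^ 2) (q := p * m.den) (by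
    push_cast; rw [← hm]; linear_combination (m.den : ℚ) ^ 2 * hp)
  obtain ⟨d, hd⟩ := exists_int_sq_of_rat (N := m.num ^ 2 + n ^ 2 * (m.den : ℤ) ^ 2)
    (q := q * m.den) (by
    push_cast; rw [← hm]; linear_combination (m.den : ℚ) ^ 2 * hq)
  rcases concordant_int hn (isCoprime_num_den m) hc hd with h | h
  · exact Rat.num_eq_zero.1 h
  · exact absurd (by exact_mod_cast h) m.den_ne_zero

theorem exists_squarefree_mul_sq {A R s : ℤ} (hA : A ≠ 0) (h : A * R = s ^ 2) :
    ∃ d M : ℤ, A = d * M ^ 2 ∧ M ≠ 0 ∧ Squarefree d ∧ d ∣ R := by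
  obtain ⟨a, M, haM, ha⟩ := Nat.sq_mul_squarefree A.natAbs
  obtain ⟨d, hd, hAd⟩ : ∃ d : ℤ, Squarefree d ∧ A = d * (M : ℤ) ^ 2 := by
    have hcast : (A.natAbs : ℤ) = (M : ℤ) ^ 2 * a := by rw [← haM]; push_cast; rfl
    rcases Int.natAbs_eq A with h1 | h1
    · exact ⟨a, Int.squarefree_natCast.2 ha, by rw [h1, hcast]; ring⟩
    · exact ⟨-a, by simpa [← Int.squarefree_natAbs] using ha, by rw [h1, hcast]; ring⟩
  have hM : (M : ℤ) ≠ 0 := by rintro h0; rw [h0] at hAd; simp at hAd; exact hA hAd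
  refine ⟨d, M, hAd, hM, hd, ?_⟩
  obtain ⟨t, rfl⟩ : (M : ℤ) ∣ s :=
    (Int.pow_dvd_pow_iff two_ne_zero).1 ⟨d * R, by rw [← h, hAd]; ring⟩
  have hdR : d * R = t ^ 2 :=
    mul_left_cancel₀ (pow_ne_zero 2 hM) (by rw [hAd] at h; linear_combination h)
  obtain ⟨e, rfl⟩ : d ∣ t := (hd.dvd_pow_iff_dvd two_ne_zero).1 (hdR ▸ dvd_mul_right d R)
  exact ⟨e ^ 2, mul_left_cancel₀ hd.ne_zero (by rw [hdR]; ring)⟩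

/-- On `Y² = X (X + 1) (X + n²)` the coordinate `X` lies in one of the square classes `±1`, `±2`. -/
theorem sq_class_of_weierstrass {n : ℤ} (hn : n = 2 ∨ n = 4) {X Y : ℚ} (hX : X ≠ 0)
    (h : Y ^ 2 = X * (X + 1) * (X + n ^ 2)) :
    ∃ m : ℚ, X = m ^ 2 ∨ X = -m ^ 2 ∨ X = 2 * m ^ 2 ∨ X = -2 * m ^ 2 := by
  have hb : (X.den : ℚ) ≠ 0 := by exact_mod_cast X.den_ne_zero
  have hm : X * X.den = X.num := Rat.mul_den_eq_num X
  have hcop := isCoprime_num_den X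
  set A : ℤ := X.num with hA
  set B : ℤ := (X.den : ℤ) with hB
  have hBq : (X.den : ℚ) = (B : ℚ) := by simp [hB]
  have hBpos : 0 < B := Int.natCast_pos.2 X.den_pos
  have hA0 : A ≠ 0 := by simpa [hA] using hX
  rw [hBq] at hm hb
  obtain ⟨s, hs⟩ := exists_int_sq_of_rat (N := A * (B * ((A + B) * (A + n ^ 2 * B))))
    (q := Y * B ^ 2) (by push_cast; rw [← hm]; linear_combination -(B : ℚ) ^ 4 * h)
  obtain ⟨d, M, hdM, -, hsq, hd⟩ := exists_squarefree_mul_sq hA0 hs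
  obtain ⟨e, he⟩ : ∃ e : ℤ, B = e ^ 2 := by
    have h1 : IsCoprime B (A * ((A + B) * (A + n ^ 2 * B))) := by
      refine hcop.symm.mul_right (IsCoprime.mul_right ?_ ?_)
      · simpa using (IsCoprime.add_mul_left_right hcop.symm 1)
      · simpa [mul_comm] using (IsCoprime.add_mul_left_right hcop.symm (n ^ 2))
    obtain ⟨e, he | he⟩ := Int.sq_of_isCoprime h1 (c := s) (by rw [← hs]; ring)
    · exact ⟨e, he⟩
    · nlinarith [sq_nonneg e]
  have hdn : d ∣ n ^ 2 := by
    have hdA : d ∣ A := hdM ▸ dvd_mul_right d _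
    have h1 : d ∣ n ^ 2 * B ^ 3 := by
      have h2 : d ∣ A * (B * (A + B + n ^ 2 * B)) := hdA.mul_right _
      have h3 := dvd_sub hd h2
      have h4 : B * ((A + B) * (A + n ^ 2 * B)) - A * (B * (A + B + n ^ 2 * B)) = n ^ 2 * B ^ 3 := by
        ring
      rwa [h4] at h3
    exact (hcop.of_isCoprime_of_dvd_left hdA).pow_right.dvd_of_dvd_mul_right h1
  have hd2 : d ∣ 2 := by
    rcases hn with rfl | rfl
    · exact (hsq.dvd_pow_iff_dvd two_ne_zero).1 hdn
    · exact (hsq.dvd_pow_iff_dvd (n := 4) (by norm_num)).1 (by norm_num at hdn ⊢; exact hdn)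
  have he0 : (e : ℚ) ≠ 0 := by rintro h0; rw [he] at hb; push_cast at hb; simp [h0] at hb
  have hXd : X = d * ((M : ℚ) / e) ^ 2 := by
    have : X = A / B := by field_simp; exact hm
    rw [this, hdM, he]; push_cast; field_simp
  refine ⟨(M : ℚ) / e, ?_⟩
  have hle := Int.le_of_dvd two_pos hd2
  have hge := Int.le_of_dvd two_pos (neg_dvd.2 hd2)
  have hge : -2 ≤ d := by omega
  interval_cases d
  · right; right; right; rw [hXd]; push_cast; ring
  · right; left; rw [hXd]; push_cast; ring
  · exact absurd hsq not_squarefree_zero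
  · left; rw [hXd]; push_cast; ring
  · right; right; left; rw [hXd]; push_cast; ring

theorem sq_class_of_quartic {n : ℤ} (hn : n = 2 ∨ n = 4) {m y : ℚ}
    (h : (m ^ 2 + 1) * (m ^ 2 + n ^ 2) = y ^ 2) :
    ∃ d p q : ℚ, m ^ 2 + 1 = d * p ^ 2 ∧ m ^ 2 + n ^ 2 = d * q ^ 2 ∧
      (d = 1 ∨ n = 4 ∧ d = 5) := by
  have hb : (m.den : ℚ) ≠ 0 := by exact_mod_cast m.den_ne_zero
  have hm : m * m.den = m.num := Rat.mul_den_eq_num m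
  have hcop := isCoprime_num_den m
  set A : ℤ := m.num with hA
  set B : ℤ := (m.den : ℤ) with hB
  have hBq : (m.den : ℚ) = (B : ℚ) := by simp [hB]
  have hBpos : 0 < B := Int.natCast_pos.2 m.den_pos
  rw [hBq] at hm hb
  obtain ⟨s, hs⟩ := exists_int_sq_of_rat (N := (A ^ 2 + B ^ 2) * (A ^ 2 + n ^ 2 * B ^ 2))
    (q := y * B ^ 2) (by push_cast; rw [← hm]; linear_combination (B : ℚ) ^ 4 * h)
  have hpos : 0 < A ^ 2 + B ^ 2 := by positivity
  obtain ⟨d, M, hdM, hM, hsq, hd⟩ := exists_squarefree_mul_sq hpos.ne' hs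
  have hdpos : 0 < d := by
    by_contra! h0
    have : d * M ^ 2 ≤ 0 := mul_nonpos_of_nonpos_of_nonneg h0 (sq_nonneg M)
    omega
  have hdAB : d ∣ A ^ 2 + B ^ 2 := hdM ▸ dvd_mul_right d _
  have hdn : d ∣ n ^ 2 - 1 := by
    obtain ⟨i, j, hij⟩ := hcop.pow (m := 2) (n := 2)
    obtain ⟨k, hk⟩ := hdAB
    obtain ⟨l, hl⟩ := hd
    exact ⟨i * (n ^ 2 * k - l) + j * (l - k), by
      linear_combination i * (n ^ 2 * hk - hl) + j * (hl - hk) - (n ^ 2 - 1) * hij⟩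
  have h3 : ¬ (3 : ℤ) ∣ d := by
    intro h3
    have h3' := h3.trans hdAB
    have hmod : ∀ z : ℤ, z ^ 2 % 3 = if z % 3 = 0 then 0 else 1 := by
      intro z
      have : z % 3 = 0 ∨ z % 3 = 1 ∨ z % 3 = 2 := by omega
      rcases this with h | h | h <;> simp [pow_two, Int.mul_emod, h]
    have hA3 := hmod A
    have hB3 := hmod B
    have hA0 : A % 3 = 0 := by by_contra h; rw [if_neg h] at hA3; split_ifs at hB3 <;> omega
    have hB0 : B % 3 = 0 := by by_contra h; rw [if_neg h] at hB3; split_ifs at hA3 <;> omega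
    have := hcop.isUnit_of_dvd' (Int.dvd_of_emod_eq_zero hA0) (Int.dvd_of_emod_eq_zero hB0)
    norm_num [Int.isUnit_iff] at this
  have hdval : d = 1 ∨ n = 4 ∧ d = 5 := by
    rcases hn with rfl | rfl
    · norm_num at hdn
      have := Int.le_of_dvd (by norm_num) hdn
      interval_cases d <;> omega
    · norm_num at hdn
      have := Int.le_of_dvd (by norm_num) hdn
      interval_cases d <;> omega
  have hMq : (M : ℚ) ≠ 0 := by exact_mod_cast hM
  have hdq : (d : ℚ) ≠ 0 := by exact_mod_cast hdpos.ne'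
  have hdMq : (A : ℚ) ^ 2 + B ^ 2 = d * M ^ 2 := by exact_mod_cast hdM
  have e1 : m ^ 2 + 1 = d * (M / B) ^ 2 := by
    field_simp; rw [← hdMq, ← hm]; ring
  refine ⟨d, M / B, y * B / (d * M), e1, ?_, by exact_mod_cast hdval⟩
  have h0 : m ^ 2 + 1 ≠ 0 := by positivity
  apply mul_left_cancel₀ h0
  rw [h]
  rw [e1]; field_simp

theorem weierstrass_two_of_sq {m Y : ℚ} (hm : m ≠ 0)
    (h : Y ^ 2 = m ^ 2 * (m ^ 2 + 1) * (m ^ 2 + 4)) : False := by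
  obtain ⟨d, p, q, hp, hq, rfl | ⟨h4, -⟩⟩ := sq_class_of_quartic (n := 2) (.inl rfl) (m := m)
    (y := Y / m) (by field_simp; push_cast; linear_combination -h)
  · exact hm (concordant_rat (.inl rfl) (by simpa using hp) (by simpa using hq))
  · norm_num at h4

theorem weierstrass_four_of_sq {m Y : ℚ} (hm : m ≠ 0)
    (h : Y ^ 2 = m ^ 2 * (m ^ 2 + 1) * (m ^ 2 + 16)) : m ^ 2 = 4 := by
  obtain ⟨d, p, q, hp, hq, rfl | ⟨-, rfl⟩⟩ := sq_class_of_quartic (n := 4) (.inr rfl) (m := m)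
    (y := Y / m) (by field_simp; push_cast; linear_combination -h)
  · exact absurd (concordant_rat (.inr rfl) (by simpa using hp) (by simpa using hq)) hm
  · by_contra hne
    have hX : m ^ 2 - 4 ≠ 0 := sub_ne_zero.2 hne
    have hp0 : p ≠ 0 := by rintro rfl; nlinarith [sq_nonneg m]
    have hq0 : q ≠ 0 := by rintro rfl; push_cast at hq; nlinarith [sq_nonneg m]
    obtain ⟨l, hY⟩ : ∃ l : ℚ, Y = 20 + l * (m ^ 2 - 4) :=
      ⟨(Y - 20) / (m ^ 2 - 4), by rw [div_mul_cancel₀ _ hX]; ring⟩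
    push_cast at hq
    -- the chord through `(4, 20)` meets the curve in a third point of abscissa `l ^ 2 - 21 - m ^ 2`
    have hroot : (l ^ 2 - 21 - m ^ 2) * m ^ 2 * 4 = (20 - 4 * l) ^ 2 := by
      apply mul_left_cancel₀ hX
      rw [hY] at h
      linear_combination 4 * h
    have hroot₁ : (l ^ 2 - 20 - m ^ 2) * (m ^ 2 + 1) * 5 = (20 - 5 * l) ^ 2 := by
      apply mul_left_cancel₀ hX
      rw [hY] at h
      linear_combination 5 * h
    have hroot₂ : (l ^ 2 - 5 - m ^ 2) * (m ^ 2 + 16) * 20 = (20 - 20 * l) ^ 2 := by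
      apply mul_left_cancel₀ hX
      rw [hY] at h
      linear_combination 20 * h
    have hx : ((20 - 4 * l) / (2 * m)) ^ 2 = l ^ 2 - 21 - m ^ 2 := by
      field_simp; linear_combination -hroot
    have hval := concordant_rat (n := 4) (.inr rfl) (m := (20 - 4 * l) / (2 * m))
      (p := (20 - 5 * l) / (5 * p)) (q := (20 - 20 * l) / (10 * q))
      (by
        rw [hx, div_pow, eq_div_iff (by positivity)]
        linear_combination hroot₁ - 5 * (l ^ 2 - 20 - m ^ 2) * hp)
      (by
        rw [hx, div_pow, eq_div_iff (by positivity)]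
        push_cast
        linear_combination hroot₂ - 20 * (l ^ 2 - 5 - m ^ 2) * hq)
    have hl5 : l = 5 := by
      rw [div_eq_zero_iff] at hval
      rcases hval with h0 | h0
      · linarith
      · exact absurd (by linarith) hm
    rw [hl5] at hroot
    apply mul_ne_zero hX (pow_ne_zero 2 hm)
    linear_combination -hroot / 4

theorem two_covering_insoluble {n : ℤ} (hn : n = 1 ∨ n = -1) {m y : ℚ}
    (h : (2 * m ^ 2 + n) * (m ^ 2 + 8 * n) = n * y ^ 2) : False := by
  have hb : (m.den : ℚ) ≠ 0 := by exact_mod_cast m.den_ne_zero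
  have hm : m * m.den = m.num := Rat.mul_den_eq_num m
  have hcop := isCoprime_num_den m
  set A : ℤ := m.num with hA
  set B : ℤ := (m.den : ℤ) with hB
  have hBq : (m.den : ℚ) = (B : ℚ) := by simp [hB]
  rw [hBq] at hm hb
  have hnn : (n : ℚ) * n = 1 := by rcases hn with rfl | rfl <;> norm_num
  obtain ⟨s, hs⟩ := exists_int_sq_of_rat
    (N := n * ((2 * A ^ 2 + n * B ^ 2) * (A ^ 2 + 8 * n * B ^ 2)))
    (q := y * B ^ 2) (by
      push_cast; rw [← hm]
      linear_combination (B : ℚ) ^ 4 * n * h + (B : ℚ) ^ 4 * y ^ 2 * hnn)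
  rcases Int.emod_two_eq_zero_or_one A with hA2 | hA2
  · obtain ⟨a, ha⟩ := Int.dvd_of_emod_eq_zero hA2
    obtain ⟨k, hk⟩ : ∃ k, B = 2 * k + 1 := by
      refine Int.odd_iff.2 ((Int.emod_two_eq_zero_or_one B).resolve_left fun hB2 => ?_)
      have := hcop.isUnit_of_dvd' (Int.dvd_of_emod_eq_zero hA2) (Int.dvd_of_emod_eq_zero hB2)
      norm_num [Int.isUnit_iff] at this
    rw [ha, hk] at hs
    obtain ⟨t, rfl⟩ : (2 : ℤ) ∣ s := Int.prime_two.dvd_of_dvd_pow (n := 2)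
      ⟨2 * (n * ((8 * a ^ 2 + n * (2 * k + 1) ^ 2) * (a ^ 2 + 2 * n * (2 * k + 1) ^ 2))), by
        rw [← hs]; ring⟩
    have h1 : n * ((8 * a ^ 2 + n * (2 * k + 1) ^ 2) * (a ^ 2 + 2 * n * (2 * k + 1) ^ 2)) =
        t ^ 2 := by
      linarith
    have h8 := congrArg (Int.cast : ℤ → ZMod 8) h1
    push_cast at h8
    generalize (a : ZMod 8) = a at h8
    generalize (k : ZMod 8) = k at h8
    generalize (t : ZMod 8) = t at h8
    rcases hn with rfl | rfl
    · revert a k t; decide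
    · revert a k t; decide
  · obtain ⟨k, hk⟩ : ∃ k, A = 2 * k + 1 := Int.odd_iff.2 hA2
    rw [hk] at hs
    have h8 := congrArg (Int.cast : ℤ → ZMod 8) hs
    push_cast at h8
    generalize (B : ZMod 8) = b at h8
    generalize (k : ZMod 8) = k at h8
    generalize (s : ZMod 8) = s at h8
    rcases hn with rfl | rfl
    · revert b k s; decide
    · revert b k s; decide

theorem weierstrass_two {X Y : ℚ} (h : Y ^ 2 = X * (X + 1) * (X + 4)) :
    X = 0 ∨ X = -1 ∨ X = -4 ∨ X = 2 ∨ X = -2 := by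
  -- translation by the point `(-1, 0)`
  have translate : ∀ X Y : ℚ, X ≠ -1 → Y ^ 2 = X * (X + 1) * (X + 4) →
      (3 * Y / (X + 1) ^ 2) ^ 2 =
        (-(X + 4) / (X + 1)) * (-(X + 4) / (X + 1) + 1) * (-(X + 4) / (X + 1) + 4) := by
    intro X Y hX h
    have : X + 1 ≠ 0 := fun h0 => hX (by linarith)
    field_simp
    linear_combination 9 * h
  have class_two : ∀ m Y : ℚ, m ≠ 0 → Y ^ 2 = 2 * m ^ 2 * (2 * m ^ 2 + 1) * (2 * m ^ 2 + 4) →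
      2 * m ^ 2 = 2 := by
    intro m Y hm h
    by_contra hne
    have hX : 2 * m ^ 2 - 2 ≠ 0 := sub_ne_zero.2 hne
    obtain ⟨l, hY⟩ : ∃ l : ℚ, Y = 6 + l * (2 * m ^ 2 - 2) :=
      ⟨(Y - 6) / (2 * m ^ 2 - 2), by rw [div_mul_cancel₀ _ hX]; ring⟩
    have hroot : (l ^ 2 - 7 - 2 * m ^ 2) * (2 * m ^ 2) * 2 = (6 - 2 * l) ^ 2 := by
      apply mul_left_cancel₀ hX
      rw [hY] at h
      linear_combination 2 * h
    have hx : ((6 - 2 * l) / (2 * m)) ^ 2 = l ^ 2 - 7 - 2 * m ^ 2 := by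
      field_simp; linear_combination -hroot
    by_cases hl3 : l = 3
    · rw [hl3] at hroot
      apply mul_ne_zero hX (pow_ne_zero 2 hm)
      linear_combination -hroot / 4
    · refine weierstrass_two_of_sq (m := (6 - 2 * l) / (2 * m))
        (Y := 6 + l * (l ^ 2 - 7 - 2 * m ^ 2 - 2)) ?_ ?_
      · exact div_ne_zero (fun h0 => hl3 (by linarith)) (by positivity)
      · rw [hx]
        linear_combination ((l ^ 2 - 7 - 2 * m ^ 2 - 2) / 2) * hroot
  by_cases hX0 : X = 0
  · exact .inl hX0
  by_cases hX1 : X = -1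
  · exact .inr (.inl hX1)
  by_cases hX4 : X = -4
  · exact .inr (.inr (.inl hX4))
  have hX1' : X + 1 ≠ 0 := fun h0 => hX1 (by linarith)
  have hX4' : X + 4 ≠ 0 := fun h0 => hX4 (by linarith)
  have ht := translate X Y hX1 h
  have hY0 : Y ≠ 0 := by
    rintro rfl
    have : X * (X + 1) * (X + 4) ≠ 0 := by positivity
    exact this (by linarith)
  obtain ⟨m, hm⟩ := sq_class_of_weierstrass (n := 2) (.inl rfl) (Y := Y) hX0
    (by push_cast; linarith)
  have hm0 : m ≠ 0 := by rintro rfl; simp at hm; exact hX0 hm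
  -- the translate of `X = -k * m ^ 2` by `(-1, 0)` is `k` times a square
  have hneg : ∀ k : ℚ, k ≠ 0 → X = -k * m ^ 2 →
      -(X + 4) / (X + 1) = k * (Y / (k * m * (X + 1))) ^ 2 := by
    intro k hk hX
    rw [div_pow, h]
    field_simp
    rw [hX]; ring
  rcases hm with rfl | hm | rfl | hm
  · exact (weierstrass_two_of_sq hm0 h).elim
  · rw [hneg 1 one_ne_zero (by rw [hm]; ring), one_mul] at ht
    exact (weierstrass_two_of_sq (by positivity) ht).elim
  · exact .inr (.inr (.inr (.inl (class_two m Y hm0 h))))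
  · have h2 := hneg 2 two_ne_zero hm
    rw [h2] at ht
    have := class_two _ _ (by positivity) ht
    rw [← h2] at this
    field_simp at this
    exact .inr (.inr (.inr (.inr (by linarith))))

theorem weierstrass_four {X Y : ℚ} (h : Y ^ 2 = X * (X + 1) * (X + 16)) :
    X = 0 ∨ X = -1 ∨ X = -16 ∨ X = 4 ∨ X = -4 := by
  by_cases hX0 : X = 0
  · exact .inl hX0
  by_cases hX1 : X = -1
  · exact .inr (.inl hX1)
  by_cases hX16 : X = -16
  · exact .inr (.inr (.inl hX16))
  have hX1' : X + 1 ≠ 0 := fun h0 => hX1 (by linarith)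
  have hX16' : X + 16 ≠ 0 := fun h0 => hX16 (by linarith)
  have hY0 : Y ≠ 0 := by
    rintro rfl
    have : X * (X + 1) * (X + 16) ≠ 0 := by positivity
    exact this (by linarith)
  obtain ⟨m, hm⟩ := sq_class_of_weierstrass (n := 4) (.inr rfl) (Y := Y) hX0
    (by push_cast; linarith)
  have hm0 : m ≠ 0 := by rintro rfl; simp at hm; exact hX0 hm
  rcases hm with rfl | hm | rfl | rfl
  · exact .inr (.inr (.inr (.inl (weierstrass_four_of_sq hm0 h))))
  · -- translation by the point `(-1, 0)`
    have h2 : -(X + 16) / (X + 1) = (Y / (m * (X + 1))) ^ 2 := by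
      rw [div_pow, h]
      field_simp
      rw [hm]
    have ht : (15 * Y / (X + 1) ^ 2) ^ 2 =
        (-(X + 16) / (X + 1)) * (-(X + 16) / (X + 1) + 1) * (-(X + 16) / (X + 1) + 16) := by
      field_simp
      linear_combination 225 * h
    rw [h2] at ht
    have := weierstrass_four_of_sq (by positivity) ht
    rw [← h2] at this
    field_simp at this
    exact .inr (.inr (.inr (.inr (by linarith))))
  · refine (two_covering_insoluble (n := 1) (.inl rfl) (m := m) (y := Y / (2 * m)) ?_).elim
    push_cast; field_simp; linear_combination -h
  · refine (two_covering_insoluble (n := -1) (.inr rfl) (m := m) (y := Y / (2 * m)) ?_).elim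
    push_cast; field_simp; linear_combination h

/-- The rational points of `w² = (r² - 1) (r² - 9)`. -/
theorem quartic_two {r w : ℚ} (h : w ^ 2 = (r + 1) * (r - 3) * ((r - 1) * (r + 3))) :
    r = 0 ∨ r = 1 ∨ r = -1 ∨ r = 3 ∨ r = -3 := by
  by_cases h1 : r = 1
  · exact .inr (.inl h1)
  have h1' : r - 1 ≠ 0 := sub_ne_zero.2 h1
  have key := weierstrass_two (X := -2 * (r + 1) / (r - 1)) (Y := 2 * w / (r - 1) ^ 2) (by
    field_simp; linear_combination 2 * h)
  rcases key with e | e | e | e | e <;> field_simp at e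
  · exact .inr (.inr (.inl (by linarith)))
  · exact .inr (.inr (.inr (.inr (by linarith))))
  · exact .inr (.inr (.inr (.inl (by linarith))))
  · exact .inl (by linarith)
  · linarith

/-- The rational points of `w² = (r + 1) (r - 3) (r² - 4)`. -/
theorem quartic_four {r w : ℚ} (h : w ^ 2 = (r + 1) * (r - 3) * (r ^ 2 - 4)) :
    r = -1 ∨ r = 3 ∨ r = 2 ∨ r = -2 ∨ r = 1 / 2 := by
  by_cases h2 : r = 2
  · exact .inr (.inr (.inl h2))
  have h2' : r - 2 ≠ 0 := sub_ne_zero.2 h2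
  have key := weierstrass_four (X := -4 * (r + 1) / (r - 2)) (Y := 12 * w / (r - 2) ^ 2) (by
    field_simp; linear_combination 144 * h)
  rcases key with e | e | e | e | e <;> field_simp at e
  · exact .inl (by linarith)
  · exact .inr (.inr (.inr (.inl (by linarith))))
  · exact .inr (.inl (by linarith))
  · exact .inr (.inr (.inr (.inr (by linarith))))
  · linarith

/-- The curve `x + 1/x - y - 1/y = 1` has no rational points with `x y ≠ 0`. -/
theorem no_rational_point {x y : ℚ} (hx : x ≠ 0) (hy : y ≠ 0)
    (h : x + x⁻¹ - y - y⁻¹ = 1) : False := by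
  have e1 : (x - x⁻¹) ^ 2 = (x + x⁻¹) ^ 2 - 4 := by field_simp; ring
  have e2 : (y - y⁻¹) ^ 2 = (x + x⁻¹ + 1) * (x + x⁻¹ - 3) := by
    have : x + x⁻¹ = y + y⁻¹ + 1 := by linarith
    rw [this]; field_simp; ring
  generalize x + x⁻¹ = r at e1 e2
  have key := quartic_four (r := r) (w := (x - x⁻¹) * (y - y⁻¹)) (by rw [mul_pow, e1, e2]; ring)
  have s1 : IsSquare (r ^ 2 - 4) := ⟨_, e1.symm.trans (sq _)⟩
  have s2 : IsSquare ((r + 1) * (r - 3)) := ⟨_, e2.symm.trans (sq _)⟩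
  rcases key with rfl | rfl | rfl | rfl | rfl <;>
    first | (refine absurd s1 ?_; norm_num; done) | (refine absurd s2 ?_; norm_num)

section QuadraticField

variable {K : Type*} [Field K] [NumberField K]

theorem exists_eq_mul_add (hdeg : Module.finrank ℚ K = 2) {u : K} (hu : ∀ q : ℚ, (q : K) ≠ u)
    (v : K) : ∃ a b : ℚ, v = a * u + b := by
  have hli : LinearIndependent ℚ ![u, 1] := by
    rw [LinearIndependent.pair_iff]
    intro s t hst
    have hs : s = 0 := by
      by_contra hs
      apply hu (-t / s)
      have hs' : (s : K) ≠ 0 := by exact_mod_cast hs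
      push_cast
      rw [div_eq_iff hs']
      simp only [Rat.smul_def] at hst
      linear_combination -hst
    subst hs
    simpa using hst
  have htop := hli.span_eq_top_of_card_eq_finrank' (by simp [hdeg])
  have hv : v ∈ Submodule.span ℚ (Set.range ![u, 1]) := htop ▸ Submodule.mem_top
  rw [Matrix.range_cons, Matrix.range_cons, Matrix.range_empty, Set.union_empty,
    Set.singleton_union, Submodule.mem_span_pair] at hv
  obtain ⟨a, b, hab⟩ := hv
  exact ⟨a, b, by rw [← hab]; simp [Rat.smul_def]⟩

theorem coeff_eq_zero {u : K} (hu : ∀ q : ℚ, (q : K) ≠ u) {a b : ℚ} (h : (a : K) * u + b = 0) :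
    a = 0 ∧ b = 0 := by
  have ha : a = 0 := by
    by_contra ha
    have ha' : (a : K) ≠ 0 := by exact_mod_cast ha
    refine hu (-b / a) ?_
    push_cast
    rw [div_eq_iff ha']
    linear_combination -h
  subst ha
  exact ⟨rfl, by simpa using h⟩

theorem mul_rational_of_sq_rational (hdeg : Module.finrank ℚ K = 2) {y z : K} {A B : ℚ}
    (hy : y ^ 2 = A) (hz : z ^ 2 = B) (hyz : (∃ q : ℚ, (q : K) = y) ↔ ∃ q : ℚ, (q : K) = z) :
    ∃ q : ℚ, q ^ 2 = A * B ∧ (q : K) = y * z := by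
  have lift : ∀ q : ℚ, (q : K) = y * z → q ^ 2 = A * B := by
    intro q hq
    have : (q : K) ^ 2 = A * B := by rw [hq, mul_pow, hy, hz]
    exact_mod_cast this
  by_cases h : ∃ q : ℚ, (q : K) = y
  · obtain ⟨p, rfl⟩ := h
    obtain ⟨q, rfl⟩ := hyz.1 ⟨p, rfl⟩
    exact ⟨p * q, lift _ (by push_cast; rfl), by push_cast; rfl⟩
  · have hz' : ¬∃ q : ℚ, (q : K) = z := fun h' => h (hyz.2 h')
    push Not at h hz'
    obtain ⟨a, b, rfl⟩ := exists_eq_mul_add hdeg h z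
    have h0 := (coeff_eq_zero h (a := 2 * a * b) (b := a ^ 2 * A + b ^ 2 - B) (by
      push_cast; linear_combination hz - a ^ 2 * hy)).1
    have ha : a ≠ 0 := by rintro rfl; exact hz' b (by simp)
    obtain rfl : b = 0 := by simpa [ha] using h0
    have : ((a * A : ℚ) : K) = y * (a * y + (0 : ℚ)) := by
      push_cast; linear_combination -(a : K) * hy
    exact ⟨_, lift _ this, this⟩

theorem isSquare_mul_of_sq_rational (hdeg : Module.finrank ℚ K = 2) {y z : K} {A B : ℚ}
    (hy : y ^ 2 = A) (hz : z ^ 2 = B) (hA : ¬IsSquare A) (hB : ¬IsSquare B) :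
    IsSquare (A * B) := by
  have lift : ∀ {x : K} {C : ℚ}, x ^ 2 = C → ¬IsSquare C → ¬∃ q : ℚ, (q : K) = x := by
    rintro x C hx hC ⟨q, rfl⟩
    exact hC ⟨q, by rw [← sq]; exact_mod_cast hx.symm⟩
  obtain ⟨q, hq, -⟩ := mul_rational_of_sq_rational hdeg hy hz
    (iff_of_false (lift hy hA) (lift hz hB))
  exact ⟨q, by rw [← hq, sq]⟩

theorem no_point_of_rational (hdeg : Module.finrank ℚ K = 2) {r : ℚ} (hr : r ≠ 0) {y₁ y₂ s : K}
    (h₁ : y₁ ^ 2 = (r + 1) * (r - 3)) (h₂ : y₂ ^ 2 = (r - 1) * (r + 3))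
    (hs : s ^ 2 = r ^ 2 - 4) : False := by
  have h₁' : y₁ ^ 2 = (((r + 1) * (r - 3) : ℚ) : K) := by push_cast; exact h₁
  have h₂' : y₂ ^ 2 = (((r - 1) * (r + 3) : ℚ) : K) := by push_cast; exact h₂
  have hs' : s ^ 2 = ((r ^ 2 - 4 : ℚ) : K) := by push_cast; exact hs
  have c₁₂ := isSquare_mul_of_sq_rational hdeg h₁' h₂'
  have c₁ := isSquare_mul_of_sq_rational hdeg h₁' hs'
  have c₂ := isSquare_mul_of_sq_rational hdeg h₂' hs'
  have key : r = 1 ∨ r = -1 ∨ r = 3 ∨ r = -3 ∨ r = 2 ∨ r = -2 ∨ r = 1 / 2 ∨ r = -1 / 2 := by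
    by_cases e₁ : (∃ q : ℚ, (q : K) = y₁) ↔ ∃ q : ℚ, (q : K) = s
    · obtain ⟨q, hq, -⟩ := mul_rational_of_sq_rational hdeg h₁' hs' e₁
      rcases quartic_four hq with h | h | h | h | h <;> simp [h]
    by_cases e₂ : (∃ q : ℚ, (q : K) = y₂) ↔ ∃ q : ℚ, (q : K) = s
    · obtain ⟨q, hq, -⟩ := mul_rational_of_sq_rational hdeg h₂' hs' e₂
      rcases quartic_four (r := -r) (w := q) (by rw [hq]; ring) with h | h | h | h | h <;>
        rw [neg_eq_iff_eq_neg] at h <;> norm_num [h]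
    rw [not_iff] at e₁ e₂
    obtain ⟨q, hq, -⟩ :=
      mul_rational_of_sq_rational hdeg h₁' h₂' (not_iff_not.1 (e₁.trans e₂.symm))
    rcases quartic_two hq with h | h | h | h | h
    · exact absurd h hr
    all_goals simp [h]
  rcases key with rfl | rfl | rfl | rfl | rfl | rfl | rfl | rfl <;>
    first
    | (refine absurd (c₁₂ ?_ ?_) ?_ <;> norm_num; done)
    | (refine absurd (c₁ ?_ ?_) ?_ <;> norm_num; done)
    | (refine absurd (c₂ ?_ ?_) ?_ <;> norm_num)

/-- The rational line through a quadratic point of `x + 1/x - y - 1/y = 1` and its conjugate meets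
the curve in a rational point, hence at `(0, 0)` or at infinity. -/
theorem proportional_or_mul_rational (hdeg : Module.finrank ℚ K = 2) {u v : K}
    (hu : ∀ q : ℚ, (q : K) ≠ u) (hv : ∀ q : ℚ, (q : K) ≠ v) (h : u + u⁻¹ - v - v⁻¹ = 1) :
    (∃ a : ℚ, v = a * u) ∨ ∃ a : ℚ, u * v = a := by
  have hu0 : u ≠ 0 := fun h0 => hu 0 (by simp [h0])
  have hv0 : v ≠ 0 := fun h0 => hv 0 (by simp [h0])
  obtain ⟨l, m, hlm⟩ := exists_eq_mul_add hdeg hu v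
  obtain ⟨t, n, htn⟩ := exists_eq_mul_add hdeg hu (u ^ 2)
  have hl : l ≠ 0 := by rintro rfl; exact hv m (by simp [hlm])
  have hG : u ^ 2 * v + v - u * v ^ 2 - u - u * v = 0 := by
    field_simp at h; linear_combination h
  by_cases hl1 : l = 1
  · right
    subst hl1
    have hm : m ≠ -1 := by
      rintro rfl
      push_cast at hlm
      rw [hlm] at hG
      have : (1 : K) = 0 := by linear_combination -hG
      exact one_ne_zero this
    have hm' : (m : K) + 1 ≠ 0 := by
      intro h0
      have h1 : m + 1 = 0 := by exact_mod_cast h0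
      exact hm (by linarith)
    refine ⟨m / (m + 1), ?_⟩
    push_cast
    rw [eq_div_iff hm']
    have : v - u = m := by rw [hlm]; push_cast; ring
    rw [← this]
    linear_combination -hG
  · left
    have hα : l - l ^ 2 ≠ 0 := by
      have : l - l ^ 2 = l * (1 - l) := by ring
      rw [this]; exact mul_ne_zero hl (sub_ne_zero.2 (Ne.symm hl1))
    -- the cubic on the line `y = l * x + m` is `(x² - t x - n) (α x + ρ)`
    set α := l - l ^ 2 with hαdef
    set ρ := m - 2 * l * m - l + α * t with hρ
    obtain ⟨e1, e0⟩ := coeff_eq_zero hu (a := α * n + ρ * t + l - m ^ 2 - 1 - m)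
      (b := m + ρ * n) (by
        rw [hlm] at hG
        rw [hρ, hαdef]
        push_cast
        linear_combination hG - ((l - l ^ 2) * u + (m - 2 * l * m - l + (l - l ^ 2) * t)) * htn)
    have hroot : ∃ x : ℚ, x ^ 2 * (l * x + m) + (l * x + m) - x * (l * x + m) ^ 2 - x -
        x * (l * x + m) = 0 := by
      obtain ⟨x, hx⟩ : ∃ x : ℚ, α * x + ρ = 0 := ⟨-ρ / α, by field_simp; ring⟩
      refine ⟨x, ?_⟩
      rw [hρ, hαdef] at hx e1 e0
      linear_combination (x ^ 2 - t * x - n) * hx + x * e1 + e0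
    obtain ⟨x, hx⟩ := hroot
    generalize hy : l * x + m = y at hx
    have hx0 : x = 0 := by
      by_contra hx0
      have hy0 : y ≠ 0 := by rintro rfl; simp at hx; exact hx0 hx
      refine no_rational_point hx0 hy0 ?_
      field_simp
      linear_combination hx
    subst hx0
    have hy0 : y = 0 := by simpa using hx
    exact ⟨l, by rw [hlm]; simp_all⟩

theorem no_proportional {u : K} (hu : ∀ q : ℚ, (q : K) ≠ u) {a b : ℚ} (ha0 : a ≠ 0) (hb0 : b ≠ 0)
    (ha : u + u⁻¹ - a * u - (a * u)⁻¹ = 1) (hb : u + u⁻¹ - b * u - (b * u)⁻¹ = -1) : False := by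
  have hu0 : u ≠ 0 := fun h0 => hu 0 (by simp [h0])
  have ha' : (a : K) ≠ 0 := by exact_mod_cast ha0
  have hb' : (b : K) ≠ 0 := by exact_mod_cast hb0
  have ea : (1 - (a : K)) * u ^ 2 + (1 - (a : K)⁻¹) = u := by
    field_simp at ha ⊢; linear_combination ha
  have eb : (1 - (b : K)) * u ^ 2 + (1 - (b : K)⁻¹) = -u := by
    field_simp at hb ⊢; linear_combination hb
  by_cases hab : 2 - a - b = 0
  · have hb2 : b = 2 - a := by linarith
    have hinv : 2 - a⁻¹ - b⁻¹ = 0 := by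
      have h1 : (2 : K) - a - b = 0 := by exact_mod_cast hab
      have : (2 : K) - (a : K)⁻¹ - (b : K)⁻¹ = 0 := by linear_combination ea + eb - u ^ 2 * h1
      exact_mod_cast this
    field_simp at hinv
    rw [hb2] at hinv
    have h1 : (a - 1) ^ 2 = 0 := by linear_combination -hinv / 2
    have ha1 : a = 1 := sub_eq_zero.1 (pow_eq_zero_iff two_ne_zero |>.1 h1)
    rw [ha1] at ea
    exact hu0 (by simpa using ea.symm)
  · have hab' : (2 : K) - a - b ≠ 0 := by exact_mod_cast hab
    have hsq : u ^ 2 = -(2 - (a : K)⁻¹ - (b : K)⁻¹) / (2 - a - b) := by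
      rw [eq_div_iff hab']; linear_combination ea + eb
    refine hu ((1 - a) * (-(2 - a⁻¹ - b⁻¹) / (2 - a - b)) + (1 - a⁻¹)) ?_
    push_cast
    rw [← hsq, ea]

theorem exists_add_inv (x y : K) (h : y ^ 2 = x ^ 2 - 4) : ∃ u : K, u + u⁻¹ = x := by
  have hmul : (x + y) / 2 * ((x - y) / 2) = 1 := by linear_combination -h / 4
  refine ⟨(x + y) / 2, ?_⟩
  rw [inv_eq_of_mul_eq_one_right hmul]
  ring

theorem exists_proportional (hdeg : Module.finrank ℚ K = 2) {u v : K} (hu : ∀ q : ℚ, (q : K) ≠ u)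
    (hv : ∀ q : ℚ, (q : K) ≠ v)
    (h : u + u⁻¹ - v - v⁻¹ = 1 ∨ v + v⁻¹ - u - u⁻¹ = 1) :
    ∃ a : ℚ, a ≠ 0 ∧ a * u + (a * u)⁻¹ = v + v⁻¹ := by
  have hu0 : u ≠ 0 := fun h0 => hu 0 (by simp [h0])
  have hv0 : v ≠ 0 := fun h0 => hv 0 (by simp [h0])
  have hcases : (∃ a : ℚ, v = a * u) ∨ ∃ a : ℚ, u * v = a := by
    rcases h with h | h
    · exact proportional_or_mul_rational hdeg hu hv h
    · rcases proportional_or_mul_rational hdeg hv hu h with ⟨a, ha⟩ | ⟨a, ha⟩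
      · have ha0 : (a : K) ≠ 0 := by rintro h0; simp [h0] at ha; exact hu0 ha
        exact .inl ⟨a⁻¹, by push_cast; rw [ha]; field_simp⟩
      · exact .inr ⟨a, by rw [← ha]; ring⟩
  rcases hcases with ⟨a, ha⟩ | ⟨a, ha⟩
  · refine ⟨a, ?_, by rw [ha]⟩
    rintro rfl; simp at ha; exact hv0 ha
  · have ha0 : (a : K) ≠ 0 := ha ▸ mul_ne_zero hu0 hv0
    refine ⟨a⁻¹, inv_ne_zero (by exact_mod_cast ha0), ?_⟩
    have : ((a⁻¹ : ℚ) : K) * u = v⁻¹ := by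
      push_cast; field_simp; exact ha
    rw [this, inv_inv, add_comm]

/-- Over a quadratic field, `(r - 1)² - 4`, `(r + 1)² - 4` and `r² - 4` are simultaneously squares only
if `r = 0`. -/
theorem no_quadratic_point (hdeg : Module.finrank ℚ K = 2) {r y₁ y₂ s : K} (hr : r ≠ 0)
    (h₁ : y₁ ^ 2 = (r + 1) * (r - 3)) (h₂ : y₂ ^ 2 = (r - 1) * (r + 3))
    (hs : s ^ 2 = r ^ 2 - 4) : False := by
  by_cases hq : ∃ q : ℚ, (q : K) = r
  · obtain ⟨q, rfl⟩ := hq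
    exact no_point_of_rational hdeg (by exact_mod_cast hr) h₁ h₂ hs
  push Not at hq
  obtain ⟨u, hu⟩ := exists_add_inv r s hs
  obtain ⟨v, hv⟩ := exists_add_inv (r - 1) y₁ (by rw [h₁]; ring)
  obtain ⟨w, hw⟩ := exists_add_inv (r + 1) y₂ (by rw [h₂]; ring)
  have hu' : ∀ q : ℚ, (q : K) ≠ u := by
    rintro q rfl; exact hq (q + q⁻¹) (by push_cast; exact hu)
  have hv' : ∀ q : ℚ, (q : K) ≠ v := by
    rintro q rfl; exact hq (q + q⁻¹ + 1) (by push_cast; linear_combination hv)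
  have hw' : ∀ q : ℚ, (q : K) ≠ w := by
    rintro q rfl; exact hq (q + q⁻¹ - 1) (by push_cast; linear_combination hw)
  obtain ⟨a, ha0, ha⟩ := exists_proportional hdeg hu' hv' (.inl (by linear_combination hu - hv))
  obtain ⟨b, hb0, hb⟩ := exists_proportional hdeg hu' hw' (.inr (by linear_combination hw - hu))
  exact no_proportional hu' ha0 hb0 (by linear_combination hu - ha - hv)
    (by linear_combination hu - hb - hw)

end QuadraticField

theorem HasPreperiodicType.exists_fixed {K : Type*} [Field K] {c α : K}
    (h : HasPreperiodicType c 1 2 α) : ∃ p : K, p ^ 2 + c = p ∧ α ^ 2 + c = -p := by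
  obtain ⟨⟨h1, -⟩, h2⟩ := h
  simp only [Function.iterate_succ, Function.iterate_zero, Function.comp_apply, id_eq, fc,
    Nat.add_one_sub_one] at h1 h2
  refine ⟨(α ^ 2 + c) ^ 2 + c, h1, ?_⟩
  have h3 : ((α ^ 2 + c) ^ 2 + c - (α ^ 2 + c)) * (α ^ 2 + c + ((α ^ 2 + c) ^ 2 + c)) = 0 := by
    linear_combination h1
  exact eq_neg_of_add_eq_zero_left ((mul_eq_zero.1 h3).resolve_left (sub_ne_zero.2 h2))

theorem HasExactPeriod.two_eq {K : Type*} [Field K] {c β : K} (h : HasExactPeriod c 2 β) :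
    β ^ 2 + β + 1 + c = 0 := by
  obtain ⟨h1, h2⟩ := h
  have h2 := h2 1 le_rfl one_lt_two
  simp only [Function.iterate_succ, Function.iterate_zero, Function.comp_apply, id_eq, fc] at h1 h2
  refine (mul_eq_zero.1 ?_).resolve_left (sub_ne_zero.2 h2)
  linear_combination h1

theorem no_two_type_1_2_with_period_2 {K : Type*} [Field K] [NumberField K]
    (hdeg : Module.finrank ℚ K = 2) (c : K) :
    ¬∃ α₁ α₂ β : K, HasPreperiodicType c 1 2 α₁ ∧ HasPreperiodicType c 1 2 α₂ ∧
      fc c α₁ ≠ fc c α₂ ∧ HasExactPeriod c 2 β := by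
  rintro ⟨α₁, α₂, β, h₁, h₂, hne, hβ⟩
  obtain ⟨p₁, hp₁, hα₁⟩ := h₁.exists_fixed
  obtain ⟨p₂, hp₂, hα₂⟩ := h₂.exists_fixed
  have hβ := hβ.two_eq
  have hp : p₁ - p₂ ≠ 0 := by
    intro h0
    apply hne
    simp only [fc]
    rw [hα₁, hα₂, sub_eq_zero.1 h0]
  have hsum : p₂ = 1 - p₁ := by
    have : (p₁ - p₂) * (p₁ + p₂ - 1) = 0 := by linear_combination hp₁ - hp₂
    linear_combination (mul_eq_zero.1 this).resolve_left hp
  subst hsum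
  exact no_quadratic_point hdeg hp (y₁ := 2 * α₁) (y₂ := 2 * α₂) (s := 2 * β + 1)
    (by linear_combination 4 * hα₁ - 4 * hp₁) (by linear_combination 4 * hα₂ - 4 * hp₁)
    (by linear_combination 4 * hβ - 4 * hp₁)
end
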